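/- Let M and M' be matroids without large uniform minors. If for every prime power q ≤ 8 the matroid M is representable over 𝔽_q exactly when M' is representable over 𝔽_q, then for every field K the matroid M is representable over K exactly when M' is representable over K. -/

import Mathlib

universe u v w

open Matroid Set

namespace Paper

/-- The deletion of the set `D` from the matroid `M`. -/
def delete {α : Type u} (M : Matroid α) (D : Set α) : Matroid α := M ↾ (M.E \ D)

/-- The contraction of the set `C` in the matroid `M`. -/
def contract {α : Type u} (M : Matroid α) (C : Set α) : Matroid α := (delete M✶ C)✶

/-- `N` is a minor of `M`: it is obtained from `M` by a sequence of deletions and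
contractions, equivalently by a single contraction followed by a single deletion. -/
def IsMinor {α : Type u} (N M : Matroid α) : Prop :=
  ∃ C D : Set α, N = delete (contract M C) D

/-- `M` is a copy of the uniform matroid `U(r,n)`: its ground set has `n` elements and its
independent sets are exactly the subsets of the ground set with at most `r` elements. -/
def IsUniform {α : Type u} (M : Matroid α) (r n : ℕ) : Prop :=
  M.E.Finite ∧ M.E.ncard = n ∧ ∀ I ⊆ M.E, (M.Indep I ↔ I.ncard ≤ r)

/-- `M` has a minor isomorphic to the uniform matroid `U(r,n)`. -/
def HasUniformMinor {α : Type u} (M : Matroid α) (r n : ℕ) : Prop :=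
  ∃ N : Matroid α, IsMinor N M ∧ IsUniform N r n

/-- `M` is without large uniform minors: no minor of `M` is isomorphic to `U(2,5)` or
`U(3,5)`. -/
def NoLargeUniformMinors {α : Type u} (M : Matroid α) : Prop :=
  ¬ HasUniformMinor M 2 5 ∧ ¬ HasUniformMinor M 3 5

/-- `M` is isomorphic to the Fano matroid `F₇`, the matroid on the seven nonzero vectors of
`(𝔽₂)³` whose independent sets are the `𝔽₂`-linearly independent subsets. -/
def IsFano {α : Type u} (M : Matroid α) : Prop :=
  ∃ f : α → (Fin 3 → ZMod 2),
    Set.BijOn f M.E {x | x ≠ 0} ∧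
    ∀ I ⊆ M.E, (M.Indep I ↔ Set.InjOn f I ∧
      LinearIndependent (ZMod 2) (fun x : (f '' I) => (x : Fin 3 → ZMod 2)))

/-- `M` has a minor isomorphic to the Fano matroid `F₇`. -/
def HasFanoMinor {α : Type u} (M : Matroid α) : Prop :=
  ∃ N : Matroid α, IsMinor N M ∧ IsFano N

/-- `M` has a minor isomorphic to the dual Fano matroid `F₇*`. -/
def HasFanoDualMinor {α : Type u} (M : Matroid α) : Prop :=
  ∃ N : Matroid α, IsMinor N M ∧ IsFano N✶

/-- `M` is representable over the field `K`: there are a `K`-vector space `V` and a map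
`φ` from the ground type to `V` such that a set `I ⊆ M.E` is independent in `M` if and only
if the family `φ` restricted to `I` is linearly independent over `K` (equivalently, `φ` is
injective on `I` and the image `φ '' I` is linearly independent). -/
def Representable {α : Type u} (M : Matroid α) (K : Type v) [Field K] : Prop :=
  ∃ (V : Type (max u v)) (_ : AddCommGroup V) (_ : Module K V) (φ : α → V),
    ∀ I ⊆ M.E, (M.Indep I ↔ LinearIndependent K (fun x : I => φ x))

end Paper

/-- The set `B` with the element `i` replaced by `j`. -/
def exch {E : Type*} (B : Set E) (i j : E) : Set E := insert j (B \ {i})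

section exch
variable {E : Type*} {B : Set E} {i j k : E}

theorem mem_exch : k ∈ exch B i j ↔ k = j ∨ (k ∈ B ∧ k ≠ i) := by simp [exch]

theorem mem_exch_self : j ∈ exch B i j := mem_exch.2 (Or.inl rfl)

theorem mem_exch_of_ne (hk : k ∈ B) (h : k ≠ i) : k ∈ exch B i j := mem_exch.2 (Or.inr ⟨hk, h⟩)

theorem notMem_exch_self (h : i ≠ j) : i ∉ exch B i j := by simp [mem_exch, h]

theorem notMem_exch (hk : k ∉ B) (h : k ≠ j) : k ∉ exch B i j := by simp [mem_exch, h, hk]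

theorem exch_exch (hi : i ∈ B) (hj : j ∉ B) : exch (exch B i j) j i = B := by
  ext k
  simp only [mem_exch]
  by_cases h1 : k = i <;> by_cases h2 : k = j <;> simp_all

theorem compl_exch (hi : i ∈ B) (hj : j ∉ B) : (exch B i j)ᶜ = exch Bᶜ j i := by
  ext k
  simp only [mem_exch, mem_compl_iff]
  by_cases h1 : k = i <;> by_cases h2 : k = j <;> simp_all

end exch

/-- A family of bases, each with its fundamental matrix, closed under pivoting. -/
structure PivotSystem (K : Type*) [Field K] (E : Type*) where
  IsBase : Set E → Prop
  /-- The entry of the fundamental matrix of a base in a given row and column. -/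
  a : Set E → E → E → K
  isBase_exch : ∀ {B i j}, IsBase B → i ∈ B → j ∉ B → a B i j ≠ 0 → IsBase (exch B i j)
  a_self : ∀ {B i j}, IsBase B → i ∈ B → j ∉ B → a B i j ≠ 0 → a (exch B i j) j i = (a B i j)⁻¹
  a_row : ∀ {B i j l}, IsBase B → i ∈ B → j ∉ B → a B i j ≠ 0 → l ∉ B → l ≠ j →
    a (exch B i j) j l = a B i l / a B i j
  a_col : ∀ {B i j k}, IsBase B → i ∈ B → j ∉ B → a B i j ≠ 0 → k ∈ B → k ≠ i →
    a (exch B i j) k i = -a B k j / a B i j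
  a_other : ∀ {B i j k l}, IsBase B → i ∈ B → j ∉ B → a B i j ≠ 0 → k ∈ B → k ≠ i → l ∉ B →
    l ≠ j → a (exch B i j) k l = a B k l - a B k j * a B i l / a B i j
  exists_row : ∀ {B B' j}, IsBase B → IsBase B' → j ∈ B' → j ∉ B → ∃ i ∈ B, i ∉ B' ∧ a B i j ≠ 0
  exists_col : ∀ {B B' i}, IsBase B → IsBase B' → i ∈ B → i ∉ B' → ∃ j ∈ B', j ∉ B ∧ a B i j ≠ 0
  finite_diff : ∀ {B B'}, IsBase B → IsBase B' → (B \ B').Finite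

namespace PivotSystem

variable {K L E : Type*} [Field K] [Field L]

theorem base_induction (σ : PivotSystem K E) {B₀ : Set E} (h₀ : σ.IsBase B₀) (P : Set E → Prop)
    (base : P B₀)
    (step : ∀ B i j, σ.IsBase B → P B → i ∈ B → j ∉ B → σ.a B i j ≠ 0 → P (exch B i j))
    {B : Set E} (hB : σ.IsBase B) : P B := by
  obtain ⟨n, hn⟩ : ∃ n, (B \ B₀).ncard = n := ⟨_, rfl⟩
  induction n generalizing B with
  | zero =>
    have hsub : B ⊆ B₀ := by
      rwa [Set.ncard_eq_zero (σ.finite_diff hB h₀), Set.sdiff_eq_empty] at hn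
    have : B = B₀ := by
      refine hsub.antisymm fun j hj => ?_
      by_contra hjB
      obtain ⟨i, hi, hi', -⟩ := σ.exists_row hB h₀ hj hjB
      exact hi' (hsub hi)
    rwa [this]
  | succ n ih =>
    have hfin := σ.finite_diff hB h₀
    obtain ⟨i, hi, hi'⟩ : (B \ B₀).Nonempty := by
      rw [← Set.ncard_pos hfin]; omega
    obtain ⟨j, hj, hjB, hne⟩ := σ.exists_col hB h₀ hi hi'
    have hB1 := σ.isBase_exch hB hi hjB hne
    have hij : i ≠ j := fun h => hi' (h ▸ hj)
    have hdiff : exch B i j \ B₀ = (B \ B₀) \ {i} := by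
      ext k
      simp only [mem_sdiff, mem_exch, mem_singleton_iff]
      by_cases hk : k = j
      · subst hk; simp [hj]
      · tauto
    have := ih hB1 (by
      rw [hdiff, Set.ncard_sdiff_singleton_of_mem (show i ∈ B \ B₀ from ⟨hi, hi'⟩)]
      omega)
    have h2 := step _ j i hB1 this mem_exch_self (notMem_exch_self hij)
      (by rw [σ.a_self hB hi hjB hne]; exact inv_ne_zero hne)
    rwa [exch_exch hi hjB] at h2

/-- Two systems with the same fundamental matrix at one base agree everywhere. -/
theorem agree_of_agree (σ τ : PivotSystem K E) {B₀ : Set E} (h₀ : σ.IsBase B₀) (h₁ : τ.IsBase B₀)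
    (h : ∀ i ∈ B₀, ∀ j ∉ B₀, σ.a B₀ i j = τ.a B₀ i j) {B : Set E} (hB : σ.IsBase B) :
    τ.IsBase B ∧ ∀ i ∈ B, ∀ j ∉ B, σ.a B i j = τ.a B i j := by
  refine σ.base_induction h₀ (fun B => τ.IsBase B ∧ ∀ i ∈ B, ∀ j ∉ B, σ.a B i j = τ.a B i j)
    ⟨h₁, h⟩ ?_ hB
  rintro B i j hσ ⟨hτ, hag⟩ hi hj hne
  have hne' : τ.a B i j ≠ 0 := hag i hi j hj ▸ hne
  refine ⟨τ.isBase_exch hτ hi hj hne', fun k hk0 l hl => ?_⟩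
  have hl' : l = i ∨ (l ∉ B ∧ l ≠ j) := by
    rw [mem_exch] at hl; push Not at hl
    by_cases h : l = i
    · exact Or.inl h
    · exact Or.inr ⟨fun h2 => h (hl.2 h2), hl.1⟩
  rcases mem_exch.1 hk0 with rfl | ⟨hk, hki⟩ <;> rcases hl' with rfl | ⟨hl, hlj⟩
  · rw [σ.a_self hσ hi hj hne, τ.a_self hτ hi hj hne', hag _ hi _ hj]
  · rw [σ.a_row hσ hi hj hne hl hlj, τ.a_row hτ hi hj hne' hl hlj, hag _ hi _ hj, hag _ hi _ hl]
  · rw [σ.a_col hσ hi hj hne hk hki, τ.a_col hτ hi hj hne' hk hki, hag _ hi _ hj, hag _ hk _ hj]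
  · rw [σ.a_other hσ hi hj hne hk hki hl hlj, τ.a_other hτ hi hj hne' hk hki hl hlj,
      hag _ hi _ hj, hag _ hk _ hj, hag _ hk _ hl, hag _ hi _ hl]

/-- The dual system. -/
def dual (σ : PivotSystem K E) : PivotSystem K E where
  IsBase B := σ.IsBase Bᶜ
  a B i j := -σ.a Bᶜ j i
  isBase_exch {B i j} hB hi hj hne := by
    rw [compl_exch hi hj]
    exact σ.isBase_exch hB hj (by simpa using hi) (by simpa using hne)
  a_self {B i j} hB hi hj hne := by
    rw [compl_exch hi hj, σ.a_self hB hj (by simpa using hi) (by simpa using hne), inv_neg]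
  a_row {B i j l} hB hi hj hne hl hlj := by
    rw [compl_exch hi hj, σ.a_col hB hj (by simpa using hi) (by simpa using hne) hl hlj]
    rw [neg_div_neg_eq, neg_div, neg_neg]
  a_col {B i j k} hB hi hj hne hk hki := by
    rw [compl_exch hi hj,
      σ.a_row hB hj (by simpa using hi) (by simpa using hne) (by simpa using hk) hki]
    rw [neg_neg, div_neg]
  a_other {B i j k l} hB hi hj hne hk hki hl hlj := by
    rw [compl_exch hi hj, σ.a_other hB hj (by simpa using hi) (by simpa using hne) hl hlj
      (by simpa using hk) hki]
    have : σ.a Bᶜ j i ≠ 0 := by simpa using hne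
    field_simp
    ring
  exists_row {B B' j} hB hB' hj hj' := by
    obtain ⟨i, hi, hi', h⟩ := σ.exists_col hB hB' hj' (by simpa using hj)
    exact ⟨i, by simpa using hi', hi, by simpa using h⟩
  exists_col {B B' i} hB hB' hi hi' := by
    obtain ⟨j, hj, hj', h⟩ := σ.exists_row hB hB' hi' (by simpa using hi)
    exact ⟨j, by simpa using hj', hj, by simpa using h⟩
  finite_diff {B B'} hB hB' := by
    refine (σ.finite_diff hB' hB).subset fun x hx => ?_
    simpa [and_comm] using hx

/-- Delete the column `x`: keep the bases avoiding `x` and turn `x` into a loop. -/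
noncomputable def del (σ : PivotSystem K E) (x : E) : PivotSystem K E := by
  classical
  exact
  { IsBase := fun B => σ.IsBase B ∧ x ∉ B
    a := fun B i j => if j = x then 0 else σ.a B i j
    isBase_exch := by
      rintro B i j ⟨hB, hx⟩ hi hj hne
      obtain ⟨hjx, hne⟩ : j ≠ x ∧ σ.a B i j ≠ 0 := by simpa using hne
      exact ⟨σ.isBase_exch hB hi hj hne, notMem_exch hx hjx.symm⟩
    a_self := by
      rintro B i j ⟨hB, hx⟩ hi hj hne
      obtain ⟨hjx, hne⟩ : j ≠ x ∧ σ.a B i j ≠ 0 := by simpa using hne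
      have hix : i ≠ x := fun h => hx (h ▸ hi)
      simp [hjx, hix, σ.a_self hB hi hj hne]
    a_row := by
      rintro B i j l ⟨hB, hx⟩ hi hj hne hl hlj
      obtain ⟨hjx, hne⟩ : j ≠ x ∧ σ.a B i j ≠ 0 := by simpa using hne
      by_cases hlx : l = x <;> simp [hjx, hlx]
      rw [σ.a_row hB hi hj hne hl hlj]
    a_col := by
      rintro B i j k ⟨hB, hx⟩ hi hj hne hk hki
      obtain ⟨hjx, hne⟩ : j ≠ x ∧ σ.a B i j ≠ 0 := by simpa using hne
      have hix : i ≠ x := fun h => hx (h ▸ hi)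
      simp [hjx, hix, σ.a_col hB hi hj hne hk hki]
    a_other := by
      rintro B i j k l ⟨hB, hx⟩ hi hj hne hk hki hl hlj
      obtain ⟨hjx, hne⟩ : j ≠ x ∧ σ.a B i j ≠ 0 := by simpa using hne
      by_cases hlx : l = x <;> simp [hjx, hlx]
      rw [σ.a_other hB hi hj hne hk hki hl hlj]
    exists_row := by
      rintro B B' j ⟨hB, hx⟩ ⟨hB', hx'⟩ hj hj'
      obtain ⟨i, hi, hi', h⟩ := σ.exists_row hB hB' hj hj'
      have hjx : j ≠ x := fun h => hx' (h ▸ hj)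
      exact ⟨i, hi, hi', by simp [hjx, h]⟩
    exists_col := by
      rintro B B' i ⟨hB, hx⟩ ⟨hB', hx'⟩ hi hi'
      obtain ⟨j, hj, hj', h⟩ := σ.exists_col hB hB' hi hi'
      have hjx : j ≠ x := fun h => hx' (h ▸ hj)
      exact ⟨j, hj, hj', by simp [hjx, h]⟩
    finite_diff := fun hB hB' => σ.finite_diff hB.1 hB'.1 }

theorem del_a_self {σ : PivotSystem K E} {x : E} {B : Set E} {i : E} :
    (σ.del x).a B i x = 0 := if_pos rfl

theorem del_a {σ : PivotSystem K E} {x : E} {B : Set E} {i j : E} (h : j ≠ x) :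
    (σ.del x).a B i j = σ.a B i j := if_neg h

/-- Keep the bases that differ from `B₀` only inside `S`, and turn the elements outside `S`
into loops and coloops. -/
noncomputable def restr (σ : PivotSystem K E) (S B₀ : Set E) : PivotSystem K E := by
  classical
  exact
  { IsBase := fun B => σ.IsBase B ∧ B \ S = B₀ \ S
    a := fun B i j => if i ∈ S ∧ j ∈ S then σ.a B i j else 0
    isBase_exch := by
      rintro B i j ⟨hB, hx⟩ hi hj hne
      obtain ⟨⟨hiS, hjS⟩, hne⟩ : (i ∈ S ∧ j ∈ S) ∧ σ.a B i j ≠ 0 := by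
        simpa [and_assoc] using hne
      refine ⟨σ.isBase_exch hB hi hj hne, ?_⟩
      rw [← hx]
      ext k
      simp only [mem_sdiff, mem_exch]
      constructor
      · rintro ⟨rfl | h, h'⟩
        · exact absurd hjS h'
        · exact ⟨h.1, h'⟩
      · rintro ⟨h, h'⟩
        exact ⟨Or.inr ⟨h, fun e => h' (e ▸ hiS)⟩, h'⟩
    a_self := by
      rintro B i j ⟨hB, hx⟩ hi hj hne
      obtain ⟨⟨hiS, hjS⟩, hne⟩ : (i ∈ S ∧ j ∈ S) ∧ σ.a B i j ≠ 0 := by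
        simpa [and_assoc] using hne
      simp [hiS, hjS, σ.a_self hB hi hj hne]
    a_row := by
      rintro B i j l ⟨hB, hx⟩ hi hj hne hl hlj
      obtain ⟨⟨hiS, hjS⟩, hne⟩ : (i ∈ S ∧ j ∈ S) ∧ σ.a B i j ≠ 0 := by
        simpa [and_assoc] using hne
      by_cases hlx : l ∈ S <;> simp [hiS, hjS, hlx]
      rw [σ.a_row hB hi hj hne hl hlj]
    a_col := by
      rintro B i j k ⟨hB, hx⟩ hi hj hne hk hki
      obtain ⟨⟨hiS, hjS⟩, hne⟩ : (i ∈ S ∧ j ∈ S) ∧ σ.a B i j ≠ 0 := by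
        simpa [and_assoc] using hne
      by_cases hlx : k ∈ S <;> simp [hiS, hjS, hlx]
      rw [σ.a_col hB hi hj hne hk hki]
    a_other := by
      rintro B i j k l ⟨hB, hx⟩ hi hj hne hk hki hl hlj
      obtain ⟨⟨hiS, hjS⟩, hne⟩ : (i ∈ S ∧ j ∈ S) ∧ σ.a B i j ≠ 0 := by
        simpa [and_assoc] using hne
      by_cases hkx : k ∈ S <;> by_cases hlx : l ∈ S <;> simp [hiS, hjS, hkx, hlx]
      rw [σ.a_other hB hi hj hne hk hki hl hlj]
    exists_row := by
      rintro B B' j ⟨hB, hx⟩ ⟨hB', hx'⟩ hj hj'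
      obtain ⟨i, hi, hi', h⟩ := σ.exists_row hB hB' hj hj'
      have key : ∀ k, k ∉ S → (k ∈ B ↔ k ∈ B') := fun k hk => by
        have := Set.ext_iff.1 (hx.trans hx'.symm) k
        simpa [hk] using this
      have hjS : j ∈ S := by by_contra h; exact hj' ((key j h).2 hj)
      have hiS : i ∈ S := by by_contra h; exact hi' ((key i h).1 hi)
      exact ⟨i, hi, hi', by simp [hiS, hjS, h]⟩
    exists_col := by
      rintro B B' i ⟨hB, hx⟩ ⟨hB', hx'⟩ hi hi'
      obtain ⟨j, hj, hj', h⟩ := σ.exists_col hB hB' hi hi'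
      have key : ∀ k, k ∉ S → (k ∈ B ↔ k ∈ B') := fun k hk => by
        have := Set.ext_iff.1 (hx.trans hx'.symm) k
        simpa [hk] using this
      have hjS : j ∈ S := by by_contra h; exact hj' ((key j h).2 hj)
      have hiS : i ∈ S := by by_contra h; exact hi' ((key i h).1 hi)
      exact ⟨j, hj, hj', by simp [hiS, hjS, h]⟩
    finite_diff := fun hB hB' => σ.finite_diff hB.1 hB'.1 }

theorem restr_a {σ : PivotSystem K E} {S B₀ B : Set E} {i j : E} (hi : i ∈ S) (hj : j ∈ S) :
    (σ.restr S B₀).a B i j = σ.a B i j := if_pos ⟨hi, hj⟩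

theorem restr_a_eq_zero {σ : PivotSystem K E} {S B₀ B : Set E} {i j : E}
    (h : ¬ (i ∈ S ∧ j ∈ S)) : (σ.restr S B₀).a B i j = 0 := if_neg h

/-- Rescale the elements by the factors `t`. -/
def scale (σ : PivotSystem K E) (t : E → K) (ht : ∀ e, t e ≠ 0) : PivotSystem K E where
  IsBase := σ.IsBase
  a B i j := σ.a B i j * t j / t i
  isBase_exch {B i j} hB hi hj hne := σ.isBase_exch hB hi hj (by simpa [ht] using hne)
  a_self {B i j} hB hi hj hne := by
    have hne : σ.a B i j ≠ 0 := by simpa [ht] using hne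
    rw [σ.a_self hB hi hj hne]
    have := ht i; have := ht j
    field_simp
  a_row {B i j l} hB hi hj hne hl hlj := by
    have hne : σ.a B i j ≠ 0 := by simpa [ht] using hne
    rw [σ.a_row hB hi hj hne hl hlj]
    have := ht i; have := ht j
    field_simp
  a_col {B i j k} hB hi hj hne hk hki := by
    have hne : σ.a B i j ≠ 0 := by simpa [ht] using hne
    rw [σ.a_col hB hi hj hne hk hki]
    have := ht i; have := ht j; have := ht k
    field_simp
  a_other {B i j k l} hB hi hj hne hk hki hl hlj := by
    have hne : σ.a B i j ≠ 0 := by simpa [ht] using hne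
    rw [σ.a_other hB hi hj hne hk hki hl hlj]
    have := ht i; have := ht j; have := ht k
    field_simp
  exists_row hB hB' hj hj' := by
    obtain ⟨i, hi, hi', h⟩ := σ.exists_row hB hB' hj hj'
    exact ⟨i, hi, hi', by simp [h, ht]⟩
  exists_col hB hB' hj hj' := by
    obtain ⟨i, hi, hi', h⟩ := σ.exists_col hB hB' hj hj'
    exact ⟨i, hi, hi', by simp [h, ht]⟩
  finite_diff hB hB' := σ.finite_diff hB hB'

end PivotSystem

/-- A map between fields that respects the action of the symmetric group generated by
`x ↦ 1 - x` and `x ↦ x⁻¹`. -/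
structure IsCrossMap {K L : Type*} [Field K] [Field L] (u : K → L) : Prop where
  map_zero : u 0 = 0
  eq_zero : ∀ {x}, u x = 0 → x = 0
  map_one_sub : ∀ x, u (1 - x) = 1 - u x
  map_inv : ∀ x, u x⁻¹ = (u x)⁻¹
  two_eq_zero : (2 : K) = 0 → (2 : L) = 0

namespace IsCrossMap

variable {K L : Type*} [Field K] [Field L] {u : K → L} (hu : IsCrossMap u)
include hu

theorem map_one : u 1 = 1 := by
  simpa [hu.map_zero] using hu.map_one_sub 0

theorem eq_zero_iff {x : K} : u x = 0 ↔ x = 0 := ⟨hu.eq_zero, fun h => h ▸ hu.map_zero⟩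

theorem eq_one_iff {x : K} : u x = 1 ↔ x = 1 := by
  have := hu.eq_zero_iff (x := 1 - x)
  rw [hu.map_one_sub, sub_eq_zero, sub_eq_zero] at this
  rw [eq_comm, this, eq_comm]

theorem map_neg_one : u (-1) = -1 := by
  by_cases h2 : (2 : K) = 0
  · have h1 : (-1 : K) = 1 := by linear_combination -h2
    rw [h1, hu.map_one]
    linear_combination hu.two_eq_zero h2
  · have h3 : (1 - 2⁻¹ : K) = 2⁻¹ := by field_simp; norm_num
    have h4 := hu.map_one_sub 2⁻¹
    rw [h3] at h4
    have h5 : u 2⁻¹ ≠ 0 := fun h => inv_ne_zero h2 (hu.eq_zero h)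
    have h6 : u 2 * u 2⁻¹ = 1 := by
      have h7 := hu.map_inv 2⁻¹
      rw [inv_inv] at h7
      rw [h7, inv_mul_cancel₀ h5]
    have h8 : u (1 - 2) = 1 - u 2 := hu.map_one_sub 2
    rw [show (1 - 2 : K) = -1 by norm_num] at h8
    rw [h8]
    have h9 : (u 2 - 2) * u 2⁻¹ = 0 := by linear_combination h6 - h4
    have := (mul_eq_zero.1 h9).resolve_right h5
    linear_combination -this

end IsCrossMap

section crossRatio

variable {K L E : Type*} [Field K] [Field L]

/-- The cross ratio of a two by two submatrix. -/
def crossRatio (A : E → E → K) (i k j l : E) : K := A i j * A k l / (A i l * A k j)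

/-- The map `u` carries the cross ratio of a submatrix of `A` to the one of `A'`. -/
def CrossAgree (u : K → L) (A : E → E → K) (A' : E → E → L) (i k j l : E) : Prop :=
  u (crossRatio A i k j l) = crossRatio A' i k j l

theorem crossRatio_swap_row (A : E → E → K) (i k j l : E) :
    crossRatio A k i j l = (crossRatio A i k j l)⁻¹ := by
  simp only [crossRatio, inv_div]; ring

theorem crossRatio_swap_col (A : E → E → K) (i k j l : E) :
    crossRatio A i k l j = (crossRatio A i k j l)⁻¹ := by
  simp only [crossRatio, inv_div]

theorem crossRatio_transpose (A : E → E → K) (i k j l : E) :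
    crossRatio (fun a b => A b a) j l i k = crossRatio A i k j l := by
  simp only [crossRatio]
  ring

variable {u : K → L} {A : E → E → K} {A' : E → E → L} {i k j l m : E}

theorem CrossAgree.swap_row (hu : IsCrossMap u) (h : CrossAgree u A A' i k j l) :
    CrossAgree u A A' k i j l := by
  rw [CrossAgree, crossRatio_swap_row, hu.map_inv, h, ← crossRatio_swap_row]

theorem CrossAgree.swap_col (hu : IsCrossMap u) (h : CrossAgree u A A' i k j l) :
    CrossAgree u A A' i k l j := by
  rw [CrossAgree, crossRatio_swap_col, hu.map_inv, h, ← crossRatio_swap_col]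

theorem crossAgree_of_eq_zero (hu : IsCrossMap u)
    (h : A i j * A k l * (A i l * A k j) = 0) (h' : A' i j * A' k l * (A' i l * A' k j) = 0) :
    CrossAgree u A A' i k j l := by
  have h1 : crossRatio A i k j l = 0 := div_eq_zero_iff.2 (by simpa using h)
  have h2 : crossRatio A' i k j l = 0 := div_eq_zero_iff.2 (by simpa using h')
  rw [CrossAgree, h1, h2, hu.map_zero]

theorem crossAgree_self_row (hu : IsCrossMap u) (h : A i j = 0 ↔ A' i j = 0)
    (h' : A i l = 0 ↔ A' i l = 0) : CrossAgree u A A' i i j l := by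
  by_cases h0 : A i j * A i l = 0
  · refine crossAgree_of_eq_zero hu (by rw [h0, zero_mul]) ?_
    have : A' i j * A' i l = 0 := by rw [mul_eq_zero] at h0 ⊢; tauto
    rw [this, zero_mul]
  · have h0' : A' i j * A' i l ≠ 0 := by rw [mul_eq_zero] at h0; rw [Ne, mul_eq_zero]; tauto
    rw [CrossAgree, crossRatio, crossRatio, mul_comm (A i l), mul_comm (A' i l), div_self h0,
      div_self h0', hu.map_one]

theorem crossAgree_self_col (hu : IsCrossMap u) (h : A i j = 0 ↔ A' i j = 0)
    (h' : A k j = 0 ↔ A' k j = 0) : CrossAgree u A A' i k j j := by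
  by_cases h0 : A i j * A k j = 0
  · refine crossAgree_of_eq_zero hu (by rw [h0, zero_mul]) ?_
    have : A' i j * A' k j = 0 := by rw [mul_eq_zero] at h0 ⊢; tauto
    rw [this, zero_mul]
  · have h0' : A' i j * A' k j ≠ 0 := by rw [mul_eq_zero] at h0; rw [Ne, mul_eq_zero]; tauto
    rw [CrossAgree, crossRatio, crossRatio, div_self h0, div_self h0', hu.map_one]

theorem crossRatio_eq_one (hj : A k j ≠ 0) (hl : A i l ≠ 0) :
    crossRatio A i k j l = 1 ↔ A i j * A k l = A i l * A k j := by
  rw [crossRatio, div_eq_one_iff_eq (mul_ne_zero hl hj)]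

/-- Three cross ratios `x, y, y / x`, one of which is one. -/
theorem IsCrossMap.map_div (hu : IsCrossMap u) {x y : K} (hx : x ≠ 0)
    (h : x = 1 ∨ y = 1 ∨ x = y) : u (y / x) = u y / u x := by
  rcases h with rfl | rfl | rfl
  · simp [hu.map_one]
  · simp [hu.map_one, hu.map_inv]
  · rw [div_self hx, div_self (fun h => hx (hu.eq_zero h)), hu.map_one]

theorem CrossAgree.trans_row (hu : IsCrossMap u) {i₁ i₂ i₃ : E}
    (hA : ∀ i, i = i₁ ∨ i = i₂ ∨ i = i₃ → A i j ≠ 0 ∧ A i l ≠ 0)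
    (hA' : ∀ i, i = i₁ ∨ i = i₂ ∨ i = i₃ → A' i j ≠ 0 ∧ A' i l ≠ 0)
    (h : A i₁ j * A i₂ l = A i₁ l * A i₂ j ∨ A i₁ j * A i₃ l = A i₁ l * A i₃ j ∨
      A i₂ j * A i₃ l = A i₂ l * A i₃ j)
    (h₁ : CrossAgree u A A' i₁ i₂ j l) (h₂ : CrossAgree u A A' i₁ i₃ j l) :
    CrossAgree u A A' i₂ i₃ j l := by
  simp only [forall_eq_or_imp, forall_eq] at hA hA'
  obtain ⟨⟨a1, b1⟩, ⟨a2, b2⟩, a3, b3⟩ := hA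
  obtain ⟨⟨a1', b1'⟩, ⟨a2', b2'⟩, a3', b3'⟩ := hA'
  have e : crossRatio A i₂ i₃ j l = crossRatio A i₁ i₃ j l / crossRatio A i₁ i₂ j l := by
    simp only [crossRatio]; field_simp
  have e' : crossRatio A' i₂ i₃ j l = crossRatio A' i₁ i₃ j l / crossRatio A' i₁ i₂ j l := by
    simp only [crossRatio]; field_simp
  rw [CrossAgree, e, hu.map_div, h₁, h₂, e']
  · simp [crossRatio, *]
  · rw [crossRatio_eq_one a2 b1, crossRatio_eq_one a3 b1]
    refine h.imp_right (Or.imp_right fun h => ?_)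
    simp only [crossRatio]
    rw [div_eq_div_iff (mul_ne_zero b1 a2) (mul_ne_zero b1 a3)]
    linear_combination (-A i₁ j * A i₁ l) * h

theorem CrossAgree.trans_col (hu : IsCrossMap u) {j₁ j₂ j₃ : E}
    (hA : ∀ j, j = j₁ ∨ j = j₂ ∨ j = j₃ → A i j ≠ 0 ∧ A k j ≠ 0)
    (hA' : ∀ j, j = j₁ ∨ j = j₂ ∨ j = j₃ → A' i j ≠ 0 ∧ A' k j ≠ 0)
    (h : A i j₁ * A k j₂ = A i j₂ * A k j₁ ∨ A i j₁ * A k j₃ = A i j₃ * A k j₁ ∨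
      A i j₂ * A k j₃ = A i j₃ * A k j₂)
    (h₁ : CrossAgree u A A' i k j₁ j₂) (h₂ : CrossAgree u A A' i k j₁ j₃) :
    CrossAgree u A A' i k j₂ j₃ := by
  rw [CrossAgree, ← crossRatio_transpose A, ← crossRatio_transpose A'] at h₁ h₂ ⊢
  refine CrossAgree.trans_row hu (A := fun a b => A b a) (A' := fun a b => A' b a) hA hA' ?_ h₁ h₂
  exact h.imp (fun h => by linear_combination h)
    (Or.imp (fun h => by linear_combination h) (fun h => by linear_combination h))

end crossRatio

namespace PivotSystem

variable {K L E : Type*} [Field K] [Field L]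

/-- No base shows a generic two by three or three by two submatrix. -/
def WLUM (σ : PivotSystem K E) : Prop := ∀ ⦃B⦄, σ.IsBase B →
  (∀ i₁ ∈ B, ∀ i₂ ∈ B, ∀ i₃ ∈ B, ∀ j ∉ B, ∀ l ∉ B,
    (∀ i, i = i₁ ∨ i = i₂ ∨ i = i₃ → σ.a B i j ≠ 0 ∧ σ.a B i l ≠ 0) →
    σ.a B i₁ j * σ.a B i₂ l = σ.a B i₁ l * σ.a B i₂ j ∨
    σ.a B i₁ j * σ.a B i₃ l = σ.a B i₁ l * σ.a B i₃ j ∨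
    σ.a B i₂ j * σ.a B i₃ l = σ.a B i₂ l * σ.a B i₃ j) ∧
  (∀ i ∈ B, ∀ k ∈ B, ∀ j₁ ∉ B, ∀ j₂ ∉ B, ∀ j₃ ∉ B,
    (∀ j, j = j₁ ∨ j = j₂ ∨ j = j₃ → σ.a B i j ≠ 0 ∧ σ.a B k j ≠ 0) →
    σ.a B i j₁ * σ.a B k j₂ = σ.a B i j₂ * σ.a B k j₁ ∨
    σ.a B i j₁ * σ.a B k j₃ = σ.a B i j₃ * σ.a B k j₁ ∨
    σ.a B i j₂ * σ.a B k j₃ = σ.a B i j₃ * σ.a B k j₂)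

/-- The matrices of two systems at `B` have the same support outside the columns in `X` and
corresponding cross ratios there. -/
structure GoodOff (u : K → L) (σ : PivotSystem K E) (σ' : PivotSystem L E) (X B : Set E) :
    Prop where
  supp : ∀ i ∈ B, ∀ j ∉ B, j ∉ X → (σ.a B i j = 0 ↔ σ'.a B i j = 0)
  cross : ∀ i ∈ B, ∀ k ∈ B, ∀ j ∉ B, ∀ l ∉ B, j ∉ X → l ∉ X →
    CrossAgree u (σ.a B) (σ'.a B) i k j l

/-- `σ'` is a lift of `σ` along `u`. -/
def Lift (u : K → L) (σ : PivotSystem K E) (σ' : PivotSystem L E) : Prop :=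
  ∀ ⦃B⦄, σ.IsBase B → σ'.IsBase B ∧ GoodOff u σ σ' ∅ B

variable {u : K → L} {σ : PivotSystem K E} {σ' : PivotSystem L E} {B : Set E} {i j k l : E}

theorem crossRatio_exch (hB : σ.IsBase B) (hi : i ∈ B) (hj : j ∉ B) (hne : σ.a B i j ≠ 0)
    (hk : k ∈ B) (hki : k ≠ i) (hl : l ∉ B) (hlj : l ≠ j) (h1 : σ.a B i l ≠ 0)
    (h2 : σ.a B k j ≠ 0) :
    crossRatio (σ.a (exch B i j)) j k i l = 1 - crossRatio (σ.a B) i k j l := by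
  simp only [crossRatio, σ.a_self hB hi hj hne, σ.a_row hB hi hj hne hl hlj,
    σ.a_col hB hi hj hne hk hki, σ.a_other hB hi hj hne hk hki hl hlj]
  field_simp
  ring

theorem crossAgree_pivot_iff (hu : IsCrossMap u) (hB : σ.IsBase B) (hB' : σ'.IsBase B)
    (hi : i ∈ B) (hj : j ∉ B) (hne : σ.a B i j ≠ 0) (hne' : σ'.a B i j ≠ 0)
    (hk : k ∈ B) (hki : k ≠ i) (hl : l ∉ B) (hlj : l ≠ j)
    (hil : σ.a B i l = 0 ↔ σ'.a B i l = 0) (hkj : σ.a B k j = 0 ↔ σ'.a B k j = 0) :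
    CrossAgree u (σ.a (exch B i j)) (σ'.a (exch B i j)) j k i l ↔
      CrossAgree u (σ.a B) (σ'.a B) i k j l := by
  by_cases h0 : σ.a B i l * σ.a B k j = 0
  · have h0' : σ'.a B i l * σ'.a B k j = 0 := by rw [mul_eq_zero] at h0 ⊢; tauto
    refine iff_of_true (crossAgree_of_eq_zero hu ?_ ?_) (crossAgree_of_eq_zero hu ?_ ?_)
    · rw [σ.a_row hB hi hj hne hl hlj, σ.a_col hB hi hj hne hk hki]
      linear_combination (σ.a (exch B i j) j i * σ.a (exch B i j) k l * -1 /
        (σ.a B i j * σ.a B i j)) * h0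
    · rw [σ'.a_row hB' hi hj hne' hl hlj, σ'.a_col hB' hi hj hne' hk hki]
      linear_combination (σ'.a (exch B i j) j i * σ'.a (exch B i j) k l * -1 /
        (σ'.a B i j * σ'.a B i j)) * h0'
    · rw [h0, mul_zero]
    · rw [h0', mul_zero]
  · have h0' : σ'.a B i l * σ'.a B k j ≠ 0 := by rw [mul_eq_zero] at h0; rw [Ne, mul_eq_zero]; tauto
    rw [← Ne, mul_ne_zero_iff] at h0
    rw [mul_ne_zero_iff] at h0'
    rw [CrossAgree, CrossAgree, crossRatio_exch hB hi hj hne hk hki hl hlj h0.1 h0.2,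
      crossRatio_exch hB' hi hj hne' hk hki hl hlj h0'.1 h0'.2, hu.map_one_sub, sub_right_inj]

theorem supp_pivot (hu : IsCrossMap u) (hB : σ.IsBase B) (hB' : σ'.IsBase B)
    (hi : i ∈ B) (hj : j ∉ B) (hne : σ.a B i j ≠ 0) (hne' : σ'.a B i j ≠ 0)
    (hk : k ∈ B) (hki : k ≠ i) (hl : l ∉ B) (hlj : l ≠ j)
    (hil : σ.a B i l = 0 ↔ σ'.a B i l = 0) (hkj : σ.a B k j = 0 ↔ σ'.a B k j = 0)
    (hkl : σ.a B k l = 0 ↔ σ'.a B k l = 0)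
    (h : CrossAgree u (σ.a B) (σ'.a B) i k j l) :
    σ.a (exch B i j) k l = 0 ↔ σ'.a (exch B i j) k l = 0 := by
  rw [σ.a_other hB hi hj hne hk hki hl hlj, σ'.a_other hB' hi hj hne' hk hki hl hlj]
  by_cases h0 : σ.a B i l * σ.a B k j = 0
  · have h0' : σ'.a B i l * σ'.a B k j = 0 := by rw [mul_eq_zero] at h0 ⊢; tauto
    rw [mul_comm, h0, mul_comm, h0', zero_div, zero_div, sub_zero, sub_zero, hkl]
  · have h0' : σ'.a B i l * σ'.a B k j ≠ 0 := by rw [mul_eq_zero] at h0; rw [Ne, mul_eq_zero]; tauto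
    rw [← Ne, mul_ne_zero_iff] at h0
    rw [mul_ne_zero_iff] at h0'
    have e1 := crossRatio_eq_one (A := σ.a B) h0.2 h0.1 (i := i) (j := j)
    have e2 := crossRatio_eq_one (A := σ'.a B) h0'.2 h0'.1 (i := i) (j := j)
    rw [← h, hu.eq_one_iff, e1] at e2
    rw [sub_eq_zero, sub_eq_zero, eq_div_iff hne, eq_div_iff hne', mul_comm, mul_comm (σ.a B k j),
      e2, mul_comm, mul_comm (σ'.a B k j)]

/-- A base with matching supports and cross ratios off `X` still has matching supports after a
pivot off `X`. -/
theorem GoodOff.supp_exch (hu : IsCrossMap u) {X : Set E} (h : GoodOff u σ σ' X B)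
    (hB : σ.IsBase B) (hB' : σ'.IsBase B) (hi : i ∈ B) (hj : j ∉ B) (hjX : j ∉ X)
    (hne : σ.a B i j ≠ 0) (hk : k ∈ exch B i j) (hl : l ∉ exch B i j) (hlX : l ∉ X) :
    σ.a (exch B i j) k l = 0 ↔ σ'.a (exch B i j) k l = 0 := by
  have hne' : σ'.a B i j ≠ 0 := fun h0 => hne ((h.supp i hi j hj hjX).2 h0)
  have hl' : l = i ∨ (l ∉ B ∧ l ≠ j) := by
    rw [mem_exch] at hl; push Not at hl
    by_cases h : l = i
    · exact Or.inl h
    · exact Or.inr ⟨fun h2 => h (hl.2 h2), hl.1⟩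
  rcases mem_exch.1 hk with rfl | ⟨hkB, hki⟩ <;> rcases hl' with rfl | ⟨hlB, hlj⟩
  · rw [σ.a_self hB hi hj hne, σ'.a_self hB' hi hj hne']
    simp [hne, hne']
  · rw [σ.a_row hB hi hj hne hlB hlj, σ'.a_row hB' hi hj hne' hlB hlj]
    simp [hne, hne', h.supp i hi l hlB hlX]
  · rw [σ.a_col hB hi hj hne hkB hki, σ'.a_col hB' hi hj hne' hkB hki]
    simp [hne, hne', h.supp k hkB j hj hjX]
  · exact supp_pivot hu hB hB' hi hj hne hne' hkB hki hlB hlj (h.supp i hi l hlB hlX)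
      (h.supp k hkB j hj hjX) (h.supp k hkB l hlB hlX) (h.cross i hi k hkB j hj l hlB hjX hlX)

theorem notMem_exch_iff (hi : i ∈ B) (hj : j ∉ B) :
    l ∉ exch B i j ↔ l = i ∨ (l ∉ B ∧ l ≠ j) := by
  rw [mem_exch]
  by_cases h : l = i
  · subst h; simp [show l ≠ j from fun h => hj (h ▸ hi)]
  · simp [h]; tauto

end PivotSystem

theorem CrossAgree.of_ne_zero {K L E : Type*} [Field K] [Field L] {u : K → L} {A : E → E → K}
    {A' : E → E → L} {i k j l : E} (hu : IsCrossMap u)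
    (h₁ : A i j = 0 ↔ A' i j = 0) (h₂ : A i l = 0 ↔ A' i l = 0) (h₃ : A k j = 0 ↔ A' k j = 0)
    (h₄ : A k l = 0 ↔ A' k l = 0)
    (h : A i j ≠ 0 → A i l ≠ 0 → A k j ≠ 0 → A k l ≠ 0 → CrossAgree u A A' i k j l) :
    CrossAgree u A A' i k j l := by
  by_cases h0 : A i j * A k l * (A i l * A k j) = 0
  · refine crossAgree_of_eq_zero hu h0 ?_
    rw [mul_eq_zero, mul_eq_zero, mul_eq_zero] at h0 ⊢
    rwa [← h₁, ← h₂, ← h₃, ← h₄]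
  · rw [mul_eq_zero, mul_eq_zero, mul_eq_zero] at h0
    exact h (by tauto) (by tauto) (by tauto) (by tauto)

namespace PivotSystem

section entries

variable {K E : Type*} [Field K] {σ : PivotSystem K E} {B : Set E} {i j k l p q x y z b : E}

theorem a_other_of_row_eq_zero (hB : σ.IsBase B) (hi : i ∈ B) (hj : j ∉ B) (hne : σ.a B i j ≠ 0)
    (hk : k ∈ B) (hki : k ≠ i) (hl : l ∉ B) (hlj : l ≠ j) (h : σ.a B i l = 0) :
    σ.a (exch B i j) k l = σ.a B k l := by
  rw [σ.a_other hB hi hj hne hk hki hl hlj, h]; simp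

theorem a_other_of_col_eq_zero (hB : σ.IsBase B) (hi : i ∈ B) (hj : j ∉ B) (hne : σ.a B i j ≠ 0)
    (hk : k ∈ B) (hki : k ≠ i) (hl : l ∉ B) (hlj : l ≠ j) (h : σ.a B k j = 0) :
    σ.a (exch B i j) k l = σ.a B k l := by
  rw [σ.a_other hB hi hj hne hk hki hl hlj, h]; simp

/-- Pivoting on `(i, j)` turns the column `j` into the column `i`. -/
theorem crossRatio_exch_of_row_eq_zero (hB : σ.IsBase B) (hi : i ∈ B) (hj : j ∉ B)
    (hne : σ.a B i j ≠ 0) (hp : p ∈ B) (hpi : p ≠ i) (hq : q ∈ B) (hqi : q ≠ i) (hl : l ∉ B)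
    (hlj : l ≠ j) (h : σ.a B i l = 0) :
    crossRatio (σ.a (exch B i j)) p q l i = crossRatio (σ.a B) p q l j := by
  simp only [crossRatio, a_other_of_row_eq_zero hB hi hj hne hp hpi hl hlj h,
    a_other_of_row_eq_zero hB hi hj hne hq hqi hl hlj h, σ.a_col hB hi hj hne hp hpi,
    σ.a_col hB hi hj hne hq hqi]
  field_simp

theorem crossRatio_exch_of_zigzag (hB : σ.IsBase B) (hx : x ∈ B) (hz : z ∉ B)
    (hxz : σ.a B x z ≠ 0) (hp : p ∈ B) (hpx : p ≠ x) (hq : q ∈ B) (hqx : q ≠ x) (hy : y ∉ B)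
    (hyz : y ≠ z) (hb : b ∉ B) (hbz : b ≠ z) (hxb : σ.a B x b = 0) (hqz : σ.a B q z = 0)
    (hpy : σ.a B p y ≠ 0) :
    crossRatio (σ.a (exch B x z)) p q y b =
      (1 - crossRatio (σ.a B) x p y z) * crossRatio (σ.a B) p q y b := by
  simp only [crossRatio, a_other_of_row_eq_zero hB hx hz hxz hp hpx hb hbz hxb,
    a_other_of_col_eq_zero hB hx hz hxz hq hqx hb hbz hqz,
    a_other_of_col_eq_zero hB hx hz hxz hq hqx hy hyz hqz, σ.a_other hB hx hz hxz hp hpx hy hyz]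
  field_simp

theorem crossRatio_exch_exch_of_zigzag (hB : σ.IsBase B) (hx : x ∈ B) (hz : z ∉ B)
    (hxz : σ.a B x z ≠ 0) (hp : p ∈ B) (hpx : p ≠ x) (hq : q ∈ B) (hqx : q ≠ x) (hpq : p ≠ q)
    (hy : y ∉ B) (hyz : y ≠ z) (hb : b ∉ B) (hbz : b ≠ z) (hby : b ≠ y) (hxb : σ.a B x b = 0)
    (hqz : σ.a B q z = 0) (hpy : σ.a B p y ≠ 0) (hpb : σ.a B p b ≠ 0) (hxy : σ.a B x y ≠ 0)
    (h : crossRatio (σ.a B) x p y z = 1) :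
    σ.a (exch B x z) p b ≠ 0 ∧
    crossRatio (σ.a (exch (exch B x z) p b)) z q x y = (crossRatio (σ.a B) p q y b)⁻¹ := by
  have hxz' : x ≠ z := fun h => hz (h ▸ hx)
  have hxb' : x ≠ b := fun h => hb (h ▸ hx)
  have hB1 := σ.isBase_exch hB hx hz hxz
  have hp1 : p ∈ exch B x z := mem_exch_of_ne hp hpx
  have hq1 : q ∈ exch B x z := mem_exch_of_ne hq hqx
  have hb1 : b ∉ exch B x z := notMem_exch hb hbz
  have hy1 : y ∉ exch B x z := notMem_exch hy hyz
  have hx1 : x ∉ exch B x z := notMem_exch_self hxz'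
  have epb : σ.a (exch B x z) p b = σ.a B p b :=
    a_other_of_row_eq_zero hB hx hz hxz hp hpx hb hbz hxb
  have h1 : σ.a (exch B x z) p b ≠ 0 := by rwa [epb]
  have hzp : z ≠ p := fun h => hz (h ▸ hp)
  have ezb : σ.a (exch B x z) z b = 0 := by rw [σ.a_row hB hx hz hxz hb hbz, hxb, zero_div]
  have hpz : σ.a B p z ≠ 0 := by
    intro h0
    rw [crossRatio, h0] at h
    simp at h
  rw [crossRatio_eq_one hpy hxz] at h
  have epy : σ.a (exch B x z) p y = 0 := by
    rw [σ.a_other hB hx hz hxz hp hpx hy hyz]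
    field_simp
    linear_combination -h
  refine ⟨h1, ?_⟩
  simp only [crossRatio]
  rw [a_other_of_col_eq_zero hB1 hp1 hb1 h1 mem_exch_self hzp hx1 hxb' ezb,
    a_other_of_col_eq_zero hB1 hp1 hb1 h1 mem_exch_self hzp hy1 hby.symm ezb,
    a_other_of_row_eq_zero hB1 hp1 hb1 h1 hq1 hpq.symm hy1 hby.symm epy,
    σ.a_other hB1 hp1 hb1 h1 hq1 hpq.symm hx1 hxb', epb,
    σ.a_col hB hx hz hxz hp hpx, σ.a_col hB hx hz hxz hq hqx, σ.a_self hB hx hz hxz,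
    σ.a_row hB hx hz hxz hy hyz, a_other_of_col_eq_zero hB hx hz hxz hq hqx hy hyz hqz,
    a_other_of_col_eq_zero hB hx hz hxz hq hqx hb hbz hqz, hqz]
  by_cases hqb : σ.a B q b = 0
  · simp [hqb]
  by_cases hqy : σ.a B q y = 0
  · simp [hqy]
  simp only [neg_zero, zero_div, zero_sub]
  field_simp
  linear_combination -h

theorem WLUM.zigzag (hW : σ.WLUM) (hB : σ.IsBase B) (hx : x ∈ B) (hz : z ∉ B)
    (hxz : σ.a B x z ≠ 0) (hp : p ∈ B) (hpx : p ≠ x) (hq : q ∈ B) (hpq : p ≠ q)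
    (hy : y ∉ B) (hyz : y ≠ z) (hb : b ∉ B) (hbz : b ≠ z) (hxb : σ.a B x b = 0)
    (hqz : σ.a B q z = 0) (hxy : σ.a B x y ≠ 0) (hpy : σ.a B p y ≠ 0)
    (hpb : σ.a B p b ≠ 0) (hpz : σ.a B p z ≠ 0)
    (hqy : σ.a B q y ≠ 0) (hqb : σ.a B q b ≠ 0) :
    crossRatio (σ.a B) x p y z = 1 ∨
      crossRatio (σ.a B) p q y b * (1 - crossRatio (σ.a B) x p y z) = 1 ∨
      crossRatio (σ.a B) p q y b = 1 := by
  by_cases h : crossRatio (σ.a B) x p y z = 1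
  · exact Or.inl h
  right
  rw [crossRatio_eq_one hpy hxz] at h
  have hB1 := σ.isBase_exch hB hp hz hpz
  have exy : σ.a (exch B p z) x y ≠ 0 := by
    rw [σ.a_other hB hp hz hpz hx hpx.symm hy hyz]
    intro h0
    field_simp at h0
    exact h (by linear_combination h0)
  have exb := σ.a_other hB hp hz hpz hx hpx.symm hb hbz
  have ezy := σ.a_row hB hp hz hpz hy hyz
  have ezb := σ.a_row hB hp hz hpz hb hbz
  have eqy := a_other_of_col_eq_zero hB hp hz hpz hq hpq.symm hy hyz hqz
  have eqb := a_other_of_col_eq_zero hB hp hz hpz hq hpq.symm hb hbz hqz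
  have key := (hW hB1).1 x (mem_exch_of_ne hx hpx.symm) z mem_exch_self q
    (mem_exch_of_ne hq hpq.symm) y (notMem_exch hy hyz) b (notMem_exch hb hbz) ?_
  · rw [exb, ezy, ezb, eqy, eqb, σ.a_other hB hp hz hpz hx hpx.symm hy hyz, hxb] at key
    simp only [crossRatio]
    field_simp at key ⊢
    rcases key with key | key | key
    · refine absurd ?_ (mul_ne_zero (mul_ne_zero hxy hpz) hpb)
      linear_combination key
    · left
      linear_combination -key
    · right
      linear_combination key
  · simp only [forall_eq_or_imp, forall_eq]
    rw [exb, ezy, ezb, eqy, eqb, hxb]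
    refine ⟨⟨exy, ?_⟩, ⟨?_, ?_⟩, hqy, hqb⟩
    · simp [hpz, hpb, hxz]
    · simp [hpz, hpy]
    · simp [hpz, hpb]

end entries

variable {K L E : Type*} [Field K] [Field L] {u : K → L} {σ : PivotSystem K E}
  {σ' : PivotSystem L E} {B B₀ : Set E} {i j k l p q x y : E}

theorem crossAgree_of_zigzag (hu : IsCrossMap u) (hW : σ.WLUM)
    (hN : ∀ B, σ.IsBase B → x ∉ B → y ∉ B → σ'.IsBase B ∧ GoodOff u σ σ' ∅ B)
    (hB : σ.IsBase B) (hB' : σ'.IsBase B) (hx : x ∈ B) (hy : y ∉ B) {z b : E} (hz : z ∉ B)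
    (hxz : σ.a B x z ≠ 0) (hp : p ∈ B) (hpx : p ≠ x) (hq : q ∈ B) (hqx : q ≠ x) (hpq : p ≠ q)
    (hyz : y ≠ z) (hb : b ∉ B) (hbz : b ≠ z) (hby : b ≠ y) (hxb : σ.a B x b = 0)
    (hqz : σ.a B q z = 0) (hxy' : σ.a B x y ≠ 0) (hpy : σ.a B p y ≠ 0) (hpb : σ.a B p b ≠ 0)
    (hpz : σ.a B p z ≠ 0) (hqy : σ.a B q y ≠ 0) (hqb : σ.a B q b ≠ 0)
    (hs : ∀ i ∈ B, ∀ j ∉ B, (σ.a B i j = 0 ↔ σ'.a B i j = 0))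
    (h : CrossAgree u (σ.a B) (σ'.a B) x p y z) : CrossAgree u (σ.a B) (σ'.a B) p q y b := by
  have hxz1 : x ≠ z := fun h => hz (h ▸ hx)
  have hxb1 : x ≠ b := fun h => hb (h ▸ hx)
  have nz : ∀ {i j}, i ∈ B → j ∉ B → σ.a B i j ≠ 0 → σ'.a B i j ≠ 0 :=
    fun hi hj hne h0 => hne ((hs _ hi _ hj).2 h0)
  have hB1 := σ.isBase_exch hB hx hz hxz
  have hx1 : x ∉ exch B x z := notMem_exch_self hxz1
  have hy1 : y ∉ exch B x z := notMem_exch hy hyz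
  have hb1 : b ∉ exch B x z := notMem_exch hb hbz
  have hp1 : p ∈ exch B x z := mem_exch_of_ne hp hpx
  have hq1 : q ∈ exch B x z := mem_exch_of_ne hq hqx
  by_cases h1 : crossRatio (σ.a B) x p y z = 1
  · have h1' : crossRatio (σ'.a B) x p y z = 1 := by rw [← h, h1, hu.map_one]
    obtain ⟨e0, e1⟩ := crossRatio_exch_exch_of_zigzag hB hx hz hxz hp hpx hq hqx hpq hy hyz hb hbz
      hby hxb hqz hpy hpb hxy' h1
    obtain ⟨-, e2⟩ := crossRatio_exch_exch_of_zigzag hB' hx hz (nz hx hz hxz) hp hpx hq hqx hpq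
      hy hyz hb hbz hby ((hs _ hx _ hb).1 hxb) ((hs _ hq _ hz).1 hqz) (nz hp hy hpy) (nz hp hb hpb)
      (nz hx hy hxy') h1'
    have hB2 := σ.isBase_exch hB1 hp1 hb1 e0
    have hx2 : x ∉ exch (exch B x z) p b := notMem_exch hx1 hxb1
    have hy2 : y ∉ exch (exch B x z) p b := notMem_exch hy1 hby.symm
    have key := (hN _ hB2 hx2 hy2).2.cross z
      (mem_exch_of_ne mem_exch_self fun h => hz (h ▸ hp)) q
      (mem_exch_of_ne hq1 hpq.symm) x hx2 y hy2 (by simp) (by simp)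
    rw [CrossAgree, e1, e2, hu.map_inv, inv_inj] at key
    exact key
  · have key := (hN _ hB1 hx1 hy1).2.cross p hp1 q hq1 y hy1 b hb1 (by simp) (by simp)
    rw [CrossAgree, crossRatio_exch_of_zigzag hB hx hz hxz hp hpx hq hqx hy hyz hb hbz hxb hqz hpy,
      crossRatio_exch_of_zigzag hB' hx hz (nz hx hz hxz) hp hpx hq hqx hy hyz hb hbz
      ((hs _ hx _ hb).1 hxb) ((hs _ hq _ hz).1 hqz) (nz hp hy hpy), ← h] at key
    have h1' : 1 - u (crossRatio (σ.a B) x p y z) ≠ 0 := by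
      rw [sub_ne_zero, ne_comm, Ne, hu.eq_one_iff]
      exact h1
    rcases hW.zigzag hB hx hz hxz hp hpx hq hpq hy hyz hb hbz hxb hqz hxy' hpy hpb hpz hqy hqb with
      h2 | h2 | h2
    · exact absurd h2 h1
    · have h3 : crossRatio (σ.a B) p q y b = (1 - crossRatio (σ.a B) x p y z)⁻¹ :=
        eq_inv_of_mul_eq_one_left h2
      rw [mul_comm, h2, hu.map_one] at key
      rw [CrossAgree, h3, hu.map_inv, hu.map_one_sub]
      exact (eq_inv_of_mul_eq_one_right key.symm).symm
    · rw [h2, mul_one, hu.map_one_sub] at key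
      rw [CrossAgree, h2, hu.map_one]
      exact mul_left_cancel₀ h1' (by rw [mul_one]; exact key)

theorem goodOff_empty_of_mem_of_notMem (hu : IsCrossMap u) (hW : σ.WLUM)
    (hB₀ : σ.IsBase B₀) (hx₀ : x ∉ B₀) (hy₀ : y ∉ B₀)
    (hN : ∀ B, σ.IsBase B → x ∉ B → y ∉ B → σ'.IsBase B ∧ GoodOff u σ σ' ∅ B)
    (hY : ∀ B, σ.IsBase B → y ∉ B → σ'.IsBase B ∧ GoodOff u σ σ' {y} B)
    (hB : σ.IsBase B) (hx : x ∈ B) (hy : y ∉ B) : GoodOff u σ σ' ∅ B := by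
  obtain ⟨hB', hG⟩ := hY B hB hy
  obtain ⟨z, hz₀, hz, hxz⟩ := σ.exists_col hB hB₀ hx hx₀
  have hyz : y ≠ z := fun h => hy₀ (h ▸ hz₀)
  have hxz1 : x ≠ z := fun h => hx₀ (h ▸ hz₀)
  have hB1 := σ.isBase_exch hB hx hz hxz
  obtain ⟨hB1', hG1⟩ := hN _ hB1 (notMem_exch_self hxz1) (notMem_exch hy hyz)
  have hs : ∀ i ∈ B, ∀ j ∉ B, (σ.a B i j = 0 ↔ σ'.a B i j = 0) := by
    intro i hi j hj
    have h := hG1.supp_exch hu hB1 hB1' mem_exch_self (notMem_exch_self hxz1) (by simp)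
      (by rw [σ.a_self hB hx hz hxz]; exact inv_ne_zero hxz) (k := i) (l := j)
    rw [exch_exch hx hz] at h
    exact h hi hj (by simp)
  have nz : ∀ {i j}, i ∈ B → j ∉ B → σ.a B i j ≠ 0 → σ'.a B i j ≠ 0 :=
    fun hi hj hne h0 => hne ((hs _ hi _ hj).2 h0)
  -- the row `x`
  have key₁ : ∀ q ∈ B, ∀ b ∉ B, b ≠ y → CrossAgree u (σ.a B) (σ'.a B) x q y b := by
    intro q hq b hb hby
    by_cases hqx : q = x
    · subst hqx
      exact crossAgree_self_row hu (hs _ hx _ hy) (hs _ hx _ hb)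
    refine CrossAgree.of_ne_zero hu (hs _ hx _ hy) (hs _ hx _ hb) (hs _ hq _ hy) (hs _ hq _ hb)
      fun h1 h2 h3 h4 => CrossAgree.swap_col hu ?_
    have hxb1 : x ≠ b := fun h => hb (h ▸ hx)
    rw [← crossAgree_pivot_iff hu hB hB' hx hb h2 (nz hx hb h2) hq hqx hy hby.symm
      (hs _ hx _ hy) (hs _ hq _ hb)]
    have hx1 : x ∉ exch B x b := notMem_exch_self hxb1
    have hy1 : y ∉ exch B x b := notMem_exch hy hby.symm
    exact (hN _ (σ.isBase_exch hB hx hb h2) hx1 hy1).2.cross _ mem_exch_self _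
      (mem_exch_of_ne hq hqx) _ hx1 _ hy1 (by simp) (by simp)
  -- the columns meeting the row `x`
  have key₂ : ∀ p ∈ B, p ≠ x → ∀ q ∈ B, q ≠ x → ∀ b ∉ B, b ≠ y → σ.a B x b ≠ 0 →
      CrossAgree u (σ.a B) (σ'.a B) p q y b := by
    intro p hp hpx q hq hqx b hb hby hxb
    refine CrossAgree.of_ne_zero hu (hs _ hp _ hy) (hs _ hp _ hb) (hs _ hq _ hy) (hs _ hq _ hb)
      fun h1 h2 h3 h4 => ?_
    by_cases hxy' : σ.a B x y = 0
    · have hxb1 : x ≠ b := fun h => hb (h ▸ hx)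
      rw [CrossAgree, ← crossRatio_exch_of_row_eq_zero hB hx hb hxb hp hpx hq hqx hy hby.symm hxy',
        ← crossRatio_exch_of_row_eq_zero hB' hx hb (nz hx hb hxb) hp hpx hq hqx hy hby.symm
          ((hs _ hx _ hy).1 hxy')]
      have hx1 : x ∉ exch B x b := notMem_exch_self hxb1
      have hy1 : y ∉ exch B x b := notMem_exch hy hby.symm
      exact (hN _ (σ.isBase_exch hB hx hb hxb) hx1 hy1).2.cross _ (mem_exch_of_ne hp hpx) _
        (mem_exch_of_ne hq hqx) _ hy1 _ hx1 (by simp) (by simp)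
    · have hA : ∀ i, i = x ∨ i = p ∨ i = q → σ.a B i y ≠ 0 ∧ σ.a B i b ≠ 0 := by
        rintro i (rfl | rfl | rfl) <;> constructor <;> assumption
      refine CrossAgree.trans_row hu (i₁ := x) hA ?_
        ((hW hB).1 x hx p hp q hq y hy b hb hA) (key₁ p hp b hb hby) (key₁ q hq b hb hby)
      rintro i (rfl | rfl | rfl) <;> constructor <;> exact nz ‹_› ‹_› ‹_›
  have key₃ : ∀ p ∈ B, ∀ q ∈ B, ∀ b ∉ B, b ≠ y → CrossAgree u (σ.a B) (σ'.a B) p q y b := by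
    intro p hp q hq b hb hby
    by_cases hpx : p = x
    · exact hpx ▸ key₁ q hq b hb hby
    by_cases hqx : q = x
    · exact hqx ▸ (key₁ p hp b hb hby).swap_row hu
    by_cases hpq : p = q
    · subst hpq
      exact crossAgree_self_row hu (hs _ hp _ hy) (hs _ hp _ hb)
    by_cases hxb : σ.a B x b = 0
    swap
    · exact key₂ p hp hpx q hq hqx b hb hby hxb
    refine CrossAgree.of_ne_zero hu (hs _ hp _ hy) (hs _ hp _ hb) (hs _ hq _ hy) (hs _ hq _ hb)
      fun h1 h2 h3 h4 => ?_
    have hbz : b ≠ z := fun h => hxz (h ▸ hxb)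
    -- if the pivot on `(x, z)` does not change the entries
    have same : σ.a B x y = 0 ∨ (σ.a B p z = 0 ∧ σ.a B q z = 0) →
        CrossAgree u (σ.a B) (σ'.a B) p q y b := by
      intro h
      have e : ∀ i, i = p ∨ i = q → ∀ j, j = y ∨ j = b →
          σ.a (exch B x z) i j = σ.a B i j ∧ σ'.a (exch B x z) i j = σ'.a B i j := by
        intro i hi j hj
        have hiB : i ∈ B := by rcases hi with rfl | rfl <;> assumption
        have hix : i ≠ x := by rcases hi with rfl | rfl <;> assumption
        have hjB : j ∉ B := by rcases hj with rfl | rfl <;> assumption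
        have hjz : j ≠ z := by rcases hj with rfl | rfl <;> assumption
        have h' : σ.a B x j = 0 ∨ σ.a B i z = 0 := by
          rcases hi with rfl | rfl <;> rcases hj with rfl | rfl <;> tauto
        rcases h' with h' | h'
        · exact ⟨a_other_of_row_eq_zero hB hx hz hxz hiB hix hjB hjz h',
            a_other_of_row_eq_zero hB' hx hz (nz hx hz hxz) hiB hix hjB hjz ((hs _ hx _ hjB).1 h')⟩
        · exact ⟨a_other_of_col_eq_zero hB hx hz hxz hiB hix hjB hjz h',
            a_other_of_col_eq_zero hB' hx hz (nz hx hz hxz) hiB hix hjB hjz ((hs _ hiB _ hz).1 h')⟩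
      have := hG1.cross p (mem_exch_of_ne hp hpx) q (mem_exch_of_ne hq hqx) y (notMem_exch hy hyz)
        b (notMem_exch hb hbz) (by simp) (by simp)
      simpa [CrossAgree, crossRatio, e] using this
    by_cases hxy' : σ.a B x y = 0
    · exact same (Or.inl hxy')
    by_cases hpz : σ.a B p z = 0 <;> by_cases hqz : σ.a B q z = 0
    · exact same (Or.inr ⟨hpz, hqz⟩)
    · refine CrossAgree.swap_row hu ?_
      exact crossAgree_of_zigzag hu hW hN hB hB' hx hy hz hxz hq hqx hp hpx (Ne.symm hpq) hyz hb
        hbz hby hxb hpz hxy' h3 h4 hqz h1 h2 hs (key₁ q hq z hz hyz.symm)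
    · exact crossAgree_of_zigzag hu hW hN hB hB' hx hy hz hxz hp hpx hq hqx hpq hyz hb
        hbz hby hxb hqz hxy' h1 h2 hpz h3 h4 hs (key₁ p hp z hz hyz.symm)
    · have hA : ∀ j, j = z ∨ j = y ∨ j = b → σ.a B p j ≠ 0 ∧ σ.a B q j ≠ 0 := by
        rintro i (rfl | rfl | rfl) <;> constructor <;> assumption
      refine CrossAgree.trans_col hu (j₁ := z) hA ?_
        ((hW hB).2 p hp q hq z hz y hy b hb hA)
        ((key₂ p hp hpx q hq hqx z hz hyz.symm hxz).swap_col hu)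
        (hG.cross p hp q hq z hz b hb hyz.symm hby)
      rintro i (rfl | rfl | rfl) <;> constructor <;> exact nz ‹_› ‹_› ‹_›
  refine ⟨fun i hi j hj _ => hs i hi j hj, fun i hi k hk j hj l hl _ _ => ?_⟩
  by_cases hjy : j = y <;> by_cases hly : l = y
  · subst hjy; subst hly
    exact crossAgree_self_col hu (hs _ hi _ hj) (hs _ hk _ hj)
  · exact hjy ▸ key₃ i hi k hk l hl hly
  · exact hly ▸ (key₃ i hi k hk j hj hjy).swap_col hu
  · exact hG.cross i hi k hk j hj l hl hjy hly

/-- A simultaneous lift of the two deletions is a lift when it is correct on the columns `x`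
and `y`. -/
theorem lift_of_del (hu : IsCrossMap u) (hW : σ.WLUM) (hxy : x ≠ y)
    (hB₀ : σ.IsBase B₀) (hx₀ : x ∉ B₀) (hy₀ : y ∉ B₀)
    (hX : ∀ B, σ.IsBase B → x ∉ B → σ'.IsBase B ∧ GoodOff u σ σ' {x} B)
    (hY : ∀ B, σ.IsBase B → y ∉ B → σ'.IsBase B ∧ GoodOff u σ σ' {y} B)
    (hXY : ∀ B, σ.IsBase B → x ∉ B → y ∉ B → ∀ i ∈ B, ∀ k ∈ B,
      CrossAgree u (σ.a B) (σ'.a B) i k x y) : Lift u σ σ' := by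
  have hN : ∀ B, σ.IsBase B → x ∉ B → y ∉ B → σ'.IsBase B ∧ GoodOff u σ σ' ∅ B := by
    intro B hB hx hy
    obtain ⟨hB', hGx⟩ := hX B hB hx
    obtain ⟨-, hGy⟩ := hY B hB hy
    have hs : ∀ i ∈ B, ∀ j ∉ B, (σ.a B i j = 0 ↔ σ'.a B i j = 0) := by
      intro i hi j hj
      by_cases hjx : j = x
      · exact hGy.supp i hi j hj (by subst hjx; exact hxy)
      · exact hGx.supp i hi j hj hjx
    refine ⟨hB', fun i hi j hj _ => hs i hi j hj, fun i hi k hk j hj l hl _ _ => ?_⟩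
    by_cases hjx : j = x
    · subst hjx
      by_cases hly : l = y
      · exact hly ▸ hXY B hB hx hy i hi k hk
      · exact hGy.cross i hi k hk j hj l hl hxy hly
    · by_cases hlx : l = x
      · subst hlx
        by_cases hjy : j = y
        · exact hjy ▸ (hXY B hB hx hy i hi k hk).swap_col hu
        · exact hGy.cross i hi k hk j hj l hl hjy hxy
      · exact hGx.cross i hi k hk j hj l hl hjx hlx
  have hα : ∀ B, σ.IsBase B → (x ∉ B ∨ y ∉ B) → σ'.IsBase B ∧ GoodOff u σ σ' ∅ B := by
    intro B hB h
    by_cases hx : x ∈ B <;> by_cases hy : y ∈ B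
    · tauto
    · exact ⟨(hY B hB hy).1, goodOff_empty_of_mem_of_notMem hu hW hB₀ hx₀ hy₀ hN hY hB hx hy⟩
    · exact ⟨(hX B hB hx).1, goodOff_empty_of_mem_of_notMem hu hW hB₀ hy₀ hx₀
        (fun B hB hy hx => hN B hB hx hy) hX hB hy hx⟩
    · exact hN B hB hx hy
  intro B hB
  by_cases hx : x ∈ B
  swap
  · exact hα B hB (Or.inl hx)
  obtain ⟨z, hz₀, hz, hxz⟩ := σ.exists_col hB hB₀ hx hx₀
  have hxz1 : x ≠ z := fun h => hx₀ (h ▸ hz₀)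
  have hB1 := σ.isBase_exch hB hx hz hxz
  obtain ⟨hB1', hG1⟩ := hα _ hB1 (Or.inl (notMem_exch_self hxz1))
  have hne1 : σ.a (exch B x z) z x ≠ 0 := by
    rw [σ.a_self hB hx hz hxz]; exact inv_ne_zero hxz
  have hx1 : x ∉ exch B x z := notMem_exch_self hxz1
  have hs : ∀ i ∈ B, ∀ j ∉ B, (σ.a B i j = 0 ↔ σ'.a B i j = 0) := by
    intro i hi j hj
    have h := hG1.supp_exch hu hB1 hB1' mem_exch_self hx1 (by simp) hne1 (k := i) (l := j)
    rw [exch_exch hx hz] at h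
    exact h hi hj (by simp)
  have hB' : σ'.IsBase B := by
    have := σ'.isBase_exch hB1' mem_exch_self hx1
      (fun h0 => hne1 ((hG1.supp _ mem_exch_self _ hx1 (by simp)).2 h0))
    rwa [exch_exch hx hz] at this
  have nz : ∀ {i j}, i ∈ B → j ∉ B → σ.a B i j ≠ 0 → σ'.a B i j ≠ 0 :=
    fun hi hj hne h0 => hne ((hs _ hi _ hj).2 h0)
  have key₁ : ∀ q ∈ B, ∀ b ∉ B, ∀ c ∉ B, CrossAgree u (σ.a B) (σ'.a B) x q c b := by
    intro q hq b hb c hc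
    by_cases hqx : q = x
    · subst hqx
      exact crossAgree_self_row hu (hs _ hx _ hc) (hs _ hx _ hb)
    by_cases hcb : c = b
    · subst hcb
      exact crossAgree_self_col hu (hs _ hx _ hc) (hs _ hq _ hc)
    refine CrossAgree.of_ne_zero hu (hs _ hx _ hc) (hs _ hx _ hb) (hs _ hq _ hc) (hs _ hq _ hb)
      fun h1 h2 h3 h4 => CrossAgree.swap_col hu ?_
    rw [← crossAgree_pivot_iff hu hB hB' hx hb h2 (nz hx hb h2) hq hqx hc hcb
      (hs _ hx _ hc) (hs _ hq _ hb)]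
    have hx1 : x ∉ exch B x b := notMem_exch_self fun h => hb (h ▸ hx)
    exact (hα _ (σ.isBase_exch hB hx hb h2) (Or.inl hx1)).2.cross _ mem_exch_self _
      (mem_exch_of_ne hq hqx) _ hx1 _ (notMem_exch hc hcb) (by simp) (by simp)
  have key₂ : ∀ p ∈ B, p ≠ x → ∀ q ∈ B, q ≠ x → ∀ b ∉ B, ∀ c ∉ B, b ≠ c → σ.a B x b ≠ 0 →
      CrossAgree u (σ.a B) (σ'.a B) p q c b := by
    intro p hp hpx q hq hqx b hb c hc hbc hxb
    refine CrossAgree.of_ne_zero hu (hs _ hp _ hc) (hs _ hp _ hb) (hs _ hq _ hc) (hs _ hq _ hb)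
      fun h1 h2 h3 h4 => ?_
    by_cases hxc : σ.a B x c = 0
    · rw [CrossAgree, ← crossRatio_exch_of_row_eq_zero hB hx hb hxb hp hpx hq hqx hc hbc.symm hxc,
        ← crossRatio_exch_of_row_eq_zero hB' hx hb (nz hx hb hxb) hp hpx hq hqx hc hbc.symm
          ((hs _ hx _ hc).1 hxc)]
      have hx1 : x ∉ exch B x b := notMem_exch_self fun h => hb (h ▸ hx)
      exact (hα _ (σ.isBase_exch hB hx hb hxb) (Or.inl hx1)).2.cross _ (mem_exch_of_ne hp hpx) _
        (mem_exch_of_ne hq hqx) _ (notMem_exch hc hbc.symm) _ hx1 (by simp) (by simp)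
    · have hA : ∀ i, i = x ∨ i = p ∨ i = q → σ.a B i c ≠ 0 ∧ σ.a B i b ≠ 0 := by
        rintro i (rfl | rfl | rfl) <;> constructor <;> assumption
      refine CrossAgree.trans_row hu (i₁ := x) hA ?_
        ((hW hB).1 x hx p hp q hq c hc b hb hA) (key₁ p hp b hb c hc) (key₁ q hq b hb c hc)
      rintro i (rfl | rfl | rfl) <;> constructor <;> exact nz ‹_› ‹_› ‹_›
  refine ⟨hB', fun i hi j hj _ => hs i hi j hj, fun p hp q hq c hc b hb _ _ => ?_⟩
  by_cases hpx : p = x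
  · exact hpx ▸ key₁ q hq b hb c hc
  by_cases hqx : q = x
  · exact hqx ▸ (key₁ p hp b hb c hc).swap_row hu
  by_cases hcb : c = b
  · subst hcb
    exact crossAgree_self_col hu (hs _ hp _ hc) (hs _ hq _ hc)
  by_cases hxb : σ.a B x b = 0
  swap
  · exact key₂ p hp hpx q hq hqx b hb c hc (Ne.symm hcb) hxb
  by_cases hxc : σ.a B x c = 0
  swap
  · exact (key₂ p hp hpx q hq hqx c hc b hb hcb hxc).swap_col hu
  have hbz : b ≠ z := fun h => hxz (h ▸ hxb)
  have hcz : c ≠ z := fun h => hxz (h ▸ hxc)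
  have := hG1.cross p (mem_exch_of_ne hp hpx) q (mem_exch_of_ne hq hqx) c (notMem_exch hc hcz)
    b (notMem_exch hb hbz) (by simp) (by simp)
  have e1 := fun {i} (hi : i ∈ B) (hix : i ≠ x) {j} (hj : j ∉ B) (hjz : j ≠ z)
    (h : σ.a B x j = 0) => a_other_of_row_eq_zero hB hx hz hxz hi hix hj hjz h
  have e2 := fun {i} (hi : i ∈ B) (hix : i ≠ x) {j} (hj : j ∉ B) (hjz : j ≠ z)
    (h : σ.a B x j = 0) =>
    a_other_of_row_eq_zero hB' hx hz (nz hx hz hxz) hi hix hj hjz ((hs _ hx _ hj).1 h)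
  simpa only [CrossAgree, crossRatio, e1 hp hpx hc hcz hxc, e1 hq hqx hc hcz hxc,
    e1 hp hpx hb hbz hxb, e1 hq hqx hb hbz hxb, e2 hp hpx hc hcz hxc, e2 hq hqx hc hcz hxc,
    e2 hp hpx hb hbz hxb, e2 hq hqx hb hbz hxb] using this

end PivotSystem

/-- Walks of a given length between rows, where `F i c` says that the row `i` meets the
column `c`. -/
inductive RowWalk {E : Type*} (F : E → E → Prop) : ℕ → E → E → Prop
  | nil (i : E) : RowWalk F 0 i i
  | cons {n : ℕ} {i c i' k : E} : F i c → F i' c → RowWalk F n i' k → RowWalk F (n + 1) i k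

namespace RowWalk

variable {E : Type*} {F F₁ : E → E → Prop} {n m : ℕ} {i j k c : E}

theorem snoc (h : RowWalk F n i j) (h₁ : F j c) (h₂ : F k c) : RowWalk F (n + 1) i k := by
  induction h with
  | nil i => exact .cons h₁ h₂ (.nil _)
  | cons a b _ ih => exact .cons a b (ih h₁)

theorem symm (h : RowWalk F n i j) : RowWalk F n j i := by
  induction h with
  | nil i => exact .nil i
  | cons a b _ ih => exact ih.snoc b a

/-- A walk either meets `Z` or survives in every relation that agrees off `Z`. -/
theorem exists_mem_or (Z : E → Prop) (hF : ∀ p q, ¬ Z p → F p q → F₁ p q)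
    (h : RowWalk F n i k) :
    (∃ p n₁ n₂, Z p ∧ RowWalk F n₁ i p ∧ RowWalk F n₂ p k ∧ n₁ + n₂ = n) ∨
      (RowWalk F₁ n i k ∧ ¬ Z i ∧ ¬ Z k) := by
  induction h with
  | nil i =>
    by_cases hZ : Z i
    · exact Or.inl ⟨i, 0, 0, hZ, .nil i, .nil i, rfl⟩
    · exact Or.inr ⟨.nil i, hZ, hZ⟩
  | @cons n i c i' k a b h ih =>
    by_cases hZ : Z i
    · exact Or.inl ⟨i, 0, n + 1, hZ, .nil i, .cons a b h, zero_add _⟩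
    · rcases ih with ⟨p, n₁, n₂, hp, h₁, h₂, e⟩ | ⟨h₁, h₂, h₃⟩
      · exact Or.inl ⟨p, n₁ + 1, n₂, hp, .cons a b h₁, h₂, by omega⟩
      · exact Or.inr ⟨.cons (hF _ _ hZ a) (hF _ _ h₂ b) h₁, hZ, h₃⟩

end RowWalk

theorem IsCrossMap.map_div_of_path {K L : Type*} [Field K] [Field L] {u : K → L}
    (hu : IsCrossMap u) {t v w : K} {t' v' w' : L} (ht : t ≠ 0) (hv : v ≠ 0) (hw : w ≠ 0)
    (ht' : t' ≠ 0) (hv' : v' ≠ 0) (hw' : w' ≠ 0)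
    (h₁ : u t = t') (h₂ : u (v / t) = v' / t') (h₃ : u (-w) = -w')
    (A₁ : t = v ∨ v = w ∨ t = v - w) (A₂ : t = 1 ∨ v = w ∨ v = w * (1 - t))
    (A₃ : t = 1 ∨ t = v ∨ v = t - 1)
    (B : w ≠ -1 → (t = 1 ∨ v = t - 1 ∨ v = w * (1 - t)) ∧ (t = v ∨ v = t - 1 ∨ t = v - w) ∧
      (v = w ∨ v = w * (1 - t) ∨ t = v - w)) : u (v / w) = v' / w' := by
  have hα : v = t - 1 → v' = t' - 1 := by
    intro hα
    have e : v / t = 1 - t⁻¹ := by rw [hα]; field_simp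
    rw [e, hu.map_one_sub, hu.map_inv, h₁, eq_div_iff ht', sub_mul, inv_mul_cancel₀ ht'] at h₂
    linear_combination -h₂
  have hδ : t = v → t' = v' := by
    intro h
    rw [h, div_self hv, hu.map_one] at h₂
    field_simp at h₂
    exact h₂
  have ht1 : t = 1 → t' = 1 := fun h => by rw [← h₁, h, hu.map_one]
  by_cases hw1 : w = -1
  · have hw1' : w' = -1 := by
      rw [hw1, neg_neg, hu.map_one] at h₃
      linear_combination h₃
    subst hw1 hw1'
    by_cases ha : v = t - 1
    · have e : v / -1 = 1 - t := by rw [ha]; field_simp; ring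
      rw [e, hu.map_one_sub, h₁, hα ha]
      field_simp
      ring
    · have hb : v ≠ -1 * (1 - t) := fun h => ha (by linear_combination h)
      have hc : t ≠ v - -1 := fun h => ha (by linear_combination -h)
      have A₁' := A₁.imp_right (Or.resolve_right · hc)
      have A₂' := A₂.imp_right (Or.resolve_right · hb)
      have A₃' := A₃.imp_right (Or.resolve_right · ha)
      have hh : (t = 1 ∧ t = v) ∨ (t = 1 ∧ v = -1) ∨ (t = v ∧ v = -1) := by
        rcases A₁' with h | h
        · exact A₂'.imp (⟨·, h⟩) fun h' => Or.inr ⟨h, h'⟩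
        · exact Or.inr (A₃'.imp (⟨·, h⟩) (⟨·, h⟩))
      rcases hh with ⟨h, h'⟩ | ⟨h, h'⟩ | ⟨h, h'⟩
      · rw [← hδ h', ht1 h, ← h', h]
        simp [hu.map_neg_one]
      · have e : v' = -1 := by
          rw [ht1 h, h, h', div_one, div_one, hu.map_neg_one] at h₂
          exact h₂.symm
        rw [h', e, div_self (by simp), div_self (by simp), hu.map_one]
      · have e : v' = -1 := by rw [← hδ h, ← h₁, h, h', hu.map_neg_one]
        rw [h', e, div_self (by simp), div_self (by simp), hu.map_one]
  · obtain ⟨B₁, B₂, B₃⟩ := B hw1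
    have hw1 : 1 + w ≠ 0 := fun h => hw1 (by linear_combination h)
    by_cases ha : v = t - 1
    · have hc : t ≠ v - w := fun h => hw1 (by linear_combination h + ha)
      have hb : v ≠ w * (1 - t) := fun h => mul_ne_zero hv hw1 (by linear_combination h + w * ha)
      have h3 : v = w := B₃.resolve_right (not_or.2 ⟨hb, hc⟩)
      have e : t' = 1 + w' := by
        have : t = 1 - (-w) := by linear_combination -ha + h3
        rw [← h₁, this, hu.map_one_sub, h₃]; ring
      have e2 : v' = w' := by rw [hα ha, e]; ring
      rw [e2, h3, div_self hw, div_self hw', hu.map_one]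
    by_cases hb : v = w * (1 - t)
    · have hc : t ≠ v - w := fun h => mul_ne_zero ht hw1 (by linear_combination h + hb)
      have h2 : t = v := B₂.resolve_right (not_or.2 ⟨ha, hc⟩)
      have ht1 : 1 - t ≠ 0 := fun h => hv (by rw [hb, h, mul_zero])
      have ht1' : 1 - t' ≠ 0 := by
        rw [← h₁, ← hu.map_one_sub]
        exact fun h => ht1 (hu.eq_zero h)
      have e : v / w = 1 - t := by rw [hb]; field_simp
      have e2 : -w = (1 - t⁻¹)⁻¹ := by
        have e3 : 1 - t⁻¹ = -(1 - t) / t := by field_simp; ring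
        rw [e3, inv_div, eq_div_iff (neg_ne_zero.2 ht1)]
        linear_combination -hb - h2
      rw [e2, hu.map_inv, hu.map_one_sub, hu.map_inv, h₁] at h₃
      have e3 : 1 - t'⁻¹ = -(1 - t') / t' := by field_simp; ring
      rw [e3, inv_div, div_eq_iff (neg_ne_zero.2 ht1')] at h₃
      rw [e, hu.map_one_sub, h₁, eq_div_iff hw', ← hδ h2]
      linear_combination -h₃
    · by_cases hc : t = v - w
      · have h1 : t = 1 := B₁.resolve_right (not_or.2 ⟨ha, hb⟩)
        have e1 := ht1 h1
        rw [e1, h1, div_one, div_one] at h₂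
        have e2 : -w = 1 - v := by linear_combination -hc + h1
        rw [e2, hu.map_one_sub, h₂] at h₃
        have e3 : v / w = (1 - v⁻¹)⁻¹ := by
          have : 1 - v⁻¹ = w / v := by field_simp; linear_combination e2
          rw [this, inv_div]
        have e4 : 1 - v'⁻¹ = w' / v' := by field_simp; linear_combination -h₃
        rw [e3, hu.map_inv, hu.map_one_sub, hu.map_inv, h₂, e4, inv_div]
      · have h1 : t = 1 := B₁.resolve_right (not_or.2 ⟨ha, hb⟩)
        have h2 : t = v := B₂.resolve_right (not_or.2 ⟨ha, hc⟩)
        have h3 : v = w := B₃.resolve_right (not_or.2 ⟨hb, hc⟩)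
        have e1 := ht1 h1
        have e2 : v' = 1 := by rw [← hδ h2, e1]
        have e3 : w' = 1 := by
          rw [← h3, ← h2, h1, hu.map_neg_one] at h₃
          linear_combination h₃
        rw [e2, e3, ← h3, div_self hv, div_one, hu.map_one]

namespace PivotSystem

variable {K L E : Type*} [Field K] [Field L] {u : K → L} {σ : PivotSystem K E}
  {σ' : PivotSystem L E} {B B₀ : Set E} {i j k l : E}

theorem crossRatio_scale (t : E → K) (ht : ∀ e, t e ≠ 0) :
    crossRatio ((σ.scale t ht).a B) i k j l = crossRatio (σ.a B) i k j l := by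
  have := ht i; have := ht j; have := ht k; have := ht l
  simp only [crossRatio, scale]
  field_simp

theorem WLUM.scale (hW : σ.WLUM) (t : E → K) (ht : ∀ e, t e ≠ 0) : (σ.scale t ht).WLUM := by
  have key : ∀ B i k j l, σ.a B i j * σ.a B k l = σ.a B i l * σ.a B k j →
      σ.a B i j * t j / t i * (σ.a B k l * t l / t k) =
      σ.a B i l * t l / t i * (σ.a B k j * t j / t k) := by
    intro B i k j l h
    have := ht i; have := ht k
    field_simp
    linear_combination (t j * t l) * h
  intro B hB
  refine ⟨fun i₁ h₁ i₂ h₂ i₃ h₃ j hj l hl h => ?_, fun i hi k hk j₁ h₁ j₂ h₂ j₃ h₃ h => ?_⟩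
  · refine ((hW hB).1 i₁ h₁ i₂ h₂ i₃ h₃ j hj l hl ?_).imp (key _ _ _ _ _)
      (Or.imp (key _ _ _ _ _) (key _ _ _ _ _))
    simpa [PivotSystem.scale, ht] using h
  · refine ((hW hB).2 i hi k hk j₁ h₁ j₂ h₂ j₃ h₃ ?_).imp (key _ _ _ _ _)
      (Or.imp (key _ _ _ _ _) (key _ _ _ _ _))
    simpa [PivotSystem.scale, ht] using h

/-- Rescaling a path of three rows and two columns together with two further columns. -/
theorem exists_scaling (A : E → E → K) {b r d c₁ c₂ x y : E} (hc₂ : c₂ ≠ c₁)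
    (hx : x ≠ c₁ ∧ x ≠ c₂) (hy : y ≠ c₁ ∧ y ≠ c₂ ∧ y ≠ x)
    (hr : r ≠ c₁ ∧ r ≠ c₂ ∧ r ≠ x ∧ r ≠ y) (hd : d ≠ c₁ ∧ d ≠ c₂ ∧ d ≠ x ∧ d ≠ y ∧ d ≠ r)
    (hb : b ≠ c₁ ∧ b ≠ c₂ ∧ b ≠ x ∧ b ≠ y ∧ b ≠ r ∧ b ≠ d)
    (h₁ : A b c₁ ≠ 0) (h₂ : A b x ≠ 0) (h₃ : A b y ≠ 0) (h₄ : A r c₁ ≠ 0) (h₅ : A r c₂ ≠ 0)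
    (h₆ : A d c₂ ≠ 0) :
    ∃ t : E → K, (∀ e, t e ≠ 0) ∧ A b c₁ * t c₁ / t b = 1 ∧ A b x * t x / t b = 1 ∧
      A b y * t y / t b = 1 ∧ A r c₁ * t c₁ / t r = 1 ∧ A r c₂ * t c₂ / t r = 1 ∧
      A d c₂ * t c₂ / t d = 1 := by
  classical
  refine ⟨fun e => if e = c₁ then (A b c₁)⁻¹ else if e = c₂ then A r c₁ / A b c₁ / A r c₂ else
    if e = x then (A b x)⁻¹ else if e = y then (A b y)⁻¹ else if e = r then A r c₁ / A b c₁ else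
    if e = d then A d c₂ * (A r c₁ / A b c₁ / A r c₂) else 1, ?_, ?_⟩
  · intro e
    dsimp only
    split_ifs <;> simp [*]
  · simp only [hc₂, hx, hy, hr, hd, hb, if_true, if_false]
    refine ⟨?_, ?_, ?_, ?_, ?_, ?_⟩ <;> field_simp

theorem WLUM.of_path (hW : σ.WLUM) (hB : σ.IsBase B) {b r d c₁ c₂ x y : E} {t v w : K}
    (hb : b ∈ B) (hr : r ∈ B) (hd : d ∈ B) (hc₁ : c₁ ∉ B) (hc₂ : c₂ ∉ B) (hx : x ∉ B) (hy : y ∉ B)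
    (hrb : r ≠ b) (hrd : r ≠ d) (hbd : b ≠ d) (hcc : c₁ ≠ c₂) (hxc₁ : x ≠ c₁) (hxc₂ : x ≠ c₂)
    (hyc₁ : y ≠ c₁) (hyc₂ : y ≠ c₂) (hxy : x ≠ y)
    (hb₁ : σ.a B b c₁ = 1) (hb₂ : σ.a B b c₂ = 0) (hb₃ : σ.a B b x = 1) (hb₄ : σ.a B b y = 1)
    (hr₁ : σ.a B r c₁ = 1) (hr₂ : σ.a B r c₂ = 1) (hr₃ : σ.a B r x = 0) (hr₄ : σ.a B r y = t)
    (hd₁ : σ.a B d c₁ = 0) (hd₂ : σ.a B d c₂ = 1) (hd₃ : σ.a B d x = w) (hd₄ : σ.a B d y = v)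
    (ht : t ≠ 0) (hv : v ≠ 0) (hw : w ≠ 0) :
    (t = v ∨ v = w ∨ t = v - w) ∧ (t = 1 ∨ v = w ∨ v = w * (1 - t)) ∧
    (t = 1 ∨ t = v ∨ v = t - 1) ∧ (w ≠ -1 → (t = 1 ∨ v = t - 1 ∨ v = w * (1 - t)) ∧
      (t = v ∨ v = t - 1 ∨ t = v - w) ∧ (v = w ∨ v = w * (1 - t) ∨ t = v - w)) := by
  have nd : σ.a B d c₂ ≠ 0 := by simp [hd₂]
  have nb : σ.a B b c₁ ≠ 0 := by simp [hb₁]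
  have nr : σ.a B r c₁ ≠ 0 := by simp [hr₁]
  have nx : σ.a B b x ≠ 0 := by simp [hb₃]
  refine ⟨?_, ?_, ?_, fun hw1 => ⟨?_, ?_, ?_⟩⟩
  · by_contra! h
    obtain ⟨h1, h2, h3⟩ := h
    have key := (hW (σ.isBase_exch hB hd hc₂ nd)).1 b (mem_exch_of_ne hb hbd)
      r (mem_exch_of_ne hr hrd) c₂ mem_exch_self x (notMem_exch hx hxc₂) y (notMem_exch hy hyc₂)
    simp only [forall_eq_or_imp, forall_eq, σ.a_other hB hd hc₂ nd hb hbd hx hxc₂,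
      σ.a_other hB hd hc₂ nd hb hbd hy hyc₂, σ.a_other hB hd hc₂ nd hr hrd hx hxc₂,
      σ.a_other hB hd hc₂ nd hr hrd hy hyc₂, σ.a_row hB hd hc₂ nd hx hxc₂,
      σ.a_row hB hd hc₂ nd hy hyc₂, hb₂, hb₃, hb₄, hr₂, hr₃, hr₄, hd₂, hd₃, hd₄, zero_mul,
      div_one, one_mul, sub_zero, zero_sub] at key
    rcases key ⟨⟨one_ne_zero, one_ne_zero⟩, ⟨neg_ne_zero.2 hw, sub_ne_zero.2 h1⟩, hw, hv⟩ with
      h | h | h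
    · exact h3 (by linear_combination h)
    · exact h2 h
    · exact mul_ne_zero ht hw (by linear_combination -h)
  · by_contra! h
    obtain ⟨h1, h2, h3⟩ := h
    have key := (hW (σ.isBase_exch hB hb hc₁ nb)).1 c₁ mem_exch_self r (mem_exch_of_ne hr hrb)
      d (mem_exch_of_ne hd hbd.symm) x (notMem_exch hx hxc₁) y (notMem_exch hy hyc₁)
    simp only [forall_eq_or_imp, forall_eq, σ.a_other hB hb hc₁ nb hd hbd.symm hx hxc₁,
      σ.a_other hB hb hc₁ nb hd hbd.symm hy hyc₁, σ.a_other hB hb hc₁ nb hr hrb hx hxc₁,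
      σ.a_other hB hb hc₁ nb hr hrb hy hyc₁, σ.a_row hB hb hc₁ nb hx hxc₁,
      σ.a_row hB hb hc₁ nb hy hyc₁, hb₁, hb₃, hb₄, hr₁, hr₃, hr₄, hd₁, hd₃, hd₄,
      div_one, one_mul, sub_zero, zero_sub, mul_one] at key
    rcases key ⟨⟨one_ne_zero, one_ne_zero⟩, ⟨neg_ne_zero.2 one_ne_zero, sub_ne_zero.2 h1⟩, hw, hv⟩
      with h | h | h
    · exact ht (by linear_combination h)
    · exact h2 h
    · exact h3 (by linear_combination -h)
  · by_contra! h
    obtain ⟨h1, h2, h3⟩ := h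
    have key := (hW (σ.isBase_exch hB hr hc₁ nr)).1 b (mem_exch_of_ne hb hrb.symm) c₁ mem_exch_self
      d (mem_exch_of_ne hd hrd.symm) c₂ (notMem_exch hc₂ hcc.symm) y (notMem_exch hy hyc₁)
    simp only [forall_eq_or_imp, forall_eq, σ.a_other hB hr hc₁ nr hd hrd.symm hc₂ hcc.symm,
      σ.a_other hB hr hc₁ nr hd hrd.symm hy hyc₁, σ.a_other hB hr hc₁ nr hb hrb.symm hc₂ hcc.symm,
      σ.a_other hB hr hc₁ nr hb hrb.symm hy hyc₁, σ.a_row hB hr hc₁ nr hc₂ hcc.symm,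
      σ.a_row hB hr hc₁ nr hy hyc₁, hb₁, hb₂, hb₄, hr₁, hr₂, hr₄, hd₁, hd₂, hd₄, zero_mul,
      div_one, one_mul, sub_zero, zero_sub, mul_one] at key
    rcases key ⟨⟨neg_ne_zero.2 one_ne_zero, sub_ne_zero.2 h1.symm⟩, ⟨one_ne_zero, ht⟩, one_ne_zero,
      hv⟩ with h | h | h
    · exact one_ne_zero (show (1 : K) = 0 by linear_combination -h)
    · exact h3 (by linear_combination -h)
    · exact h2 h.symm
  · by_contra! h
    obtain ⟨h1, h2, h3⟩ := h
    have key := (hW (σ.isBase_exch hB hb hc₁ nb)).2 r (mem_exch_of_ne hr hrb)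
      d (mem_exch_of_ne hd hbd.symm) c₂ (notMem_exch hc₂ hcc.symm) x (notMem_exch hx hxc₁)
      y (notMem_exch hy hyc₁)
    simp only [forall_eq_or_imp, forall_eq, σ.a_other hB hb hc₁ nb hd hbd.symm hx hxc₁,
      σ.a_other hB hb hc₁ nb hd hbd.symm hy hyc₁, σ.a_other hB hb hc₁ nb hr hrb hx hxc₁,
      σ.a_other hB hb hc₁ nb hr hrb hy hyc₁, σ.a_other hB hb hc₁ nb hr hrb hc₂ hcc.symm,
      σ.a_other hB hb hc₁ nb hd hbd.symm hc₂ hcc.symm, hb₁, hb₂, hb₃, hb₄, hr₁, hr₂, hr₃, hr₄,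
      hd₁, hd₂, hd₃, hd₄, mul_zero,
      div_one, one_mul, sub_zero, zero_sub, mul_one] at key
    rcases key ⟨⟨one_ne_zero, one_ne_zero⟩, ⟨neg_ne_zero.2 one_ne_zero, hw⟩, sub_ne_zero.2 h1, hv⟩
      with h | h | h
    · exact hw1 h
    · exact h2 h
    · exact h3 (by linear_combination -h)
  · by_contra! h
    obtain ⟨h1, h2, h3⟩ := h
    have key := (hW (σ.isBase_exch hB hd hc₂ nd)).2 b (mem_exch_of_ne hb hbd)
      r (mem_exch_of_ne hr hrd) c₁ (notMem_exch hc₁ hcc) x (notMem_exch hx hxc₂)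
      y (notMem_exch hy hyc₂)
    simp only [forall_eq_or_imp, forall_eq, σ.a_other hB hd hc₂ nd hb hbd hx hxc₂,
      σ.a_other hB hd hc₂ nd hb hbd hy hyc₂, σ.a_other hB hd hc₂ nd hr hrd hx hxc₂,
      σ.a_other hB hd hc₂ nd hr hrd hy hyc₂, σ.a_other hB hd hc₂ nd hr hrd hc₁ hcc,
      σ.a_other hB hd hc₂ nd hb hbd hc₁ hcc, hb₁, hb₂, hb₃, hb₄, hr₁, hr₂, hr₃, hr₄, hd₁, hd₂,
      hd₃, hd₄, zero_mul, mul_zero, div_one, one_mul, sub_zero, zero_sub,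
      mul_one] at key
    rcases key ⟨⟨one_ne_zero, one_ne_zero⟩, ⟨one_ne_zero, neg_ne_zero.2 hw⟩, one_ne_zero,
      sub_ne_zero.2 h1⟩ with h | h | h
    · exact hw1 (by linear_combination -h)
    · exact h2 (by linear_combination -h)
    · exact h3 (by linear_combination h)
  · by_contra! h
    obtain ⟨h1, h2, h3⟩ := h
    have key := (hW (σ.isBase_exch hB hb hx nx)).2 r (mem_exch_of_ne hr hrb)
      d (mem_exch_of_ne hd hbd.symm) c₁ (notMem_exch hc₁ hxc₁.symm) c₂ (notMem_exch hc₂ hxc₂.symm)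
      y (notMem_exch hy hxy.symm)
    simp only [forall_eq_or_imp, forall_eq, σ.a_other hB hb hx nx hr hrb hc₁ hxc₁.symm,
      σ.a_other hB hb hx nx hr hrb hc₂ hxc₂.symm, σ.a_other hB hb hx nx hr hrb hy hxy.symm,
      σ.a_other hB hb hx nx hd hbd.symm hc₁ hxc₁.symm,
      σ.a_other hB hb hx nx hd hbd.symm hc₂ hxc₂.symm,
      σ.a_other hB hb hx nx hd hbd.symm hy hxy.symm, hb₁, hb₂, hb₃, hb₄, hr₁, hr₂, hr₃, hr₄,
      hd₁, hd₂, hd₃, hd₄, mul_zero, div_one, one_mul, sub_zero, zero_sub,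
      mul_one] at key
    rcases key ⟨⟨one_ne_zero, neg_ne_zero.2 hw⟩, ⟨one_ne_zero, one_ne_zero⟩, ht,
      sub_ne_zero.2 h1⟩ with h | h | h
    · exact hw1 (by linear_combination h)
    · exact h2 (by linear_combination h)
    · exact h3 (by linear_combination -h)

theorem crossAgree_of_path_normalized (hu : IsCrossMap u) (hW : σ.WLUM) (hB : σ.IsBase B)
    (hB' : σ'.IsBase B) {b r d c₁ c₂ x y : E}
    (hb : b ∈ B) (hr : r ∈ B) (hd : d ∈ B) (hc₁ : c₁ ∉ B) (hc₂ : c₂ ∉ B) (hx : x ∉ B) (hy : y ∉ B)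
    (hrb : r ≠ b) (hrd : r ≠ d) (hbd : b ≠ d) (hcc : c₁ ≠ c₂) (hxc₁ : x ≠ c₁) (hxc₂ : x ≠ c₂)
    (hyc₁ : y ≠ c₁) (hyc₂ : y ≠ c₂) (hxy : x ≠ y)
    (hb₁ : σ.a B b c₁ = 1) (hb₂ : σ.a B b c₂ = 0) (hb₃ : σ.a B b x = 1) (hb₄ : σ.a B b y = 1)
    (hr₁ : σ.a B r c₁ = 1) (hr₂ : σ.a B r c₂ = 1) (hr₃ : σ.a B r x = 0) (hr₄ : σ.a B r y ≠ 0)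
    (hd₁ : σ.a B d c₁ = 0) (hd₂ : σ.a B d c₂ = 1) (hd₃ : σ.a B d x ≠ 0) (hd₄ : σ.a B d y ≠ 0)
    (hb₁' : σ'.a B b c₁ = 1) (hb₂' : σ'.a B b c₂ = 0) (hb₃' : σ'.a B b x = 1)
    (hb₄' : σ'.a B b y = 1) (hr₁' : σ'.a B r c₁ = 1) (hr₂' : σ'.a B r c₂ = 1)
    (hr₃' : σ'.a B r x = 0) (hr₄' : σ'.a B r y ≠ 0) (hd₁' : σ'.a B d c₁ = 0)
    (hd₂' : σ'.a B d c₂ = 1) (hd₃' : σ'.a B d x ≠ 0) (hd₄' : σ'.a B d y ≠ 0)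
    (h₁ : CrossAgree u (σ.a B) (σ'.a B) b r c₁ y) (h₂ : CrossAgree u (σ.a B) (σ'.a B) r d c₂ y)
    (h₃ : CrossAgree u (σ.a (exch B r c₁)) (σ'.a (exch B r c₁)) b d c₂ x) :
    CrossAgree u (σ.a B) (σ'.a B) b d x y := by
  have nr : σ.a B r c₁ ≠ 0 := by simp [hr₁]
  have nr' : σ'.a B r c₁ ≠ 0 := by simp [hr₁']
  simp only [CrossAgree, crossRatio, hb₁, hb₃, hb₄, hr₁, hr₂, hd₂, hb₁', hb₃', hb₄',
    hr₁', hr₂', hd₂', one_mul, mul_one, div_one] at h₁ h₂ ⊢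
  simp only [CrossAgree, crossRatio, σ.a_other hB hr hc₁ nr hd hrd.symm hc₂ hcc.symm,
    σ.a_other hB hr hc₁ nr hd hrd.symm hx hxc₁, σ.a_other hB hr hc₁ nr hb hrb.symm hc₂ hcc.symm,
    σ.a_other hB hr hc₁ nr hb hrb.symm hx hxc₁,
    σ'.a_other hB' hr hc₁ nr' hd hrd.symm hc₂ hcc.symm,
    σ'.a_other hB' hr hc₁ nr' hd hrd.symm hx hxc₁,
    σ'.a_other hB' hr hc₁ nr' hb hrb.symm hc₂ hcc.symm,
    σ'.a_other hB' hr hc₁ nr' hb hrb.symm hx hxc₁, hb₁, hb₂, hb₃, hr₁, hr₂, hr₃, hd₁, hd₂, hb₁',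
    hb₂', hb₃', hr₁', hr₂', hr₃', hd₁', hd₂', mul_zero, div_one, one_mul,
    sub_zero, zero_sub, mul_one, neg_mul] at h₃
  obtain ⟨k₁, k₂, k₃, k₄⟩ := hW.of_path hB hb hr hd hc₁ hc₂ hx hy hrb hrd hbd hcc hxc₁ hxc₂ hyc₁
    hyc₂ hxy hb₁ hb₂ hb₃ hb₄ hr₁ hr₂ hr₃ rfl hd₁ hd₂ rfl rfl hr₄ hd₄ hd₃
  exact hu.map_div_of_path hr₄ hd₄ hd₃ hr₄' hd₄' hd₃' h₁ h₂ h₃ k₁ k₂ k₃ k₄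

theorem crossAgree_of_path (hu : IsCrossMap u) (hW : σ.WLUM) (hB : σ.IsBase B)
    (hB' : σ'.IsBase B) {b r d c₁ c₂ x y : E}
    (hb : b ∈ B) (hr : r ∈ B) (hd : d ∈ B) (hc₁ : c₁ ∉ B) (hc₂ : c₂ ∉ B) (hx : x ∉ B) (hy : y ∉ B)
    (hxc₁ : x ≠ c₁) (hxc₂ : x ≠ c₂) (hyc₁ : y ≠ c₁) (hyc₂ : y ≠ c₂) (hxy : x ≠ y)
    (hs : ∀ i ∈ B, ∀ j ∉ B, (σ.a B i j = 0 ↔ σ'.a B i j = 0))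
    (hb₁ : σ.a B b c₁ ≠ 0) (hb₂ : σ.a B b c₂ = 0) (hb₃ : σ.a B b x ≠ 0) (hb₄ : σ.a B b y ≠ 0)
    (hr₁ : σ.a B r c₁ ≠ 0) (hr₂ : σ.a B r c₂ ≠ 0) (hr₃ : σ.a B r x = 0) (hr₄ : σ.a B r y ≠ 0)
    (hd₁ : σ.a B d c₁ = 0) (hd₂ : σ.a B d c₂ ≠ 0) (hd₃ : σ.a B d x ≠ 0) (hd₄ : σ.a B d y ≠ 0)
    (h₁ : CrossAgree u (σ.a B) (σ'.a B) b r c₁ y) (h₂ : CrossAgree u (σ.a B) (σ'.a B) r d c₂ y)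
    (h₃ : CrossAgree u (σ.a (exch B r c₁)) (σ'.a (exch B r c₁)) b d c₂ x) :
    CrossAgree u (σ.a B) (σ'.a B) b d x y := by
  have hrb : r ≠ b := fun h => hr₂ (h ▸ hb₂)
  have hrd : r ≠ d := fun h => hr₁ (h ▸ hd₁)
  have hbd : b ≠ d := fun h => hb₁ (h ▸ hd₁)
  have hcc : c₁ ≠ c₂ := fun h => hb₁ (h ▸ hb₂)
  have ne : ∀ {i j}, i ∈ B → j ∉ B → i ≠ j := fun hi hj h => hj (h ▸ hi)
  have nz : ∀ {i j}, i ∈ B → j ∉ B → σ.a B i j ≠ 0 → σ'.a B i j ≠ 0 :=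
    fun hi hj hne h0 => hne ((hs _ hi _ hj).2 h0)
  have ez : ∀ {i j}, i ∈ B → j ∉ B → σ.a B i j = 0 → σ'.a B i j = 0 :=
    fun hi hj h0 => (hs _ hi _ hj).1 h0
  obtain ⟨t, ht, e₁, e₂, e₃, e₄, e₅, e₆⟩ := exists_scaling (σ.a B) hcc.symm ⟨hxc₁, hxc₂⟩
    ⟨hyc₁, hyc₂, hxy.symm⟩ ⟨ne hr hc₁, ne hr hc₂, ne hr hx, ne hr hy⟩
    ⟨ne hd hc₁, ne hd hc₂, ne hd hx, ne hd hy, hrd.symm⟩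
    ⟨ne hb hc₁, ne hb hc₂, ne hb hx, ne hb hy, hrb.symm, hbd⟩ hb₁ hb₃ hb₄ hr₁ hr₂ hd₂
  obtain ⟨t', ht', e₁', e₂', e₃', e₄', e₅', e₆'⟩ := exists_scaling (σ'.a B) hcc.symm ⟨hxc₁, hxc₂⟩
    ⟨hyc₁, hyc₂, hxy.symm⟩ ⟨ne hr hc₁, ne hr hc₂, ne hr hx, ne hr hy⟩
    ⟨ne hd hc₁, ne hd hc₂, ne hd hx, ne hd hy, hrd.symm⟩
    ⟨ne hb hc₁, ne hb hc₂, ne hb hx, ne hb hy, hrb.symm, hbd⟩ (nz hb hc₁ hb₁) (nz hb hx hb₃)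
    (nz hb hy hb₄) (nz hr hc₁ hr₁) (nz hr hc₂ hr₂) (nz hd hc₂ hd₂)
  have key := crossAgree_of_path_normalized (σ := σ.scale t ht) (σ' := σ'.scale t' ht') hu
    (hW.scale t ht) hB hB' hb hr hd hc₁ hc₂ hx hy hrb hrd hbd hcc hxc₁ hxc₂ hyc₁ hyc₂ hxy
    e₁ (by simp [scale, hb₂]) e₂ e₃ e₄ e₅ (by simp [scale, hr₃]) (by simp [scale, hr₄, ht])
    (by simp [scale, hd₁]) e₆ (by simp [scale, hd₃, ht]) (by simp [scale, hd₄, ht])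
    e₁' (by simp [scale, ez hb hc₂ hb₂]) e₂' e₃' e₄' e₅' (by simp [scale, ez hr hx hr₃])
    (by simp [scale, nz hr hy hr₄, ht']) (by simp [scale, ez hd hc₁ hd₁]) e₆'
    (by simp [scale, nz hd hx hd₃, ht']) (by simp [scale, nz hd hy hd₄, ht'])
  simp only [CrossAgree, crossRatio_scale] at key
  exact key h₁ h₂ h₃

/-- The row `i` meets the column `c`, where `c` is neither `x` nor `y`. -/
def EdgeOff (σ : PivotSystem K E) (x y : E) (B : Set E) (i c : E) : Prop :=
  i ∈ B ∧ c ∉ B ∧ c ≠ x ∧ c ≠ y ∧ σ.a B i c ≠ 0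

theorem crossAgree_of_rowWalk (hu : IsCrossMap u) (hW : σ.WLUM) {x y : E} (hxy : x ≠ y)
    (hX : ∀ B, σ.IsBase B → x ∉ B → σ'.IsBase B ∧ GoodOff u σ σ' {x} B)
    (hY : ∀ B, σ.IsBase B → y ∉ B → σ'.IsBase B ∧ GoodOff u σ σ' {y} B) (m : ℕ) :
    ∀ B, σ.IsBase B → x ∉ B → y ∉ B → ∀ b ∈ B, ∀ d ∈ B, RowWalk (σ.EdgeOff x y B) m b d →
      CrossAgree u (σ.a B) (σ'.a B) b d x y := by
  induction m using Nat.strong_induction_on with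
  | _ m ih =>
  intro B hB hx hy b hb d hd hwalk
  obtain ⟨hB', hGx⟩ := hX B hB hx
  obtain ⟨-, hGy⟩ := hY B hB hy
  have hs : ∀ i ∈ B, ∀ j ∉ B, (σ.a B i j = 0 ↔ σ'.a B i j = 0) := by
    intro i hi j hj
    by_cases hjx : j = x
    · exact hGy.supp i hi j hj (by subst hjx; exact hxy)
    · exact hGx.supp i hi j hj hjx
  have nz : ∀ {i j}, i ∈ B → j ∉ B → σ.a B i j ≠ 0 → σ'.a B i j ≠ 0 :=
    fun hi hj hne h0 => hne ((hs _ hi _ hj).2 h0)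
  refine CrossAgree.of_ne_zero hu (hs _ hb _ hx) (hs _ hb _ hy) (hs _ hd _ hx) (hs _ hd _ hy)
    fun hbx hby hdx hdy => ?_
  -- the columns `x, y` agree on two rows joined by a single column
  have one : ∀ b ∈ B, ∀ d ∈ B, ∀ c, σ.EdgeOff x y B b c → σ.EdgeOff x y B d c →
      σ.a B b x ≠ 0 → σ.a B b y ≠ 0 → σ.a B d x ≠ 0 → σ.a B d y ≠ 0 →
      CrossAgree u (σ.a B) (σ'.a B) b d x y := by
    rintro b hb d hd c ⟨-, hc, hcx, hcy, hbc⟩ ⟨-, -, -, -, hdc⟩ hbx hby hdx hdy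
    have hA : ∀ j, j = c ∨ j = x ∨ j = y → σ.a B b j ≠ 0 ∧ σ.a B d j ≠ 0 := by
      rintro i (rfl | rfl | rfl) <;> constructor <;> assumption
    refine CrossAgree.trans_col hu (j₁ := c) hA ?_ ((hW hB).2 b hb d hd c hc x hx y hy hA)
      (hGy.cross b hb d hd c hc x hx hcy hxy) (hGx.cross b hb d hd c hc y hy hcx hxy.symm)
    rintro i (rfl | rfl | rfl) <;> constructor <;> exact nz ‹_› ‹_› ‹_›
  -- a pivot that fixes the rows `b, d` on the columns `x, y`
  have pivot : ∀ p ∈ B, ∀ c ∉ B, c ≠ x → c ≠ y → σ.a B p c ≠ 0 → b ≠ p → d ≠ p →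
      (∀ i, i = b ∨ i = d → ∀ j, j = x ∨ j = y → σ.a B i c = 0 ∨ σ.a B p j = 0) →
      ∀ n, n < m → RowWalk (σ.EdgeOff x y (exch B p c)) n b d →
      CrossAgree u (σ.a B) (σ'.a B) b d x y := by
    intro p hp c hc hcx hcy hpc hbp hdp h n hn hw
    have key := ih n hn _ (σ.isBase_exch hB hp hc hpc) (notMem_exch hx hcx.symm)
      (notMem_exch hy hcy.symm) b (mem_exch_of_ne hb hbp) d (mem_exch_of_ne hd hdp) hw
    have e : ∀ i, i = b ∨ i = d → ∀ j, j = x ∨ j = y →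
        σ.a (exch B p c) i j = σ.a B i j ∧ σ'.a (exch B p c) i j = σ'.a B i j := by
      intro i hi j hj
      have hiB : i ∈ B := by rcases hi with rfl | rfl <;> assumption
      have hix : i ≠ p := by rcases hi with rfl | rfl <;> assumption
      have hjB : j ∉ B := by rcases hj with rfl | rfl <;> assumption
      have hjz : j ≠ c := by rcases hj with rfl | rfl <;> exact Ne.symm ‹_›
      rcases h i hi j hj with h' | h'
      · exact ⟨a_other_of_col_eq_zero hB hp hc hpc hiB hix hjB hjz h',
          a_other_of_col_eq_zero hB' hp hc (nz hp hc hpc) hiB hix hjB hjz ((hs _ hiB _ hc).1 h')⟩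
      · exact ⟨a_other_of_row_eq_zero hB hp hc hpc hiB hix hjB hjz h',
          a_other_of_row_eq_zero hB' hp hc (nz hp hc hpc) hiB hix hjB hjz ((hs _ hp _ hjB).1 h')⟩
    simpa [CrossAgree, crossRatio, e] using key
  cases hwalk with
  | nil => exact crossAgree_self_row hu (hs _ hb _ hx) (hs _ hb _ hy)
  | @cons _ _ c₀ r₁ _ f₁ f₂ hwalk =>
  cases hwalk with
  | nil => exact one _ hb _ hd _ f₁ f₂ hbx hby hdx hdy
  | @cons _ _ c₁ r₂ _ f₃ f₄ hwalk =>
  obtain ⟨hr₁, hc₁, hc₁x, hc₁y, hr₁c₁⟩ := id f₃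
  obtain ⟨-, hc₀, hc₀x, hc₀y, hbc₀⟩ := id f₁
  obtain ⟨-, -, -, -, hr₁c₀⟩ := id f₂
  obtain ⟨hr₂, -, -, -, hr₂c₁⟩ := id f₄
  by_cases hbc₁ : σ.a B b c₁ = 0
  swap
  · exact ih _ (by omega) B hB hx hy b hb d hd
      (.cons ⟨hb, hc₁, hc₁x, hc₁y, hbc₁⟩ f₄ hwalk)
  by_cases hr₂c₀ : σ.a B r₂ c₀ = 0
  swap
  · exact ih _ (by omega) B hB hx hy b hb d hd
      (.cons f₁ ⟨hr₂, hc₀, hc₀x, hc₀y, hr₂c₀⟩ hwalk)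
  have hbr₁ : b ≠ r₁ := fun h => hr₁c₁ (h ▸ hbc₁)
  have hbr₂ : b ≠ r₂ := fun h => hr₂c₁ (h ▸ hbc₁)
  have hr₁r₂ : r₁ ≠ r₂ := fun h => hr₁c₀ (h ▸ hr₂c₀)
  have hc₀c₁ : c₀ ≠ c₁ := fun h => hbc₀ (h ▸ hbc₁)
  cases hwalk with
  | nil =>
    by_cases hs₀ : σ.a B r₁ x = 0 <;> by_cases ht₀ : σ.a B r₁ y = 0
    · have hb1 : b ∈ exch B r₁ c₀ := mem_exch_of_ne hb hbr₁
      have hd1 : d ∈ exch B r₁ c₀ := mem_exch_of_ne hd hr₁r₂.symm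
      have hc1 : c₁ ∉ exch B r₁ c₀ := notMem_exch hc₁ hc₀c₁.symm
      refine pivot r₁ hr₁ c₀ hc₀ hc₀x hc₀y hr₁c₀ hbr₁ hr₁r₂.symm ?_ 1 (by omega)
        (.cons (c := c₁) ⟨hb1, hc1, hc₁x, hc₁y, ?_⟩ ⟨hd1, hc1, hc₁x, hc₁y, ?_⟩ (.nil _))
      · rintro i - j (rfl | rfl)
        · exact Or.inr hs₀
        · exact Or.inr ht₀
      · rw [σ.a_other hB hr₁ hc₀ hr₁c₀ hb hbr₁ hc₁ hc₀c₁.symm, hbc₁, zero_sub]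
        exact neg_ne_zero.2 (div_ne_zero (mul_ne_zero hbc₀ hr₁c₁) hr₁c₀)
      · rw [a_other_of_col_eq_zero hB hr₁ hc₀ hr₁c₀ hd hr₁r₂.symm hc₁ hc₀c₁.symm hr₂c₀]
        exact hr₂c₁
    · have hB1 := σ.isBase_exch hB hr₁ hc₀ hr₁c₀
      exact crossAgree_of_path hu hW hB hB' hb hr₁ hd hc₀ hc₁ hx hy hc₀x.symm hc₁x.symm hc₀y.symm
        hc₁y.symm hxy hs hbc₀ hbc₁ hbx hby hr₁c₀ hr₁c₁ hs₀ ht₀ hr₂c₀ hr₂c₁ hdx hdy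
        (hGx.cross _ hb _ hr₁ _ hc₀ _ hy hc₀x hxy.symm)
        (hGx.cross _ hr₁ _ hd _ hc₁ _ hy hc₁x hxy.symm)
        ((hY _ hB1 (notMem_exch hy hc₀y.symm)).2.cross _ (mem_exch_of_ne hb hbr₁) _
          (mem_exch_of_ne hd hr₁r₂.symm) _ (notMem_exch hc₁ hc₀c₁.symm) _
          (notMem_exch hx hc₀x.symm) hc₁y hxy)
    · have hB1 := σ.isBase_exch hB hr₁ hc₀ hr₁c₀
      refine CrossAgree.swap_col hu ?_
      exact crossAgree_of_path hu hW hB hB' hb hr₁ hd hc₀ hc₁ hy hx hc₀y.symm hc₁y.symm hc₀x.symm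
        hc₁x.symm hxy.symm hs hbc₀ hbc₁ hby hbx hr₁c₀ hr₁c₁ ht₀ hs₀ hr₂c₀ hr₂c₁ hdy hdx
        (hGy.cross _ hb _ hr₁ _ hc₀ _ hx hc₀y hxy)
        (hGy.cross _ hr₁ _ hd _ hc₁ _ hx hc₁y hxy)
        ((hX _ hB1 (notMem_exch hx hc₀x.symm)).2.cross _ (mem_exch_of_ne hb hbr₁) _
          (mem_exch_of_ne hd hr₁r₂.symm) _ (notMem_exch hc₁ hc₀c₁.symm) _
          (notMem_exch hy hc₀y.symm) hc₁x hxy.symm)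
    · have hA : ∀ i, i = r₁ ∨ i = b ∨ i = d → σ.a B i x ≠ 0 ∧ σ.a B i y ≠ 0 := by
        rintro i (rfl | rfl | rfl) <;> constructor <;> assumption
      refine CrossAgree.trans_row hu (i₁ := r₁) hA ?_
        ((hW hB).1 r₁ hr₁ b hb d hd x hx y hy hA)
        (one _ hr₁ _ hb _ f₂ f₁ hs₀ ht₀ hbx hby) (one _ hr₁ _ hd _ f₃ f₄ hs₀ ht₀ hdx hdy)
      rintro i (rfl | rfl | rfl) <;> constructor <;> exact nz ‹_› ‹_› ‹_›
  | @cons n _ c₂ r₃ _ f₅ f₆ hwalk =>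
    obtain ⟨-, hc₂, hc₂x, hc₂y, hr₂c₂⟩ := id f₅
    by_cases hr₁c₂ : σ.a B r₁ c₂ = 0
    swap
    · exact ih _ (by omega) B hB hx hy b hb d hd
        (.cons f₁ f₂ (.cons ⟨hr₁, hc₂, hc₂x, hc₂y, hr₁c₂⟩ f₆ hwalk))
    have hc₂c₁ : c₂ ≠ c₁ := fun h => hr₁c₁ (h ▸ hr₁c₂)
    have hF : ∀ p q, ¬ (σ.a B p c₁ ≠ 0) → σ.EdgeOff x y B p q →
        σ.EdgeOff x y (exch B r₂ c₁) p q := by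
      rintro p q hp ⟨hpB, hq, hqx, hqy, hpq⟩
      rw [not_not] at hp
      have hpr : p ≠ r₂ := fun h => hr₂c₁ (h ▸ hp)
      have hqc : q ≠ c₁ := fun h => hpq (h ▸ hp)
      refine ⟨mem_exch_of_ne hpB hpr, notMem_exch hq hqc, hqx, hqy, ?_⟩
      rwa [a_other_of_col_eq_zero hB hr₂ hc₁ hr₂c₁ hpB hpr hq hqc hp]
    rcases hwalk.exists_mem_or (fun p => σ.a B p c₁ ≠ 0) hF with
      ⟨p, n₁, n₂, hp, w₁, w₂, e⟩ | ⟨w, hr₃, hd'⟩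
    · have hpB : p ∈ B := by
        cases w₂ with
        | nil => exact hd
        | cons f _ _ => exact f.1
      exact ih _ (by omega) B hB hx hy b hb d hd
        (.cons f₁ f₂ (.cons f₃ ⟨hpB, hc₁, hc₁x, hc₁y, hp⟩ w₂))
    · have hd0 : σ.a B d c₁ = 0 := not_not.1 hd'
      refine pivot r₂ hr₂ c₁ hc₁ hc₁x hc₁y hr₂c₁ hbr₂ (fun h => hr₂c₁ (h ▸ hd0)) ?_ (n + 2)
        (by omega) (.cons (hF _ _ (not_not.2 hbc₁) f₁) (i' := r₁) ⟨?_, ?_, hc₀x, hc₀y, ?_⟩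
          (.cons (c := c₂) ⟨?_, ?_, hc₂x, hc₂y, ?_⟩ (hF _ _ hr₃ f₆) w))
      · rintro i (rfl | rfl) j -
        · exact Or.inl hbc₁
        · exact Or.inl hd0
      · exact mem_exch_of_ne hr₁ hr₁r₂
      · exact notMem_exch hc₀ hc₀c₁
      · rwa [a_other_of_row_eq_zero hB hr₂ hc₁ hr₂c₁ hr₁ hr₁r₂ hc₀ hc₀c₁ hr₂c₀]
      · exact mem_exch_of_ne hr₁ hr₁r₂
      · exact notMem_exch hc₂ hc₂c₁
      · rw [σ.a_other hB hr₂ hc₁ hr₂c₁ hr₁ hr₁r₂ hc₂ hc₂c₁, hr₁c₂, zero_sub]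
        exact neg_ne_zero.2 (div_ne_zero (mul_ne_zero hr₁c₁ hr₂c₂) hr₂c₁)

end PivotSystem

namespace PivotSystem

variable {K L E : Type*} [Field K] [Field L] {u : K → L} {σ : PivotSystem K E}
  {τ τ' : PivotSystem L E}

theorem Lift.a_eq_zero_iff (h : Lift u σ τ) {B : Set E} (hB : σ.IsBase B) {i j : E} (hi : i ∈ B)
    (hj : j ∉ B) : σ.a B i j = 0 ↔ τ.a B i j = 0 :=
  (h hB).2.supp i hi j hj (notMem_empty _)

theorem Lift.crossAgree (h : Lift u σ τ) {B : Set E} (hB : σ.IsBase B) {i k j l : E} (hi : i ∈ B)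
    (hk : k ∈ B) (hj : j ∉ B) (hl : l ∉ B) : CrossAgree u (σ.a B) (τ.a B) i k j l :=
  (h hB).2.cross i hi k hk j hj l hl (notMem_empty _) (notMem_empty _)

/-- Nonzero entries at which two systems agree. -/
def EdgeAgree (σ : PivotSystem K E) (τ τ' : PivotSystem L E) (B : Set E) (i j : E) : Prop :=
  i ∈ B ∧ j ∉ B ∧ σ.a B i j ≠ 0 ∧ τ.a B i j = τ'.a B i j

theorem Lift.agree_of_two_by_two (hτ : Lift u σ τ) (hτ' : Lift u σ τ') {B : Set E}
    (hB : σ.IsBase B) {i k c j : E} (h₁ : EdgeAgree σ τ τ' B i c) (h₂ : EdgeAgree σ τ τ' B k c)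
    (h₃ : EdgeAgree σ τ τ' B k j) : τ.a B i j = τ'.a B i j := by
  obtain ⟨hi, hc, n1, e1⟩ := h₁
  obtain ⟨hk, -, n2, e2⟩ := h₂
  obtain ⟨-, hj, n3, e3⟩ := h₃
  have key : crossRatio (τ.a B) i k j c = crossRatio (τ'.a B) i k j c :=
    (hτ.crossAgree hB hi hk hj hc).symm.trans (hτ'.crossAgree hB hi hk hj hc)
  simp only [crossRatio, e1, e2, e3] at key
  have m1 := (hτ'.a_eq_zero_iff hB hi hc).not.1 n1
  have m2 := (hτ'.a_eq_zero_iff hB hk hc).not.1 n2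
  have m3 := (hτ'.a_eq_zero_iff hB hk hj).not.1 n3
  rw [div_left_inj' (mul_ne_zero m1 m3)] at key
  exact mul_right_cancel₀ m2 key

theorem Lift.agree_of_rowWalk (hτ : Lift u σ τ) (hτ' : Lift u σ τ') (n : ℕ) :
    ∀ B, σ.IsBase B → ∀ i ∈ B, ∀ k j, RowWalk (EdgeAgree σ τ τ' B) n i k →
      EdgeAgree σ τ τ' B k j → σ.a B i j ≠ 0 → τ.a B i j = τ'.a B i j := by
  induction n using Nat.strong_induction_on with | _ n ih => ?_
  intro B hB i hi k j hw hkj hij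
  have nz : ∀ {i j}, i ∈ B → j ∉ B → σ.a B i j ≠ 0 → τ.a B i j ≠ 0 ∧ τ'.a B i j ≠ 0 :=
    fun hi hj h => ⟨(hτ.a_eq_zero_iff hB hi hj).not.1 h, (hτ'.a_eq_zero_iff hB hi hj).not.1 h⟩
  have hj : j ∉ B := hkj.2.1
  cases hw with
  | nil => exact hkj.2.2.2
  | @cons n _ c i₁ _ f₁ f₂ hw =>
  cases hw with
  | nil => exact hτ.agree_of_two_by_two hτ' hB f₁ f₂ hkj
  | @cons n _ c₂ i₂ _ f₃ f₄ hw =>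
  obtain ⟨hi₁, hc, hi₁c, eqi₁c⟩ := id f₂
  obtain ⟨-, -, hic, eqic⟩ := id f₁
  obtain ⟨-, hc₂, hi₁c₂, eqi₁c₂⟩ := id f₃
  obtain ⟨hi₂, -, hi₂c₂, eqi₂c₂⟩ := id f₄
  by_cases hi₁j : σ.a B i₁ j = 0
  swap
  · exact hτ.agree_of_two_by_two hτ' hB f₁ f₂
      ⟨hi₁, hj, hi₁j, ih _ (by omega) B hB i₁ hi₁ k j (.cons f₃ f₄ hw) hkj hi₁j⟩
  by_cases hic₂ : σ.a B i c₂ = 0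
  swap
  · exact ih _ (by omega) B hB i hi k j
      (.cons ⟨hi, hc₂, hic₂, hτ.agree_of_two_by_two hτ' hB f₁ f₂ f₃⟩ f₄ hw) hkj hij
  have hii₁ : i ≠ i₁ := fun h => hij (h ▸ hi₁j)
  have hcc₂ : c₂ ≠ c := fun h => hic (h ▸ hic₂)
  have hB₁ := σ.isBase_exch hB hi₁ hc hi₁c
  have hBτ := (hτ hB).1
  have hBτ' := (hτ' hB).1
  obtain ⟨mτ, mτ'⟩ := nz hi₁ hc hi₁c
  have same : ∀ p q, σ.a B p c = 0 → EdgeAgree σ τ τ' B p q →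
      EdgeAgree σ τ τ' (exch B i₁ c) p q := by
    rintro p q h0 ⟨hp, hq, h1, h2⟩
    have hpi : p ≠ i₁ := fun h => hi₁c (h ▸ h0)
    have hqc : q ≠ c := fun h => h1 (h ▸ h0)
    refine ⟨mem_exch_of_ne hp hpi, notMem_exch hq hqc, ?_, ?_⟩
    · rwa [a_other_of_col_eq_zero hB hi₁ hc hi₁c hp hpi hq hqc h0]
    · rwa [a_other_of_col_eq_zero hBτ hi₁ hc mτ hp hpi hq hqc
          ((hτ.a_eq_zero_iff hB hp hc).1 h0),
        a_other_of_col_eq_zero hBτ' hi₁ hc mτ' hp hpi hq hqc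
          ((hτ'.a_eq_zero_iff hB hp hc).1 h0)]
  rcases hw.exists_mem_or (fun p => σ.a B p c ≠ 0)
      (fun p q hp hpq => same p q (not_not.1 hp) hpq) with ⟨p, n₁, n₂, hp, w₁, w₂, e⟩ | ⟨w, hr, hk⟩
  · have hpB : p ∈ B := by
      cases w₂ with
      | nil => exact hkj.1
      | cons f _ _ => exact f.1
    exact ih (n₂ + 1) (by omega) B hB i hi k j (.cons f₁ ⟨hpB, hc, hp,
      ih (n₁ + 1) (by omega) B hB p hpB i₁ c (w₁.symm.snoc f₄ f₃) f₂ hp⟩ w₂) hkj hij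
  · rw [not_not] at hr hk
    have hjc : j ≠ c := fun h => hkj.2.2.1 (h ▸ hk)
    have hiB := mem_exch_of_ne hi hii₁ (j := c)
    have hcB := notMem_exch hc₂ hcc₂ (i := i₁)
    have key := ih (n + 1) (by omega) _ hB₁ i hiB k j (.cons (c := c₂) ⟨hiB, hcB, ?_, ?_⟩
      (same _ _ hr f₄) w) (same _ _ hk hkj)
    · rw [a_other_of_row_eq_zero hB hi₁ hc hi₁c hi hii₁ hj hjc hi₁j,
        a_other_of_row_eq_zero hBτ hi₁ hc mτ hi hii₁ hj hjc
          ((hτ.a_eq_zero_iff hB hi₁ hj).1 hi₁j),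
        a_other_of_row_eq_zero hBτ' hi₁ hc mτ' hi hii₁ hj hjc
          ((hτ'.a_eq_zero_iff hB hi₁ hj).1 hi₁j)] at key
      exact key hij
    · rw [σ.a_other hB hi₁ hc hi₁c hi hii₁ hc₂ hcc₂, hic₂, zero_sub]
      exact neg_ne_zero.2 (div_ne_zero (mul_ne_zero hic hi₁c₂) hi₁c)
    · rw [τ.a_other hBτ hi₁ hc mτ hi hii₁ hc₂ hcc₂, τ'.a_other hBτ' hi₁ hc mτ' hi hii₁ hc₂ hcc₂,
        (hτ.a_eq_zero_iff hB hi hc₂).1 hic₂, (hτ'.a_eq_zero_iff hB hi hc₂).1 hic₂, eqic, eqi₁c₂,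
        eqi₁c]

end PivotSystem

section Forest

/-- The rooted spanning forest given by the parent function `p`, where `h` is the height. -/
structure IsSpanningForest {V : Type*} (G : SimpleGraph V) (h : V → ℕ) (p : V → V) : Prop where
  adj_parent : ∀ v, h v ≠ 0 → G.Adj v (p v)
  height_parent : ∀ v, h v ≠ 0 → h (p v) + 1 = h v
  root_unique : ∀ v w, G.Reachable v w → h v = 0 → h w = 0 → v = w
  height_le : ∀ v w, G.Adj v w → h w ≤ h v + 1

variable {V : Type*} {G : SimpleGraph V}

/-- A breadth first spanning forest with a prescribed root. -/
theorem exists_isSpanningForest (G : SimpleGraph V) (r : V) :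
    ∃ h p, IsSpanningForest G h p ∧ h r = 0 := by
  classical
  let root : G.ConnectedComponent → V := fun c => if c = G.connectedComponentMk r then r else c.out
  have hroot : ∀ c, G.connectedComponentMk (root c) = c := by
    intro c
    by_cases hc : c = G.connectedComponentMk r
    · simp [root, hc]
    · simp only [root, if_neg hc]
      exact Quot.out_eq c
  let ρ : V → V := fun v => root (G.connectedComponentMk v)
  have hρ : ∀ v, G.Reachable (ρ v) v := fun v => SimpleGraph.ConnectedComponent.exact (hroot _)
  have hρeq : ∀ v w, G.Reachable v w → ρ v = ρ w := fun v w h => by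
    simp only [ρ, SimpleGraph.ConnectedComponent.sound h]
  have hpar : ∀ v, ∃ w, G.dist (ρ v) v ≠ 0 → G.Adj v w ∧ G.dist (ρ w) w + 1 = G.dist (ρ v) v := by
    intro v
    by_cases h0 : G.dist (ρ v) v = 0
    · exact ⟨v, fun h => absurd h0 h⟩
    obtain ⟨q, hq⟩ := (hρ v).symm.exists_walk_length_eq_dist
    rw [SimpleGraph.dist_comm] at hq
    obtain ⟨w, hvw, q', hlen⟩ : ∃ w, ∃ _ : G.Adj v w, ∃ q' : G.Walk w (ρ v),
        q'.length + 1 = q.length := by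
      have h0' : q.length ≠ 0 := hq ▸ h0
      clear hq h0
      generalize ρ v = z at q
      cases q with
      | nil => exact absurd rfl h0'
      | cons h q => exact ⟨_, h, q, rfl⟩
    refine ⟨w, fun _ => ⟨hvw, ?_⟩⟩
    have e : ρ w = ρ v := (hρeq v w hvw.reachable).symm
    rw [e]
    have h1 : G.dist (ρ v) w ≤ q'.length := by
      rw [SimpleGraph.dist_comm]; exact SimpleGraph.dist_le q'
    have h2 : G.dist (ρ v) v ≤ G.dist (ρ v) w + 1 := by
      obtain ⟨q', hq'⟩ := (e ▸ hρ w : G.Reachable (ρ v) w).exists_walk_length_eq_dist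
      rw [← hq']
      simpa using SimpleGraph.dist_le (q'.concat hvw.symm)
    omega
  choose p hp using hpar
  refine ⟨fun v => G.dist (ρ v) v, p, ⟨fun v hv => (hp v hv).1, fun v hv => (hp v hv).2, ?_, ?_⟩, ?_⟩
  · intro v w hvw hv hw
    rw [(hρ v).dist_eq_zero_iff] at hv
    rw [(hρ w).dist_eq_zero_iff] at hw
    rw [← hv, ← hw, hρeq v w hvw]
  · intro v w hvw
    have e : ρ w = ρ v := (hρeq v w hvw.reachable).symm
    show G.dist (ρ w) w ≤ G.dist (ρ v) v + 1
    rw [e]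
    obtain ⟨q', hq'⟩ := (hρ v).exists_walk_length_eq_dist
    rw [← hq']
    simpa using SimpleGraph.dist_le (q'.concat hvw)
  · have : ρ r = r := by simp [ρ, root]
    simp [this]

namespace IsSpanningForest

variable {h : V → ℕ} {p : V → V} (hF : IsSpanningForest G h p)
include hF

/-- A graph containing the edges of a spanning forest has the same components. -/
theorem reachable_of_le {H : SimpleGraph V} (hH : ∀ v, h v ≠ 0 → H.Adj v (p v)) {v w : V}
    (hvw : G.Reachable v w) : H.Reachable v w := by
  have key : ∀ n v, h v = n → ∃ r, h r = 0 ∧ H.Reachable v r ∧ G.Reachable v r := by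
    intro n
    induction n with
    | zero => exact fun v hv => ⟨v, hv, .refl _, .refl _⟩
    | succ n ih =>
      intro v hv
      have hv0 : h v ≠ 0 := by omega
      have := hF.height_parent v hv0
      obtain ⟨r, hr, h1, h2⟩ := ih (p v) (by omega)
      exact ⟨r, hr, (hH v hv0).reachable.trans h1, (hF.adj_parent v hv0).reachable.trans h2⟩
  obtain ⟨r, hr, h1, h2⟩ := key _ v rfl
  obtain ⟨s, hs, h3, h4⟩ := key _ w rfl
  rw [hF.root_unique r s (h2.symm.trans (hvw.trans h4)) hr hs] at h1
  exact h1.trans h3.symm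

/-- Weights of the vertices adapted to a spanning forest. -/
theorem exists_weight {L : Type*} [MulZeroOneClass L] [Nontrivial L] (f : V → L → L)
    (hf : ∀ v x, h v ≠ 0 → x ≠ 0 → f v x ≠ 0) :
    ∃ t : V → L, (∀ v, t v ≠ 0) ∧ ∀ v, h v ≠ 0 → t v = f v (t (p v)) := by
  let g : ℕ → V → L := fun n => Nat.rec (fun _ => 1) (fun _ g v => f v (g (p v))) n
  refine ⟨fun v => g (h v) v, ?_, ?_⟩
  · suffices ∀ n v, h v = n → g n v ≠ 0 from fun v => this _ v rfl
    intro n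
    induction n with
    | zero => exact fun v _ => one_ne_zero
    | succ n ih =>
      intro v hv
      have hv0 : h v ≠ 0 := by omega
      have := hF.height_parent v hv0
      exact hf v _ hv0 (ih (p v) (by omega))
  · intro v hv
    show g (h v) v = f v (g (h (p v)) (p v))
    rw [← hF.height_parent v hv]

end IsSpanningForest

end Forest

namespace PivotSystem

variable {K L E : Type*} [Field K] [Field L] {u : K → L} {σ : PivotSystem K E}
  {τ τ' : PivotSystem L E} {B B' : Set E}

/-- The bipartite graph of the nonzero entries at a base. -/
def graph (σ : PivotSystem K E) (B : Set E) : SimpleGraph E where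
  Adj v w := (v ∈ B ∧ w ∉ B ∧ σ.a B v w ≠ 0) ∨ (w ∈ B ∧ v ∉ B ∧ σ.a B w v ≠ 0)
  symm := ⟨fun _ _ h => h.symm⟩
  loopless := ⟨fun v h => by rcases h with h | h <;> exact h.2.1 h.1⟩

theorem graph_adj_iff {i j : E} (hi : i ∈ B) (hj : j ∉ B) :
    (σ.graph B).Adj i j ↔ σ.a B i j ≠ 0 := by
  simp [graph, hi, hj]

theorem graph_adj {i j : E} (hi : i ∈ B) (hj : j ∉ B) (h : σ.a B i j ≠ 0) :
    (σ.graph B).Adj i j := (graph_adj_iff hi hj).2 h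

theorem reachable_of_reachable (hB : σ.IsBase B) (hB' : σ.IsBase B') {v w : E}
    (h : (σ.graph B).Reachable v w) : (σ.graph B').Reachable v w := by
  refine σ.base_induction hB' (fun B => ∀ v w, (σ.graph B).Reachable v w →
    (σ.graph B').Reachable v w) (fun _ _ h => h) ?_ hB v w h
  intro B i j hB ih hi hj hne
  have key : ∀ v w, (σ.graph (exch B i j)).Adj v w → (σ.graph B').Reachable v w := by
    have aux : ∀ v ∈ exch B i j, ∀ w ∉ exch B i j, σ.a (exch B i j) v w ≠ 0 →
        (σ.graph B').Reachable v w := by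
      intro v hv w hw h
      refine ih _ _ ?_
      have hij := (graph_adj hi hj hne).reachable
      rw [notMem_exch_iff hi hj] at hw
      rcases mem_exch.1 hv with rfl | ⟨hk, hki⟩ <;> rcases hw with rfl | ⟨hl, hlj⟩
      · exact hij.symm
      · rw [σ.a_row hB hi hj hne hl hlj] at h
        exact hij.symm.trans (graph_adj hi hl (div_ne_zero_iff.1 h).1).reachable
      · rw [σ.a_col hB hi hj hne hk hki] at h
        exact (graph_adj hk hj (neg_ne_zero.1 (div_ne_zero_iff.1 h).1)).reachable.trans hij.symm
      · rw [σ.a_other hB hi hj hne hk hki hl hlj] at h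
        by_cases h1 : σ.a B v w = 0
        · rw [h1, zero_sub, neg_ne_zero, div_ne_zero_iff, mul_ne_zero_iff] at h
          exact (graph_adj hk hj h.1.1).reachable.trans (hij.symm.trans
            (graph_adj hi hl h.1.2).reachable)
        · exact (graph_adj hk hl h1).reachable
    rintro v w (⟨h1, h2, h3⟩ | ⟨h1, h2, h3⟩)
    · exact aux v h1 w h2 h3
    · exact (aux w h1 v h2 h3).symm
  rintro v w ⟨q⟩
  induction q with
  | nil => exact .refl _
  | cons h _ ih => exact (key _ _ h).trans ih

/-- Lifts that agree along a connected set of entries agree there. -/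
theorem Lift.agree_of_reachable (hτ : Lift u σ τ) (hτ' : Lift u σ τ') (hB : σ.IsBase B)
    {H : SimpleGraph E} (hH : ∀ v w, H.Adj v w →
      EdgeAgree σ τ τ' B v w ∨ EdgeAgree σ τ τ' B w v) {i j : E} (hi : i ∈ B) (hj : j ∉ B)
    (hij : H.Reachable i j) : τ.a B i j = τ'.a B i j := by
  by_cases hne : σ.a B i j = 0
  · rw [(hτ.a_eq_zero_iff hB hi hj).1 hne, (hτ'.a_eq_zero_iff hB hi hj).1 hne]
  obtain ⟨q⟩ := hij
  have key : ∀ v w, H.Walk v w → w ∉ B →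
      (v ∈ B → ∃ n k, RowWalk (EdgeAgree σ τ τ' B) n v k ∧ EdgeAgree σ τ τ' B k w) ∧
      (v ∉ B → ∀ i, EdgeAgree σ τ τ' B i v →
        ∃ n k, RowWalk (EdgeAgree σ τ τ' B) n i k ∧ EdgeAgree σ τ τ' B k w) := by
    intro v w q
    induction q with
    | nil => exact fun h => ⟨fun h' => absurd h' h, fun _ i hi => ⟨0, i, .nil i, hi⟩⟩
    | @cons v v' w h q ih =>
      intro hw
      obtain ⟨ih1, ih2⟩ := ih hw
      rcases hH _ _ h with h | h
      · exact ⟨fun _ => ih2 h.2.1 v h, fun h' => absurd h.1 h'⟩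
      · refine ⟨fun h' => absurd h' h.2.1, fun _ i hi => ?_⟩
        obtain ⟨n, k, h1, h2⟩ := ih1 h.1
        exact ⟨n + 1, k, .cons hi h h1, h2⟩
  obtain ⟨n, k, h1, h2⟩ := (key i j q hj).1 hi
  exact hτ.agree_of_rowWalk hτ' n B hB i hi k j h1 h2 hne

/-- The entries along the edges of the forest are one. -/
def IsNormalized (τ : PivotSystem L E) (B : Set E) (h : E → ℕ) (p : E → E) : Prop :=
  ∀ v, h v ≠ 0 → (v ∈ B → τ.a B v (p v) = 1) ∧ (v ∉ B → τ.a B (p v) v = 1)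

theorem Lift.agree_of_isNormalized (hτ : Lift u σ τ) (hτ' : Lift u σ τ') (hB : σ.IsBase B)
    {h : E → ℕ} {p : E → E} (hF : IsSpanningForest (σ.graph B) h p) (hN : τ.IsNormalized B h p)
    (hN' : τ'.IsNormalized B h p) {i j : E} (hi : i ∈ B) (hj : j ∉ B) :
    τ.a B i j = τ'.a B i j := by
  by_cases hne : σ.a B i j = 0
  · rw [(hτ.a_eq_zero_iff hB hi hj).1 hne, (hτ'.a_eq_zero_iff hB hi hj).1 hne]
  let H : SimpleGraph E :=
    { Adj := fun v w => EdgeAgree σ τ τ' B v w ∨ EdgeAgree σ τ τ' B w v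
      symm := ⟨fun _ _ h => h.symm⟩
      loopless := ⟨fun v h => by rcases h with h | h <;> exact h.2.1 h.1⟩ }
  refine hτ.agree_of_reachable hτ' hB (H := H) (fun _ _ h => h) hi hj ?_
  refine hF.reachable_of_le (fun v hv => ?_) (graph_adj hi hj hne).reachable
  rcases hF.adj_parent v hv with ⟨h1, h2, h3⟩ | ⟨h1, h2, h3⟩
  · exact Or.inl ⟨h1, h2, h3, ((hN v hv).1 h1).trans ((hN' v hv).1 h1).symm⟩
  · exact Or.inr ⟨h1, h2, h3, ((hN v hv).2 h2).trans ((hN' v hv).2 h2).symm⟩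

theorem Lift.scale (hτ : Lift u σ τ) (t : E → L) (ht : ∀ e, t e ≠ 0) :
    Lift u σ (τ.scale t ht) := by
  intro B hB
  refine ⟨(hτ hB).1, fun i hi j hj _ => ?_, fun i hi k hk j hj l hl _ _ => ?_⟩
  · rw [hτ.a_eq_zero_iff hB hi hj]
    simp [PivotSystem.scale, ht]
  · rw [CrossAgree, crossRatio_scale t ht]
    exact hτ.crossAgree hB hi hk hj hl

theorem Lift.exists_isNormalized (hτ : Lift u σ τ) (hB : σ.IsBase B) {h : E → ℕ} {p : E → E}
    {G : SimpleGraph E} (hG : G ≤ σ.graph B) (hF : IsSpanningForest G h p) :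
    ∃ t : E → L, ∃ ht : ∀ e, t e ≠ 0, (τ.scale t ht).IsNormalized B h p := by
  classical
  have nz : ∀ {i j}, i ∈ B → j ∉ B → σ.a B i j ≠ 0 → τ.a B i j ≠ 0 :=
    fun hi hj h => (hτ.a_eq_zero_iff hB hi hj).not.1 h
  obtain ⟨t, ht, ht'⟩ := hF.exists_weight
    (fun v x => if v ∈ B then τ.a B v (p v) * x else x / τ.a B (p v) v) (by
      intro v x hv hx
      rcases hG (hF.adj_parent v hv) with ⟨h1, h2, h3⟩ | ⟨h1, h2, h3⟩
      · simp [h1, nz h1 h2 h3, hx]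
      · simp [h2, nz h1 h2 h3, hx])
  refine ⟨t, ht, fun v hv => ⟨fun hvB => ?_, fun hvB => ?_⟩⟩
  · have e := ht' v hv
    rw [if_pos hvB] at e
    show τ.a B v (p v) * t (p v) / t v = 1
    rw [← e, div_self (ht v)]
  · have e := ht' v hv
    rw [if_neg hvB] at e
    have h3 : τ.a B (p v) v ≠ 0 := by
      rcases hG (hF.adj_parent v hv) with ⟨h1, -, -⟩ | ⟨h1, h2, h3⟩
      · exact absurd h1 hvB
      · exact nz h1 h2 h3
    show τ.a B (p v) v * t v / t (p v) = 1
    rw [e, mul_div_cancel₀ _ h3, div_self (ht _)]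

end PivotSystem

namespace PivotSystem

section ofVectors

variable {K E V : Type*} [Field K] [AddCommGroup V] [Module K V] (φ : E → V)

open Classical in
/-- Coordinates of `φ j` with respect to the vectors indexed by `B`. -/
noncomputable def coord (B : Set E) (j : E) : E →₀ K :=
  if h : ∃ f ∈ Finsupp.supported K K B, Finsupp.linearCombination K φ f = φ j then h.choose else 0

/-- The vectors indexed by `B` form a basis of the span of all vectors. -/
def IsVectorBase (K : Type*) [Field K] [Module K V] (φ : E → V) (B : Set E) : Prop :=
  LinearIndepOn K φ B ∧ ∀ j, φ j ∈ Submodule.span K (φ '' B)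

variable {φ}

theorem IsVectorBase.coord_spec {B : Set E} (hB : IsVectorBase K φ B) (j : E) :
    coord φ B j ∈ Finsupp.supported K K B ∧
      Finsupp.linearCombination K φ (coord (K := K) φ B j) = φ j := by
  have h := (Finsupp.mem_span_image_iff_linearCombination K).1 (hB.2 j)
  rw [coord, dif_pos h]
  exact h.choose_spec

theorem IsVectorBase.coord_eq {B : Set E} (hB : IsVectorBase K φ B) {j : E} {f : E →₀ K}
    (hf : ∀ i ∉ B, f i = 0) (hj : Finsupp.linearCombination K φ f = φ j) : coord φ B j = f := by
  obtain ⟨h1, h2⟩ := hB.coord_spec j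
  have h3 : coord φ B j - f ∈ Finsupp.supported K K B :=
    sub_mem h1 ((Finsupp.mem_supported' K f).2 hf)
  exact sub_eq_zero.1 (linearIndepOn_iff.1 hB.1 _ h3 (by rw [map_sub, h2, hj, sub_self]))

theorem IsVectorBase.coord_apply {B : Set E} (hB : IsVectorBase K φ B) (j : E) {i : E}
    (hi : i ∉ B) : coord (K := K) φ B j i = 0 :=
  (Finsupp.mem_supported' K _).1 (hB.coord_spec j).1 i hi

theorem IsVectorBase.coord_of_mem {B : Set E} (hB : IsVectorBase K φ B) {j : E} (hj : j ∈ B) :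
    coord (K := K) φ B j = Finsupp.single j 1 :=
  hB.coord_eq (fun i hi => Finsupp.single_eq_of_ne (fun h => hi (h ▸ hj))) (by simp)

section pivot

variable {B : Set E} (hB : IsVectorBase K φ B) {i j : E} (hi : i ∈ B) (hj : j ∉ B)
  (hne : coord (K := K) φ B j i ≠ 0)
include hB hi hj hne

theorem IsVectorBase.linearIndepOn_exch : LinearIndepOn K φ (exch B i j) := by
  classical
  have hij : i ≠ j := fun h => hj (h ▸ hi)
  rw [linearIndepOn_iff]
  intro g hg h0
  rw [Finsupp.mem_supported'] at hg
  obtain ⟨h1, h2⟩ := hB.coord_spec j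
  have hg' : g + g j • (coord φ B j - Finsupp.single j 1) ∈ Finsupp.supported K K B := by
    rw [Finsupp.mem_supported']
    intro k hk
    by_cases hkj : k = j
    · subst hkj
      simp [hB.coord_apply k hk]
    · simp [hB.coord_apply j hk, Finsupp.single_eq_of_ne hkj, hg k (notMem_exch hk hkj)]
  have h3 := linearIndepOn_iff.1 hB.1 _ hg' (by
    rw [map_add, map_smul, map_sub, h0, h2]; simp)
  have h4 := DFunLike.congr_fun h3 i
  simp [hg i (notMem_exch_self hij), Finsupp.single_eq_of_ne hij, hne] at h4
  simpa [h4] using h3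

theorem IsVectorBase.exists_coord_exch : ∃ f : E →₀ K, (∀ k ∉ exch B i j, f k = 0) ∧
    Finsupp.linearCombination K φ f = φ i ∧ f j = (coord (K := K) φ B j i)⁻¹ ∧
    ∀ k ∈ B, k ≠ i → f k = -coord (K := K) φ B j k / coord (K := K) φ B j i := by
  classical
  have hij : i ≠ j := fun h => hj (h ▸ hi)
  obtain ⟨h1, h2⟩ := hB.coord_spec j
  refine ⟨(coord (K := K) φ B j i)⁻¹ • (Finsupp.single j 1 - coord φ B j +
    Finsupp.single i (coord (K := K) φ B j i)), ?_, ?_, ?_, ?_⟩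
  · intro k hk
    rcases (notMem_exch_iff hi hj).1 hk with rfl | ⟨hk, hkj⟩
    · simp [Finsupp.single_eq_of_ne hij]
    · simp [Finsupp.single_eq_of_ne hkj, hB.coord_apply j hk,
        Finsupp.single_eq_of_ne (show k ≠ i from fun h => hk (h ▸ hi))]
  · rw [map_smul, map_add, map_sub, h2]
    simp [smul_smul, hne]
  · simp [hB.coord_apply j hj, Finsupp.single_eq_of_ne hij.symm]
  · intro k hk hki
    simp [Finsupp.single_eq_of_ne hki, Finsupp.single_eq_of_ne
      (show k ≠ j from fun h => hj (h ▸ hk))]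
    field_simp

theorem IsVectorBase.exists_coord_exch_of_ne (l : E) : ∃ f : E →₀ K,
    (∀ k ∉ exch B i j, f k = 0) ∧
    Finsupp.linearCombination K φ f = φ l ∧
    f j = coord (K := K) φ B l i / coord (K := K) φ B j i ∧
    ∀ k ∈ B, k ≠ i → f k = coord (K := K) φ B l k -
      coord (K := K) φ B j k * coord (K := K) φ B l i / coord (K := K) φ B j i := by
  classical
  have hij : i ≠ j := fun h => hj (h ▸ hi)
  obtain ⟨f, hf, hφ, hfj, hfk⟩ := hB.exists_coord_exch hi hj hne
  obtain ⟨h1, h2⟩ := hB.coord_spec l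
  refine ⟨coord φ B l + coord (K := K) φ B l i • f - Finsupp.single i (coord (K := K) φ B l i),
    ?_, ?_, ?_, ?_⟩
  · intro k hk
    have h0 := hf k hk
    rcases (notMem_exch_iff hi hj).1 hk with rfl | ⟨hk, hkj⟩
    · simp [h0]
    · simp [h0, hB.coord_apply l hk,
        Finsupp.single_eq_of_ne (show k ≠ i from fun h => hk (h ▸ hi))]
  · rw [map_sub, map_add, map_smul, h2, hφ]
    simp
  · simp [hB.coord_apply l hj, Finsupp.single_eq_of_ne hij.symm, hfj, div_eq_mul_inv]
  · intro k hk hki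
    simp [Finsupp.single_eq_of_ne hki, hfk k hk hki]
    ring

theorem IsVectorBase.exch : IsVectorBase K φ (exch B i j) := by
  refine ⟨hB.linearIndepOn_exch hi hj hne, fun l => ?_⟩
  obtain ⟨f, hf, hφ, -⟩ := hB.exists_coord_exch_of_ne hi hj hne l
  exact (Finsupp.mem_span_image_iff_linearCombination K).2
    ⟨f, (Finsupp.mem_supported' K f).2 hf, hφ⟩

end pivot

/-- The pivot system of a family of vectors: bases at finite distance from `B₀`. -/
noncomputable def ofVectors (K : Type*) [Field K] [Module K V] (φ : E → V) (B₀ : Set E) :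
    PivotSystem K E where
  IsBase B := IsVectorBase K φ B ∧ (B \ B₀).Finite ∧ (B₀ \ B).Finite
  a B i j := coord φ B j i
  isBase_exch {B i j} hB hi hj hne := by
    refine ⟨hB.1.exch hi hj hne, (hB.2.1.insert j).subset ?_, (hB.2.2.insert i).subset ?_⟩
    · rintro k ⟨hk, hk'⟩
      rcases mem_exch.1 hk with rfl | ⟨h, -⟩
      · exact mem_insert _ _
      · exact mem_insert_of_mem _ ⟨h, hk'⟩
    · rintro k ⟨hk, hk'⟩
      rcases (notMem_exch_iff hi hj).1 hk' with rfl | ⟨h, -⟩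
      · exact mem_insert _ _
      · exact mem_insert_of_mem _ ⟨hk, h⟩
  a_self {B i j} hB hi hj hne := by
    obtain ⟨f, hf, hφ, hfj, -⟩ := hB.1.exists_coord_exch hi hj hne
    rw [(hB.1.exch hi hj hne).coord_eq hf hφ, hfj]
  a_row {B i j l} hB hi hj hne hl hlj := by
    obtain ⟨f, hf, hφ, hfj, -⟩ := hB.1.exists_coord_exch_of_ne hi hj hne l
    rw [(hB.1.exch hi hj hne).coord_eq hf hφ, hfj]
  a_col {B i j k} hB hi hj hne hk hki := by
    obtain ⟨f, hf, hφ, -, hfk⟩ := hB.1.exists_coord_exch hi hj hne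
    rw [(hB.1.exch hi hj hne).coord_eq hf hφ, hfk k hk hki]
  a_other {B i j k l} hB hi hj hne hk hki hl hlj := by
    obtain ⟨f, hf, hφ, -, hfk⟩ := hB.1.exists_coord_exch_of_ne hi hj hne l
    rw [(hB.1.exch hi hj hne).coord_eq hf hφ, hfk k hk hki]
  exists_row {B B' j} hB hB' hj hj' := by
    by_contra! hcon
    have h : coord (K := K) φ B' j = coord φ B j := by
      refine hB'.1.coord_eq (fun i hi => ?_) (hB.1.coord_spec j).2
      by_cases hiB : i ∈ B
      · exact hcon i hiB hi
      · exact hB.1.coord_apply j hiB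
    have := DFunLike.congr_fun h j
    rw [hB'.1.coord_of_mem hj, hB.1.coord_apply j hj'] at this
    simp at this
  exists_col {B B' i} hB hB' hi hi' := by
    by_contra! hcon
    have h : coord (K := K) φ B i =
        Finsupp.linearCombination K (fun j => coord φ B j) (coord φ B' i) := by
      refine hB.1.coord_eq (fun k hk => ?_) ?_
      · rw [Finsupp.linearCombination_apply, Finsupp.sum, Finsupp.finsetSum_apply]
        exact Finset.sum_eq_zero fun j _ => by simp [hB.1.coord_apply j hk]
      · rw [Finsupp.linearCombination_apply K (v := fun j => coord (K := K) φ B j), Finsupp.sum,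
          map_sum]
        simp only [map_smul, (hB.1.coord_spec _).2]
        exact (hB'.1.coord_spec i).2
    have := DFunLike.congr_fun h i
    rw [hB.1.coord_of_mem hi, Finsupp.linearCombination_apply, Finsupp.sum,
      Finsupp.finsetSum_apply, Finset.sum_eq_zero] at this
    · simp at this
    · intro j _
      by_cases hjB' : j ∈ B'
      · by_cases hjB : j ∈ B
        · have : i ≠ j := fun h => hi' (h ▸ hjB')
          simp [hB.1.coord_of_mem hjB, Finsupp.single_eq_of_ne this]
        · simp [hcon j hjB' hjB]
      · simp [hB'.1.coord_apply i hjB']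
  finite_diff {B B'} hB hB' := by
    refine (hB.2.1.union hB'.2.2).subset fun k hk => ?_
    by_cases h : k ∈ B₀
    · exact Or.inr ⟨h, hk.2⟩
    · exact Or.inl ⟨hk.1, h⟩

end ofVectors

/-- Every column-finite matrix is the fundamental matrix of a family of vectors. -/
theorem exists_ofVectors {K E : Type*} [Field K] (B₀ : Set E) (A : E → E → K)
    (hA : ∀ j ∉ B₀, {i | i ∈ B₀ ∧ A i j ≠ 0}.Finite) :
    ∃ φ : E → (E →₀ K), (ofVectors K φ B₀).IsBase B₀ ∧
      ∀ i ∈ B₀, ∀ j ∉ B₀, (ofVectors K φ B₀).a B₀ i j = A i j := by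
  classical
  have : ∀ j, ∃ f : E →₀ K, (∀ i ∉ B₀, f i = 0) ∧ (j ∈ B₀ → f = Finsupp.single j 1) ∧
      (j ∉ B₀ → ∀ i ∈ B₀, f i = A i j) := by
    intro j
    by_cases hj : j ∈ B₀
    · exact ⟨Finsupp.single j 1, fun i hi => Finsupp.single_eq_of_ne (fun h => hi (h ▸ hj)),
        fun _ => rfl, fun h => absurd hj h⟩
    · refine ⟨Finsupp.ofSupportFinite (fun i => if i ∈ B₀ then A i j else 0)
        ((hA j hj).subset fun i hi => ?_), fun i hi => ?_, fun h => absurd h hj, fun _ i hi => ?_⟩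
      · rw [Function.mem_support] at hi
        by_cases h : i ∈ B₀
        · exact ⟨h, by simpa [h] using hi⟩
        · simp [h] at hi
      · simp [Finsupp.ofSupportFinite_coe, hi]
      · simp [Finsupp.ofSupportFinite_coe, hi]
  choose φ h0 h1 h2 using this
  have key : ∀ f : E →₀ K, (∀ i ∉ B₀, f i = 0) → Finsupp.linearCombination K φ f = f := by
    intro f hf
    conv_rhs => rw [← Finsupp.sum_single f]
    rw [Finsupp.linearCombination_apply]
    refine Finsupp.sum_congr fun i hi => ?_
    have hiB : i ∈ B₀ := by
      by_contra h
      exact Finsupp.mem_support_iff.1 hi (hf i h)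
    rw [h1 i hiB, Finsupp.smul_single, smul_eq_mul, mul_one]
  have hB₀ : IsVectorBase K φ B₀ := by
    refine ⟨linearIndepOn_iff.2 fun f hf hf0 => ?_, fun j => ?_⟩
    · rw [← key f ((Finsupp.mem_supported' K f).1 hf), hf0]
    · exact (Finsupp.mem_span_image_iff_linearCombination K).2
        ⟨φ j, (Finsupp.mem_supported' K _).2 (h0 j), key _ (h0 j)⟩
  refine ⟨φ, ⟨hB₀, by simp, by simp⟩, fun i hi j hj => ?_⟩
  show coord φ B₀ j i = A i j
  rw [hB₀.coord_eq (h0 j) (key _ (h0 j)), h2 j hj i hi]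

end PivotSystem

/-- The graph obtained by removing all edges at `x` and `y`. -/
def offGraph {V : Type*} (G : SimpleGraph V) (x y : V) : SimpleGraph V where
  Adj v w := G.Adj v w ∧ v ≠ x ∧ v ≠ y ∧ w ≠ x ∧ w ≠ y
  symm := ⟨fun _ _ h => ⟨h.1.symm, h.2.2.2.1, h.2.2.2.2, h.2.1, h.2.2.1⟩⟩
  loopless := ⟨fun _ h => G.loopless.irrefl _ h.1⟩

/-- Two leaves of a spanning forest do not separate the other vertices. -/
theorem IsSpanningForest.reachable_offGraph {V : Type*} {G : SimpleGraph V} {h : V → ℕ} {p : V → V}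
    (hF : IsSpanningForest G h p) {x y : V} (hx : ∀ v, h v ≠ 0 → p v ≠ x)
    (hy : ∀ v, h v ≠ 0 → p v ≠ y) {b d : V} (hbx : b ≠ x) (hby : b ≠ y) (hdx : d ≠ x) (hdy : d ≠ y)
    (hbd : G.Reachable b d) : (offGraph G x y).Reachable b d := by
  have key : ∀ n v, v ≠ x → v ≠ y → h v = n →
      ∃ r, h r = 0 ∧ (offGraph G x y).Reachable v r ∧ G.Reachable v r := by
    intro n
    induction n with
    | zero => exact fun v _ _ hv => ⟨v, hv, .refl _, .refl _⟩
    | succ n ih =>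
      intro v hvx hvy hv
      have hv0 : h v ≠ 0 := by omega
      have := hF.height_parent v hv0
      obtain ⟨r, hr, h1, h2⟩ := ih (p v) (hx v hv0) (hy v hv0) (by omega)
      have hadj : (offGraph G x y).Adj v (p v) :=
        ⟨hF.adj_parent v hv0, hvx, hvy, hx v hv0, hy v hv0⟩
      exact ⟨r, hr, hadj.reachable.trans h1, hadj.1.reachable.trans h2⟩
  obtain ⟨r, hr, h1, h2⟩ := key _ b hbx hby rfl
  obtain ⟨s, hs, h3, h4⟩ := key _ d hdx hdy rfl
  rw [hF.root_unique r s (h2.symm.trans (hbd.trans h4)) hr hs] at h1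
  exact h1.trans h3.symm

/-- Below every child of the root there is a leaf. -/
theorem IsSpanningForest.exists_leaf {V : Type*} {G : SimpleGraph V} {h : V → ℕ} {p : V → V}
    (hF : IsSpanningForest G h p) {r n : V} (hr : h r = 0) (hn : G.Adj r n) {S : Finset V}
    (hS : ∀ v w, G.Adj v w → v ∈ S) :
    ∃ v, h v ≠ 0 ∧ p^[h v - 1] v = n ∧ ∀ w, h w ≠ 0 → p w ≠ v := by
  classical
  have hn1 : h n = 1 := by
    have h1 := hF.height_le r n hn
    have h2 : h n ≠ 0 := fun h0 => hn.ne (hF.root_unique r n hn.reachable hr h0)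
    omega
  obtain ⟨v, hv, hmax⟩ := (S.filter fun v => h v ≠ 0 ∧ p^[h v - 1] v = n).exists_max_image h
    ⟨n, Finset.mem_filter.2 ⟨hS n r hn.symm, by simp [hn1], by simp [hn1]⟩⟩
  rw [Finset.mem_filter] at hv
  refine ⟨v, hv.2.1, hv.2.2, fun w hw hwv => ?_⟩
  have h1 := hF.height_parent w hw
  rw [hwv] at h1
  have h2 := hmax w (Finset.mem_filter.2 ⟨hS w _ (hF.adj_parent w hw), hw, ?_⟩)
  · omega
  · have : h w - 1 = (h v - 1) + 1 := by have := hv.2.1; omega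
    rw [this, Function.iterate_succ_apply, hwv, hv.2.2]

theorem exists_rowWalk {E : Type*} {F : E → E → Prop} {B : Set E} {H : SimpleGraph E}
    (hH : ∀ v w, H.Adj v w → (v ∈ B ∧ w ∉ B ∧ F v w) ∨ (w ∈ B ∧ v ∉ B ∧ F w v)) {b d : E}
    (hb : b ∈ B) (hd : d ∈ B) (h : H.Reachable b d) : ∃ n, RowWalk F n b d := by
  obtain ⟨q⟩ := h
  have key : ∀ v w, H.Walk v w → w ∈ B → (v ∈ B → ∃ n, RowWalk F n v w) ∧
      (v ∉ B → ∀ i, F i v → ∃ n, RowWalk F n i w) := by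
    intro v w q
    induction q with
    | nil => exact fun h => ⟨fun _ => ⟨0, .nil _⟩, fun h' => absurd h h'⟩
    | cons h q ih =>
      intro hw
      obtain ⟨ih1, ih2⟩ := ih hw
      rcases hH _ _ h with h | h
      · exact ⟨fun _ => ih2 h.2.1 _ h.2.2, fun h' => absurd h.1 h'⟩
      · refine ⟨fun h' => absurd h' h.2.1, fun _ i hi => ?_⟩
        obtain ⟨n, h1⟩ := ih1 h.1
        exact ⟨n + 1, .cons hi h.2.2 h1⟩
  exact (key b d q hd).1 hb

/-- Three rows joined by walks give a row that shares columns with two others. -/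
theorem RowWalk.exists_fork {E : Type*} {F : E → E → Prop} {n m : ℕ} {x y z : E}
    (hxy : x ≠ y) (hxz : x ≠ z) (hyz : y ≠ z) (hy : RowWalk F n x y) (hz : RowWalk F m x z) :
    ∃ r r₁ r₂ c₁ c₂, r ≠ r₁ ∧ r ≠ r₂ ∧ r₁ ≠ r₂ ∧ F r c₁ ∧ F r₁ c₁ ∧ F r c₂ ∧ F r₂ c₂ := by
  by_contra hcon
  obtain ⟨x', c, hx', h1, h2⟩ : ∃ x' c, x ≠ x' ∧ F x c ∧ F x' c := by
    clear hz hcon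
    induction hy with
    | nil => exact absurd rfl hxy
    | @cons n i c i' k a b h ih =>
      by_cases hi : i = i'
      · exact hi ▸ ih (hi ▸ hxy) (hi ▸ hxz) hyz
      · exact ⟨i', c, hi, a, b⟩
  have key : ∀ {n v w}, RowWalk F n v w → (v = x ∨ v = x') → (w = x ∨ w = x') := by
    intro n v w h
    induction h with
    | nil => exact id
    | @cons n i c' i' k a b _ ih =>
      intro hi
      refine ih ?_
      by_contra hi'
      rw [not_or] at hi'
      rcases hi with rfl | rfl
      · exact hcon ⟨i, x', i', c, c', hx', Ne.symm hi'.1, Ne.symm hi'.2, h1, h2, a, b⟩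
      · exact hcon ⟨i, x, i', c, c', hx'.symm, Ne.symm hi'.2, Ne.symm hi'.1, h2, h1, a, b⟩
  have h3 := (key hy (Or.inl rfl)).resolve_left hxy.symm
  have h4 := (key hz (Or.inl rfl)).resolve_left hxz.symm
  exact hyz (h3.trans h4.symm)

namespace PivotSystem

variable {K L E : Type*} [Field K] [Field L] {u : K → L} {σ : PivotSystem K E}
  {τ τ' : PivotSystem L E} {σ' : PivotSystem L E} {B B' B₀ : Set E} {x y : E}

theorem WLUM.del (hW : σ.WLUM) (x : E) : (σ.del x).WLUM := by
  intro B hB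
  have key : ∀ i j, (σ.del x).a B i j ≠ 0 → (σ.del x).a B i j = σ.a B i j := by
    intro i j h
    refine del_a fun hj => h ?_
    rw [hj, del_a_self]
  constructor
  · intro i₁ h₁ i₂ h₂ i₃ h₃ j hj l hl hne
    have e : ∀ i, i = i₁ ∨ i = i₂ ∨ i = i₃ →
      (σ.del x).a B i j = σ.a B i j ∧ (σ.del x).a B i l = σ.a B i l := fun i hi =>
        ⟨key _ _ (hne i hi).1, key _ _ (hne i hi).2⟩
    have := (hW hB.1).1 i₁ h₁ i₂ h₂ i₃ h₃ j hj l hl (fun i hi => by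
      rw [← (e i hi).1, ← (e i hi).2]; exact hne i hi)
    simpa [e] using this
  · intro i hi k hk j₁ h₁ j₂ h₂ j₃ h₃ hne
    have e : ∀ j, j = j₁ ∨ j = j₂ ∨ j = j₃ →
      (σ.del x).a B i j = σ.a B i j ∧ (σ.del x).a B k j = σ.a B k j := fun j hj =>
        ⟨key _ _ (hne j hj).1, key _ _ (hne j hj).2⟩
    have := (hW hB.1).2 i hi k hk j₁ h₁ j₂ h₂ j₃ h₃ (fun i hi => by
      rw [← (e i hi).1, ← (e i hi).2]; exact hne i hi)
    simpa [e] using this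

theorem WLUM.dual (hW : σ.WLUM) : σ.dual.WLUM := by
  intro B hB
  have e : ∀ i j, σ.dual.a B i j = -σ.a Bᶜ j i := fun _ _ => rfl
  simp only [e, ne_eq, neg_eq_zero, neg_mul_neg]
  obtain ⟨h1, h2⟩ := hW (B := Bᶜ) hB
  constructor
  · intro i₁ h₁ i₂ h₂ i₃ h₃ j hj l hl hne
    have := h2 j hj l hl i₁ (by simpa) i₂ (by simpa) i₃ (by simpa) hne
    exact this.imp (fun h => by linear_combination h)
      (Or.imp (fun h => by linear_combination h) (fun h => by linear_combination h))
  · intro i hi k hk j₁ h₁ j₂ h₂ j₃ h₃ hne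
    have := h1 j₁ h₁ j₂ h₂ j₃ h₃ i (by simpa) k (by simpa) hne
    exact this.imp (fun h => by linear_combination h)
      (Or.imp (fun h => by linear_combination h) (fun h => by linear_combination h))

theorem Lift.of_dual (h : Lift u σ.dual τ) : Lift u σ τ.dual := by
  intro B hB
  have hB' : σ.dual.IsBase Bᶜ := by
    show σ.IsBase Bᶜᶜ
    rwa [compl_compl]
  have e : ∀ i j, σ.a B i j = -σ.dual.a Bᶜ j i := fun i j => by
    show σ.a B i j = - -σ.a Bᶜᶜ i j
    rw [neg_neg, compl_compl]
  refine ⟨(h hB').1, fun i hi j hj _ => ?_, fun i hi k hk j hj l hl _ _ => ?_⟩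
  · show σ.a B i j = 0 ↔ -τ.a Bᶜ j i = 0
    rw [e, neg_eq_zero, neg_eq_zero]
    exact h.a_eq_zero_iff hB' hj (by simpa)
  · have := h.crossAgree hB' hj hl (k := l) (j := i) (l := k) (by simpa) (by simpa)
    rw [CrossAgree, ← crossRatio_transpose, ← crossRatio_transpose (τ.a Bᶜ)] at this
    have e1 : crossRatio (σ.a B) i k j l = crossRatio (fun a b => σ.dual.a Bᶜ b a) i k j l := by
      simp only [crossRatio, e, neg_mul_neg]
    have e2 : crossRatio (τ.dual.a B) i k j l = crossRatio (fun a b => τ.a Bᶜ b a) i k j l := by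
      simp only [crossRatio, PivotSystem.dual, neg_mul_neg]
    rw [CrossAgree, e1, e2, this]

theorem graph_dual : σ.dual.graph Bᶜ = σ.graph B := by
  ext v w
  simp only [graph, PivotSystem.dual, mem_compl_iff, not_not, compl_compl, neg_ne_zero]
  tauto

theorem offGraph_le_del_graph :
    offGraph (σ.graph B) x y ≤ ((σ.del x).del y).graph B := by
  rintro v w ⟨h | h, h1, h2, h3, h4⟩
  · exact Or.inl ⟨h.1, h.2.1, by rw [del_a h4, del_a h3]; exact h.2.2⟩
  · exact Or.inr ⟨h.1, h.2.1, by rw [del_a h2, del_a h1]; exact h.2.2⟩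

theorem Lift.del (hu : IsCrossMap u) (h : Lift u σ τ) (x : E) : Lift u (σ.del x) (τ.del x) := by
  rintro B ⟨hB, hx⟩
  refine ⟨⟨(h hB).1, hx⟩, fun i hi j hj _ => ?_, fun i hi k hk j hj l hl _ _ => ?_⟩
  · by_cases hjx : j = x
    · subst hjx; simp [del_a_self]
    · rw [del_a hjx, del_a hjx, h.a_eq_zero_iff hB hi hj]
  · by_cases hjx : j = x
    · subst hjx
      exact crossAgree_of_eq_zero hu (by simp [del_a_self]) (by simp [del_a_self])
    by_cases hlx : l = x
    · subst hlx
      exact crossAgree_of_eq_zero hu (by simp [del_a_self]) (by simp [del_a_self])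
    simpa only [CrossAgree, crossRatio, del_a hjx, del_a hlx] using h.crossAgree hB hi hk hj hl

theorem del_graph_le : (σ.del x).graph B ≤ σ.graph B := by
  have key : ∀ i j, (σ.del x).a B i j ≠ 0 → σ.a B i j ≠ 0 := by
    intro i j h
    rwa [del_a (fun hj => h (by rw [hj, del_a_self]))] at h
  rintro v w (h | h)
  · exact Or.inl ⟨h.1, h.2.1, key _ _ h.2.2⟩
  · exact Or.inr ⟨h.1, h.2.1, key _ _ h.2.2⟩

theorem IsNormalized.del {h : E → ℕ} {p : E → E} (hN : τ.IsNormalized B h p)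
    (hF : ∀ v, h v ≠ 0 → ((σ.del x).graph B).Adj v (p v)) : (τ.del x).IsNormalized B h p := by
  have key : ∀ i j, (σ.del x).a B i j ≠ 0 → j ≠ x := fun i j h hj => h (by rw [hj, del_a_self])
  intro v hv
  obtain ⟨h1, h2⟩ := hN v hv
  rcases hF v hv with h | h
  · exact ⟨fun hvB => by rw [del_a (key _ _ h.2.2), h1 hvB], fun h' => absurd h.1 h'⟩
  · exact ⟨fun h' => absurd h' h.2.1, fun hvB => by rw [del_a (key _ _ h.2.2), h2 hvB]⟩

theorem del_comm : (σ.del x).del y = (σ.del y).del x := by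
  simp only [PivotSystem.del, PivotSystem.mk.injEq]
  constructor
  · funext B; simp only [eq_iff_iff]; tauto
  · funext B i j
    by_cases h : j = x <;> by_cases h' : j = y <;> simp [h, h']

theorem goodOff_of_agree (h : Lift u (σ.del x) τ) (hB₀ : σ.IsBase B₀) (hx : x ∉ B₀)
    (hB₀' : σ'.IsBase B₀) (he : ∀ i ∈ B₀, ∀ j ∉ B₀, j ≠ x → σ'.a B₀ i j = τ.a B₀ i j)
    (hB : σ.IsBase B) (hxB : x ∉ B) : σ'.IsBase B ∧ GoodOff u σ σ' {x} B := by
  have h0 : (σ.del x).IsBase B₀ := ⟨hB₀, hx⟩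
  have hd : (σ.del x).IsBase B := ⟨hB, hxB⟩
  obtain ⟨h1, h2⟩ := agree_of_agree τ (σ'.del x) (h h0).1 ⟨hB₀', hx⟩ (fun i hi j hj => by
    by_cases hjx : j = x
    · subst hjx
      rw [del_a_self, ← h.a_eq_zero_iff h0 hi hj, del_a_self]
    · rw [del_a hjx, he i hi j hj hjx]) (h hd).1
  have e : ∀ i ∈ B, ∀ j ∉ B, j ≠ x → σ'.a B i j = τ.a B i j := fun i hi j hj hjx => by
    rw [h2 i hi j hj, del_a hjx]
  refine ⟨h1.1, fun i hi j hj hjx => ?_, fun i hi k hk j hj l hl hjx hlx => ?_⟩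
  · have := h.a_eq_zero_iff hd hi hj
    rwa [del_a hjx, ← e i hi j hj hjx] at this
  · have := h.crossAgree hd hi hk hj hl
    simpa only [CrossAgree, crossRatio, del_a (show j ≠ x from hjx), del_a (show l ≠ x from hlx),
      e _ hi _ hj hjx, e _ hi _ hl hlx, e _ hk _ hj hjx, e _ hk _ hl hlx] using this

end PivotSystem

namespace PivotSystem

variable {K L E : Type*} [Field K] [Field L] {u : K → L} {σ : PivotSystem K E}
  {B B' B₀ : Set E} {x y : E}

/-- Lifts of two single element deletions combine to a lift, provided that deleting both elements
does not split their component. -/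
theorem exists_lift_of_del (hu : IsCrossMap u) (hW : σ.WLUM) (hxy : x ≠ y) (hB₀ : σ.IsBase B₀)
    (hx₀ : x ∉ B₀) (hy₀ : y ∉ B₀) (hfin : ∀ j ∉ B₀, {i | i ∈ B₀ ∧ σ.a B₀ i j ≠ 0}.Finite)
    {τx τy : PivotSystem L E} (hτx : Lift u (σ.del x) τx) (hτy : Lift u (σ.del y) τy)
    (hsep : ∀ b d, b ≠ x → b ≠ y → d ≠ x → d ≠ y → (σ.graph B₀).Reachable b x →
      (σ.graph B₀).Reachable b y → (σ.graph B₀).Reachable d x →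
      (((σ.del x).del y).graph B₀).Reachable b d) :
    ∃ σ' : PivotSystem L E, Lift u σ σ' := by
  classical
  obtain ⟨h, p, hF, -⟩ := exists_isSpanningForest (((σ.del x).del y).graph B₀) x
  have hBx : (σ.del x).IsBase B₀ := ⟨hB₀, hx₀⟩
  have hBy : (σ.del y).IsBase B₀ := ⟨hB₀, hy₀⟩
  obtain ⟨t, ht, hNx⟩ := hτx.exists_isNormalized hBx del_graph_le hF
  obtain ⟨s, hs, hNy⟩ := hτy.exists_isNormalized (G := ((σ.del x).del y).graph B₀) hBy
    (by rw [del_comm]; exact del_graph_le) hF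
  replace hτx := hτx.scale t ht
  replace hτy := hτy.scale s hs
  generalize τx.scale t ht = τx at hτx hNx
  generalize τy.scale s hs = τy at hτy hNy
  have hag : ∀ i ∈ B₀, ∀ j ∉ B₀, j ≠ x → j ≠ y → τx.a B₀ i j = τy.a B₀ i j := by
    intro i hi j hj hjx hjy
    have h1 := hτx.del hu y
    have h2 := hτy.del hu x
    rw [← del_comm] at h2
    have := h1.agree_of_isNormalized h2 ⟨hBx, hy₀⟩ hF (hNx.del hF.adj_parent)
      (hNy.del (σ := σ.del y) (by rw [← del_comm]; exact hF.adj_parent)) hi hj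
    rwa [del_a hjy, del_a hjx] at this
  obtain ⟨φ, hφB, hφ⟩ := exists_ofVectors B₀
    (fun i j => if j = y then τx.a B₀ i y else τy.a B₀ i j) (by
      intro j hj
      refine (hfin j hj).subset fun i hi => ⟨hi.1, ?_⟩
      have hi2 := hi.2
      by_cases hjy : j = y
      · subst hjy
        rwa [if_pos rfl, ne_eq, ← hτx.a_eq_zero_iff hBx hi.1 hj, del_a hxy.symm] at hi2
      · rwa [if_neg hjy, ne_eq, ← hτy.a_eq_zero_iff hBy hi.1 hj, del_a hjy] at hi2)
  generalize ofVectors L φ B₀ = σ' at hφB hφ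
  have hX : ∀ B, σ.IsBase B → x ∉ B → σ'.IsBase B ∧ GoodOff u σ σ' {x} B := fun B =>
    goodOff_of_agree hτx hB₀ hx₀ hφB fun i hi j hj hjx => by
      rw [hφ i hi j hj]
      by_cases hjy : j = y
      · rw [if_pos hjy, hjy]
      · rw [if_neg hjy, hag i hi j hj hjx hjy]
  have hY : ∀ B, σ.IsBase B → y ∉ B → σ'.IsBase B ∧ GoodOff u σ σ' {y} B := fun B =>
    goodOff_of_agree hτy hB₀ hy₀ hφB fun i hi j hj hjy => by
      rw [hφ i hi j hj, if_neg hjy]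
  refine ⟨σ', lift_of_del hu hW hxy hB₀ hx₀ hy₀ hX hY fun B hB hx hy b hb d hd => ?_⟩
  have hsx : ∀ i ∈ B, (σ.a B i x = 0 ↔ σ'.a B i x = 0) := fun i hi =>
    (hY B hB hy).2.supp i hi x hx hxy
  have hsy : ∀ i ∈ B, (σ.a B i y = 0 ↔ σ'.a B i y = 0) := fun i hi =>
    (hX B hB hx).2.supp i hi y hy hxy.symm
  by_cases h0 : σ.a B b x * σ.a B d y * (σ.a B b y * σ.a B d x) = 0
  · refine crossAgree_of_eq_zero hu h0 ?_
    simpa only [mul_eq_zero, hsx b hb, hsx d hd, hsy b hb, hsy d hd] using h0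
  simp only [mul_eq_zero, not_or] at h0
  obtain ⟨⟨hbx, hdy⟩, hby, hdx⟩ := h0
  have tr : ∀ {i j}, i ∈ B → j ∉ B → σ.a B i j ≠ 0 → (σ.graph B₀).Reachable i j :=
    fun hi hj h => reachable_of_reachable hB hB₀ (graph_adj hi hj h).reachable
  have hD := reachable_of_reachable (σ := (σ.del x).del y) ⟨hBx, hy₀⟩ (B' := B) ⟨⟨hB, hx⟩, hy⟩
    (hsep b d (fun h => hx (h ▸ hb)) (fun h => hy (h ▸ hb)) (fun h => hx (h ▸ hd))
      (fun h => hy (h ▸ hd)) (tr hb hx hbx) (tr hb hy hby) (tr hd hx hdx))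
  have key : ∀ i j, ((σ.del x).del y).a B i j ≠ 0 → j ≠ x ∧ j ≠ y ∧ σ.a B i j ≠ 0 := by
    intro i j h
    have hjy : j ≠ y := fun hj => h (by rw [hj, del_a_self])
    rw [del_a hjy] at h
    have hjx : j ≠ x := fun hj => h (by rw [hj, del_a_self])
    rw [del_a hjx] at h
    exact ⟨hjx, hjy, h⟩
  obtain ⟨n, hn⟩ := exists_rowWalk (F := σ.EdgeOff x y B) (B := B) (fun v w hvw => by
    rcases hvw with h | h
    · obtain ⟨h1, h2, h3⟩ := key _ _ h.2.2
      exact Or.inl ⟨h.1, h.2.1, h.1, h.2.1, h1, h2, h3⟩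
    · obtain ⟨h1, h2, h3⟩ := key _ _ h.2.2
      exact Or.inr ⟨h.1, h.2.1, h.1, h.2.1, h1, h2, h3⟩) hb hd hD
  exact crossAgree_of_rowWalk hu hW hxy hX hY n B hB hx hy b hb d hd hn

end PivotSystem

theorem crossAgree_of_block {K L E : Type*} [Field K] [Field L] {u : K → L} (hu : IsCrossMap u)
    {A : E → E → K} {A' : E → E → L} {B : Set E} {r₁ r₂ c₁ c₂ : E}
    (hs : ∀ i ∈ B, ∀ j ∉ B, (A i j = 0 ↔ A' i j = 0))
    (hb : ∀ i ∈ B, ∀ j ∉ B, A i j ≠ 0 → (i = r₁ ∨ i = r₂) ∧ (j = c₁ ∨ j = c₂))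
    (h : r₁ ≠ r₂ → c₁ ≠ c₂ → A r₁ c₁ ≠ 0 → A r₂ c₂ ≠ 0 → A r₁ c₂ ≠ 0 → A r₂ c₁ ≠ 0 →
      r₁ ∈ B → r₂ ∈ B → c₁ ∉ B → c₂ ∉ B → CrossAgree u A A' r₁ r₂ c₁ c₂)
    {i k j l : E} (hi : i ∈ B) (hk : k ∈ B) (hj : j ∉ B) (hl : l ∉ B) :
    CrossAgree u A A' i k j l := by
  by_cases h0 : A i j * A k l * (A i l * A k j) = 0
  · refine crossAgree_of_eq_zero hu h0 ?_
    simpa only [mul_eq_zero, ← hs i hi j hj, ← hs k hk l hl, ← hs i hi l hl, ← hs k hk j hj]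
      using h0
  by_cases hik : i = k
  · subst hik; exact crossAgree_self_row hu (hs i hi j hj) (hs i hi l hl)
  by_cases hjl : j = l
  · subst hjl; exact crossAgree_self_col hu (hs i hi j hj) (hs k hk j hj)
  simp only [mul_eq_zero, not_or] at h0
  obtain ⟨⟨n1, n2⟩, n3, n4⟩ := h0
  obtain ⟨hi', hj'⟩ := hb i hi j hj n1
  obtain ⟨hk', hl'⟩ := hb k hk l hl n2
  rcases hi' with rfl | rfl <;> rcases hk' with rfl | rfl <;>
    first | exact absurd rfl hik | rcases hj' with rfl | rfl <;> rcases hl' with rfl | rfl <;>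
    first | exact absurd rfl hjl | skip
  · exact h hik hjl n1 n2 n3 n4 hi hk hj hl
  · exact (h hik (Ne.symm hjl) n3 n4 n1 n2 hi hk hl hj).swap_col hu
  · exact (h (Ne.symm hik) hjl n4 n3 n2 n1 hk hi hj hl).swap_row hu
  · exact ((h (Ne.symm hik) (Ne.symm hjl) n2 n1 n4 n3 hk hi hl hj).swap_row hu).swap_col hu

namespace PivotSystem

variable {K L E : Type*} [Field K] [Field L] {u : K → L} {σ : PivotSystem K E}
  {σ' : PivotSystem L E} {B B' B₀ : Set E} {x y : E} {n : ℕ} {S : Finset E}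

theorem exists_isBase_goodOff (B₀ : Set E) (A : E → E → L)
    (hfin : ∀ j ∉ B₀, {i | i ∈ B₀ ∧ σ.a B₀ i j ≠ 0}.Finite)
    (hs : ∀ i ∈ B₀, ∀ j ∉ B₀, (σ.a B₀ i j = 0 ↔ A i j = 0))
    (hc : ∀ i ∈ B₀, ∀ k ∈ B₀, ∀ j ∉ B₀, ∀ l ∉ B₀, CrossAgree u (σ.a B₀) A i k j l) :
    ∃ σ' : PivotSystem L E, σ'.IsBase B₀ ∧ GoodOff u σ σ' ∅ B₀ := by
  obtain ⟨φ, hB, hφ⟩ := exists_ofVectors B₀ A (fun j hj => (hfin j hj).subset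
    fun i hi => ⟨hi.1, (hs i hi.1 j hj).not.2 hi.2⟩)
  refine ⟨_, hB, fun i hi j hj _ => by rw [hφ i hi j hj, hs i hi j hj],
    fun i hi k hk j hj l hl _ _ => ?_⟩
  have := hc i hi k hk j hj l hl
  simpa only [CrossAgree, crossRatio, hφ _ hi _ hj, hφ _ hi _ hl, hφ _ hk _ hj, hφ _ hk _ hl]
    using this

/-- The fundamental matrix at `B` has at most two nonzero rows and at most two nonzero columns. -/
def IsBlock (σ : PivotSystem K E) (B : Set E) : Prop :=
  ∀ i ∈ B, ∀ j ∉ B, σ.a B i j ≠ 0 → ∃ r c, ∀ k ∈ B, ∀ l ∉ B, σ.a B k l ≠ 0 →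
    (k = i ∨ k = r) ∧ (l = j ∨ l = c)

theorem exch_block (hB : σ.IsBase B) {i j r c : E} (hi : i ∈ B) (hj : j ∉ B)
    (hne : σ.a B i j ≠ 0) (hb : ∀ k ∈ B, ∀ l ∉ B, σ.a B k l ≠ 0 →
      (k = i ∨ k = r) ∧ (l = j ∨ l = c)) {k l : E} (hk : k ∈ exch B i j) (hl : l ∉ exch B i j)
    (h : σ.a (exch B i j) k l ≠ 0) : (k = j ∨ k = r) ∧ (l = i ∨ l = c) := by
  rw [notMem_exch_iff hi hj] at hl
  rw [mem_exch] at hk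
  rcases hk with rfl | ⟨hk, hki⟩ <;> rcases hl with rfl | ⟨hl, hlj⟩
  · exact ⟨Or.inl rfl, Or.inl rfl⟩
  · rw [σ.a_row hB hi hj hne hl hlj] at h
    have := hb i hi l hl fun h0 => h (by rw [h0, zero_div])
    tauto
  · rw [σ.a_col hB hi hj hne hk hki] at h
    have := hb k hk j hj fun h0 => h (by rw [h0, neg_zero, zero_div])
    tauto
  · rw [σ.a_other hB hi hj hne hk hki hl hlj] at h
    by_cases h1 : σ.a B k l = 0
    · have h2 : σ.a B k j ≠ 0 := fun h0 => h (by rw [h1, h0]; simp)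
      have h3 : σ.a B i l ≠ 0 := fun h0 => h (by rw [h1, h0]; simp)
      have := hb k hk j hj h2
      have := hb i hi l hl h3
      tauto
    · have := hb k hk l hl h1
      tauto

theorem lift_of_isBlock (hu : IsCrossMap u) (hB₀ : σ.IsBase B₀) (hB₀' : σ'.IsBase B₀)
    (hb : σ.IsBlock B₀) (hG : GoodOff u σ σ' ∅ B₀) : Lift u σ σ' := by
  intro B hB
  refine (σ.base_induction hB₀ (fun B => (σ'.IsBase B ∧ GoodOff u σ σ' ∅ B) ∧ σ.IsBlock B)
    ⟨⟨hB₀', hG⟩, hb⟩ ?_ hB).1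
  rintro B i j hB ⟨⟨hB', hG⟩, hb⟩ hi hj hne
  obtain ⟨r, c, hrc⟩ := hb i hi j hj hne
  have hne' : σ'.a B i j ≠ 0 := (hG.supp i hi j hj (notMem_empty _)).not.1 hne
  have hs : ∀ k ∈ exch B i j, ∀ l ∉ exch B i j,
      (σ.a (exch B i j) k l = 0 ↔ σ'.a (exch B i j) k l = 0) := fun k hk l hl =>
    hG.supp_exch hu hB hB' hi hj (notMem_empty _) hne hk hl (notMem_empty _)
  have hbl := fun k (hk : k ∈ exch B i j) l (hl : l ∉ exch B i j) =>
    exch_block hB hi hj hne hrc hk hl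
  have hij : i ≠ j := fun h => hj (h ▸ hi)
  refine ⟨⟨σ'.isBase_exch hB' hi hj hne', fun k hk l hl _ => hs k hk l hl,
    fun k hk k' hk' l hl l' hl' _ _ => crossAgree_of_block hu hs hbl ?_ hk hk' hl hl'⟩, ?_⟩
  · intro hjr hic _ _ _ _ _ hr _ hc
    have hr' := (mem_exch.1 hr).resolve_left (Ne.symm hjr)
    have hc' := ((notMem_exch_iff hi hj).1 hc).resolve_left (Ne.symm hic)
    rw [crossAgree_pivot_iff hu hB hB' hi hj hne hne' hr'.1 hr'.2 hc'.1 hc'.2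
      (hG.supp i hi c hc'.1 (notMem_empty _)) (hG.supp r hr'.1 j hj (notMem_empty _))]
    exact hG.cross i hi r hr'.1 j hj c hc'.1 (notMem_empty _) (notMem_empty _)
  · intro i' hi' j' hj' hne2
    obtain ⟨h1, h2⟩ := hbl i' hi' j' hj' hne2
    rcases h1 with rfl | rfl <;> rcases h2 with rfl | rfl
    · exact ⟨r, c, hbl⟩
    · exact ⟨r, i, fun k hk l hl h => ⟨(hbl k hk l hl h).1, (hbl k hk l hl h).2.symm⟩⟩
    · exact ⟨j, c, fun k hk l hl h => ⟨(hbl k hk l hl h).1.symm, (hbl k hk l hl h).2⟩⟩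
    · exact ⟨j, i, fun k hk l hl h => ⟨(hbl k hk l hl h).1.symm, (hbl k hk l hl h).2.symm⟩⟩

theorem exists_lift_of_isBlock (hu : IsCrossMap u) (hB₀ : σ.IsBase B₀) (hb : σ.IsBlock B₀) :
    ∃ σ' : PivotSystem L E, Lift u σ σ' := by
  classical
  suffices ∃ A : E → E → L, (∀ i ∈ B₀, ∀ j ∉ B₀, (σ.a B₀ i j = 0 ↔ A i j = 0)) ∧
      ∀ i ∈ B₀, ∀ k ∈ B₀, ∀ j ∉ B₀, ∀ l ∉ B₀, CrossAgree u (σ.a B₀) A i k j l by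
    obtain ⟨A, hs, hc⟩ := this
    obtain ⟨σ', h1, h2⟩ := exists_isBase_goodOff B₀ A (fun j hj => by
      by_cases h : ∃ i ∈ B₀, σ.a B₀ i j ≠ 0
      · obtain ⟨i, hi, hne⟩ := h
        obtain ⟨r, c, hrc⟩ := hb i hi j hj hne
        exact (toFinite {i, r}).subset fun k hk => (hrc k hk.1 j hj hk.2).1
      · push Not at h
        convert finite_empty
        ext i
        simpa using h i) hs hc
    exact ⟨σ', lift_of_isBlock hu hB₀ h1 hb h2⟩
  by_cases h : ∃ i ∈ B₀, ∃ j ∉ B₀, σ.a B₀ i j ≠ 0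
  · obtain ⟨i, hi, j, hj, hne⟩ := h
    obtain ⟨r, c, hrc⟩ := hb i hi j hj hne
    let A : E → E → L := fun k l => if σ.a B₀ k l = 0 then 0 else
      if (k = i ∧ l = j) ∧ crossRatio (σ.a B₀) i r j c ≠ 0 then u (crossRatio (σ.a B₀) i r j c)
      else 1
    have hs : ∀ k ∈ B₀, ∀ l ∉ B₀, (σ.a B₀ k l = 0 ↔ A k l = 0) := by
      intro k _ l _
      simp only [A]
      split_ifs with h1 h2
      · simp [h1]
      · simp [h1, hu.eq_zero_iff, h2.2]
      · simp [h1]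
    refine ⟨A, hs, fun i' hi' k hk j' hj' l hl => crossAgree_of_block hu hs hrc ?_ hi' hk hj' hl⟩
    intro hir hjc n1 n2 n3 n4 _ _ _ _
    have h0 : crossRatio (σ.a B₀) i r j c ≠ 0 := by simp [crossRatio, n1, n2, n3, n4]
    have e1 : A i j = u (crossRatio (σ.a B₀) i r j c) := by simp only [A]; simp [n1, h0]
    have e2 : A r c = 1 := by simp only [A]; simp [n2, hir.symm]
    have e3 : A i c = 1 := by simp only [A]; simp [n3, hjc.symm]
    have e4 : A r j = 1 := by simp only [A]; simp [n4, hir.symm]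
    rw [CrossAgree, crossRatio.eq_def A, e1, e2, e3, e4]
    simp
  · push Not at h
    have hs : ∀ k ∈ B₀, ∀ l ∉ B₀, (σ.a B₀ k l = 0 ↔ (0 : L) = 0) := fun k hk l hl =>
      iff_of_true (h k hk l hl) rfl
    exact ⟨fun _ _ => 0, hs, fun i hi k hk j hj l hl =>
      crossAgree_of_eq_zero hu (by rw [h i hi j hj]; simp) (by simp)⟩

section
variable (hu : IsCrossMap u)
  (ih : ∀ (σ : PivotSystem K E) (B : Set E) (S : Finset E), σ.WLUM → σ.IsBase B →
    (∀ v w, (σ.graph B).Adj v w → v ∈ S) → S.card < n → ∃ τ : PivotSystem L E, Lift u σ τ)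
include hu ih

theorem exists_lift_of_sep (hW : σ.WLUM) (hB : σ.IsBase B)
    (hS : ∀ v w, (σ.graph B).Adj v w → v ∈ S) (hn : S.card ≤ n) (hxy : x ≠ y) (hx : x ∉ B)
    (hy : y ∉ B) (hxS : x ∈ S) (hyS : y ∈ S)
    (hsep : ∀ b d, b ≠ x → b ≠ y → d ≠ x → d ≠ y → (σ.graph B).Reachable b x →
      (σ.graph B).Reachable b y → (σ.graph B).Reachable d x →
      (offGraph (σ.graph B) x y).Reachable b d) :
    ∃ τ : PivotSystem L E, Lift u σ τ := by
  classical
  have key : ∀ x ∈ S, x ∉ B → ∃ τ : PivotSystem L E, Lift u (σ.del x) τ := by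
    intro x hxS hx
    refine ih _ B (S.erase x) (hW.del x) ⟨hB, hx⟩ (fun v w hvw => ?_)
      ((Finset.card_erase_lt_of_mem hxS).trans_le hn)
    refine Finset.mem_erase.2 ⟨?_, hS v w (del_graph_le hvw)⟩
    rintro rfl
    rcases hvw with h | h
    · exact hx h.1
    · exact h.2.2 del_a_self
  obtain ⟨τx, hτx⟩ := key x hxS hx
  obtain ⟨τy, hτy⟩ := key y hyS hy
  refine exists_lift_of_del hu hW hxy hB hx hy (fun j hj => S.finite_toSet.subset
    fun i hi => hS i j (graph_adj hi.1 hj hi.2)) hτx hτy ?_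
  intro b d h1 h2 h3 h4 h5 h6 h7
  exact (hsep b d h1 h2 h3 h4 h5 h6 h7).mono offGraph_le_del_graph

theorem exists_lift_of_leaves (hW : σ.WLUM) (hB : σ.IsBase B)
    (hS : ∀ v w, (σ.graph B).Adj v w → v ∈ S) (hn : S.card ≤ n) {h : E → ℕ} {p : E → E}
    (hF : IsSpanningForest (σ.graph B) h p) (hxy : x ≠ y)
    (hBxy : x ∈ B ↔ y ∈ B) (hx0 : h x ≠ 0) (hy0 : h y ≠ 0) (hpx : ∀ v, h v ≠ 0 → p v ≠ x)
    (hpy : ∀ v, h v ≠ 0 → p v ≠ y) : ∃ τ : PivotSystem L E, Lift u σ τ := by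
  have hsep : ∀ b d, b ≠ x → b ≠ y → d ≠ x → d ≠ y → (σ.graph B).Reachable b x →
      (σ.graph B).Reachable b y → (σ.graph B).Reachable d x →
      (offGraph (σ.graph B) x y).Reachable b d := fun b d h1 h2 h3 h4 h5 _ h7 =>
    hF.reachable_offGraph hpx hpy h1 h2 h3 h4 (h5.trans h7.symm)
  have hxS := hS _ _ (hF.adj_parent x hx0)
  have hyS := hS _ _ (hF.adj_parent y hy0)
  by_cases hx : x ∈ B
  · have hy := hBxy.1 hx
    obtain ⟨τ, hτ⟩ := exists_lift_of_sep (σ := σ.dual) (B := Bᶜ) hu ih hW.dual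
      (show σ.IsBase Bᶜᶜ by rwa [compl_compl]) (by rwa [graph_dual]) hn hxy (by simpa) (by simpa)
      hxS hyS (by rwa [graph_dual])
    exact ⟨_, hτ.of_dual⟩
  · exact exists_lift_of_sep hu ih hW hB hS hn hxy hx (hBxy.not.1 hx) hxS hyS hsep

theorem exists_lift_of_three_neighbors (hW : σ.WLUM) (hB : σ.IsBase B)
    (hS : ∀ v w, (σ.graph B).Adj v w → v ∈ S) (hn : S.card ≤ n) {r n₁ n₂ n₃ : E}
    (h12 : n₁ ≠ n₂) (h13 : n₁ ≠ n₃) (h23 : n₂ ≠ n₃) (h1 : (σ.graph B).Adj r n₁)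
    (h2 : (σ.graph B).Adj r n₂) (h3 : (σ.graph B).Adj r n₃) :
    ∃ τ : PivotSystem L E, Lift u σ τ := by
  obtain ⟨h, p, hF, hr⟩ := exists_isSpanningForest (σ.graph B) r
  obtain ⟨v₁, a1, b1, c1⟩ := hF.exists_leaf hr h1 hS
  obtain ⟨v₂, a2, b2, c2⟩ := hF.exists_leaf hr h2 hS
  obtain ⟨v₃, a3, b3, c3⟩ := hF.exists_leaf hr h3 hS
  have d12 : v₁ ≠ v₂ := by rintro rfl; exact h12 (b1.symm.trans b2)
  have d13 : v₁ ≠ v₃ := by rintro rfl; exact h13 (b1.symm.trans b3)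
  have d23 : v₂ ≠ v₃ := by rintro rfl; exact h23 (b2.symm.trans b3)
  have : (v₁ ∈ B ↔ v₂ ∈ B) ∨ (v₁ ∈ B ↔ v₃ ∈ B) ∨ (v₂ ∈ B ↔ v₃ ∈ B) := by tauto
  rcases this with e | e | e
  · exact exists_lift_of_leaves hu ih hW hB hS hn hF d12 e a1 a2 c1 c2
  · exact exists_lift_of_leaves hu ih hW hB hS hn hF d13 e a1 a3 c1 c3
  · exact exists_lift_of_leaves hu ih hW hB hS hn hF d23 e a2 a3 c2 c3

theorem exists_lift_of_three_columns (hW : σ.WLUM) (hB : σ.IsBase B)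
    (hS : ∀ v w, (σ.graph B).Adj v w → v ∈ S) (hn : S.card ≤ n) {x₁ x₂ x₃ : E}
    (h12 : x₁ ≠ x₂) (h13 : x₁ ≠ x₃) (h23 : x₂ ≠ x₃) (h1 : x₁ ∉ B) (h2 : x₂ ∉ B) (h3 : x₃ ∉ B)
    (hS₁ : ∃ i ∈ B, σ.a B i x₁ ≠ 0) (hS₂ : ∃ i ∈ B, σ.a B i x₂ ≠ 0)
    (hS₃ : ∃ i ∈ B, σ.a B i x₃ ≠ 0) : ∃ τ : PivotSystem L E, Lift u σ τ := by
  have mem : ∀ {x}, x ∉ B → (∃ i ∈ B, σ.a B i x ≠ 0) → x ∈ S := fun hx ⟨i, hi, h⟩ =>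
    hS _ _ (graph_adj hi hx h).symm
  by_cases hr2 : (σ.graph B).Reachable x₁ x₂
  swap
  · exact exists_lift_of_sep hu ih hW hB hS hn h12 h1 h2 (mem h1 hS₁) (mem h2 hS₂)
      fun b d _ _ _ _ h5 h6 _ => absurd (h5.symm.trans h6) hr2
  by_cases hr3 : (σ.graph B).Reachable x₁ x₃
  swap
  · exact exists_lift_of_sep hu ih hW hB hS hn h13 h1 h3 (mem h1 hS₁) (mem h3 hS₃)
      fun b d _ _ _ _ h5 h6 _ => absurd (h5.symm.trans h6) hr3
  have hwalk : ∀ {w}, w ∉ B → (σ.graph B).Reachable x₁ w →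
      ∃ m, RowWalk (fun c i => i ∈ B ∧ c ∉ B ∧ σ.a B i c ≠ 0) m x₁ w := fun hw hr =>
    exists_rowWalk (B := Bᶜ) (fun v w h => by
      rcases h with h | h
      · exact Or.inr ⟨h.2.1, by simpa using h.1, h⟩
      · exact Or.inl ⟨h.2.1, by simpa using h.1, h⟩) h1 hw hr
  obtain ⟨m₂, w₂⟩ := hwalk h2 hr2
  obtain ⟨m₃, w₃⟩ := hwalk h3 hr3
  obtain ⟨c, c₁, c₂, i₁, i₂, d1, d2, d3, ⟨hi₁, hc, e1⟩, ⟨-, hc₁, e2⟩, ⟨hi₂, -, e3⟩, -, hc₂, e4⟩ :=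
    w₂.exists_fork h12 h13 h23 w₃
  by_cases hz : σ.a B i₁ c₂ = 0
  swap
  · exact exists_lift_of_three_neighbors hu ih hW hB hS hn d1 d2 d3 (graph_adj hi₁ hc e1)
      (graph_adj hi₁ hc₁ e2) (graph_adj hi₁ hc₂ hz)
  by_cases hz' : σ.a B i₂ c₁ = 0
  swap
  · exact exists_lift_of_three_neighbors hu ih hW hB hS hn d1 d2 d3 (graph_adj hi₂ hc e3)
      (graph_adj hi₂ hc₁ hz') (graph_adj hi₂ hc₂ e4)
  have hi12 : i₁ ≠ i₂ := fun h => e4 (h ▸ hz)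
  have hB' := σ.isBase_exch hB hi₂ hc e3
  have hS' : ∀ v w, (σ.graph (exch B i₂ c)).Adj v w → v ∈ S := by
    intro v w hvw
    obtain ⟨q⟩ := reachable_of_reachable hB' hB hvw.reachable
    cases q with
    | nil => exact absurd rfl hvw.ne
    | cons h _ => exact hS _ _ h
  have hm := mem_exch_of_ne (j := c) hi₁ hi12
  have hne : ∀ {c'}, c' ∉ B → i₂ ≠ c' := fun h h' => h (h' ▸ hi₂)
  refine exists_lift_of_three_neighbors hu ih hW hB' hS' hn (r := i₁) (n₁ := i₂) (n₂ := c₁)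
    (n₃ := c₂) (hne hc₁) (hne hc₂) d3 (graph_adj hm (notMem_exch_self (hne hc)) ?_)
    (graph_adj hm (notMem_exch hc₁ d1.symm) ?_) (graph_adj hm (notMem_exch hc₂ d2.symm) ?_)
  · rw [σ.a_col hB hi₂ hc e3 hi₁ hi12]
    simp [e1, e3]
  · rw [σ.a_other hB hi₂ hc e3 hi₁ hi12 hc₁ d1.symm, hz']
    simpa
  · rw [σ.a_other hB hi₂ hc e3 hi₁ hi12 hc₂ d2.symm, hz]
    simp [e1, e3, e4]

theorem exists_lift_step (hW : σ.WLUM) (hB : σ.IsBase B)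
    (hS : ∀ v w, (σ.graph B).Adj v w → v ∈ S) (hn : S.card ≤ n) :
    ∃ τ : PivotSystem L E, Lift u σ τ := by
  by_contra hcon
  refine hcon (exists_lift_of_isBlock hu hB fun i hi j hj hne => ?_)
  obtain ⟨c, hc⟩ : ∃ c, ∀ k ∈ B, ∀ l ∉ B, σ.a B k l ≠ 0 → l = j ∨ l = c := by
    by_cases h : ∃ k ∈ B, ∃ l ∉ B, σ.a B k l ≠ 0 ∧ l ≠ j
    · obtain ⟨k, hk, l, hl, hkl, hlj⟩ := h
      refine ⟨l, fun k' hk' l' hl' hne' => ?_⟩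
      by_contra! hcon'
      exact hcon (exists_lift_of_three_columns hu ih hW hB hS hn hlj.symm hcon'.1.symm
        hcon'.2.symm hj hl hl' ⟨i, hi, hne⟩ ⟨k, hk, hkl⟩ ⟨k', hk', hne'⟩)
    · push Not at h
      exact ⟨j, fun k hk l hl hne => Or.inl (h k hk l hl hne)⟩
  obtain ⟨r, hr⟩ : ∃ r, ∀ k ∈ B, ∀ l ∉ B, σ.a B k l ≠ 0 → k = i ∨ k = r := by
    by_cases h : ∃ k ∈ B, ∃ l ∉ B, σ.a B k l ≠ 0 ∧ k ≠ i
    · obtain ⟨k, hk, l, hl, hkl, hki⟩ := h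
      refine ⟨k, fun k' hk' l' hl' hne' => ?_⟩
      by_contra! hcon'
      obtain ⟨τ, hτ⟩ := exists_lift_of_three_columns (σ := σ.dual) (B := Bᶜ) hu ih hW.dual
        (show σ.IsBase Bᶜᶜ by rwa [compl_compl]) (by rwa [graph_dual]) hn hki.symm hcon'.1.symm
        hcon'.2.symm (by simpa) (by simpa) (by simpa)
        ⟨j, hj, by simpa [PivotSystem.dual]⟩ ⟨l, hl, by simpa [PivotSystem.dual]⟩
        ⟨l', hl', by simpa [PivotSystem.dual]⟩
      exact hcon ⟨_, hτ.of_dual⟩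
    · push Not at h
      exact ⟨i, fun k hk l hl hne => Or.inl (h k hk l hl hne)⟩
  exact ⟨r, c, fun k hk l hl h => ⟨hr k hk l hl h, hc k hk l hl h⟩⟩

end

theorem exists_lift_of_finite (hu : IsCrossMap u) (hW : σ.WLUM) (hB : σ.IsBase B)
    (hS : ∀ v w, (σ.graph B).Adj v w → v ∈ S) : ∃ τ : PivotSystem L E, Lift u σ τ := by
  obtain ⟨n, hn⟩ : ∃ n, S.card = n := ⟨_, rfl⟩
  induction n using Nat.strong_induction_on generalizing σ B S with
  | _ n ih =>
    exact exists_lift_step hu (fun σ B S hW hB hS hn => ih S.card hn hW hB hS rfl) hW hB hS hn.le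

end PivotSystem

/-- A parent closed set carries a subforest of the induced graph. -/
theorem IsSpanningForest.indicator {V : Type*} {G H : SimpleGraph V} {h : V → ℕ} {p : V → V}
    (hF : IsSpanningForest G h p) {S : Set V} (hS : ∀ v ∈ S, h v ≠ 0 → p v ∈ S)
    (hH : ∀ v w, H.Adj v w ↔ G.Adj v w ∧ v ∈ S ∧ w ∈ S) :
    IsSpanningForest H (S.indicator h) p where
  adj_parent v hv := by
    rw [Set.indicator_apply_ne_zero] at hv
    exact (hH _ _).2 ⟨hF.adj_parent v hv.2, hv.1, hS v hv.1 hv.2⟩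
  height_parent v hv := by
    rw [Set.indicator_apply_ne_zero] at hv
    rw [indicator_of_mem (hS v hv.1 hv.2), indicator_of_mem hv.1, hF.height_parent v hv.2]
  root_unique v w hvw hv hw := by
    obtain ⟨q⟩ := id hvw
    cases q with
    | nil => rfl
    | cons e q =>
      obtain ⟨q'⟩ := hvw.symm
      cases q' with
      | nil => rfl
      | cons e' q' =>
        rw [indicator_of_mem ((hH _ _).1 e).2.1] at hv
        rw [indicator_of_mem ((hH _ _).1 e').2.1] at hw
        exact hF.root_unique v w (hvw.mono fun _ _ h => ((hH _ _).1 h).1) hv hw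
  height_le v w hvw := by
    obtain ⟨h1, h2, h3⟩ := (hH _ _).1 hvw
    rw [indicator_of_mem h2, indicator_of_mem h3]
    exact hF.height_le v w h1

theorem IsSpanningForest.exists_closed {V : Type*} {G : SimpleGraph V} {h : V → ℕ} {p : V → V}
    (hF : IsSpanningForest G h p) {T : Set V} (hT : T.Finite) :
    ∃ S : Finset V, T ⊆ S ∧ ∀ v ∈ S, h v ≠ 0 → p v ∈ S := by
  classical
  refine ⟨hT.toFinset.biUnion fun v => (Finset.range (h v + 1)).image fun n => p^[n] v,
    fun v hv => ?_, ?_⟩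
  · simp only [Finset.coe_biUnion, Finset.coe_image, mem_iUnion]
    exact ⟨v, by simpa, 0, by simp, rfl⟩
  · have key : ∀ n v, n ≤ h v → h (p^[n] v) + n = h v := by
      intro n
      induction n with
      | zero => simp
      | succ n ih =>
        intro v hv
        have h1 := ih v (by omega)
        have h2 := hF.height_parent (p^[n] v) (by omega)
        rw [Function.iterate_succ_apply']
        omega
    intro w hw hw0
    simp only [Finset.mem_biUnion, Finset.mem_image, Finset.mem_range] at hw ⊢
    obtain ⟨v, hv, n, hn, rfl⟩ := hw
    have := key n v (by omega)
    exact ⟨v, hv, n + 1, by omega, Function.iterate_succ_apply' p n v⟩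

namespace PivotSystem

variable {K L E : Type*} [Field K] [Field L] {u : K → L} {σ : PivotSystem K E}
  {τ τ' : PivotSystem L E} {B B₀ S S' : Set E}

theorem WLUM.restr (hW : σ.WLUM) (S B₀ : Set E) : (σ.restr S B₀).WLUM := by
  intro B hB
  have key : ∀ i j, (σ.restr S B₀).a B i j ≠ 0 → (σ.restr S B₀).a B i j = σ.a B i j := by
    intro i j h
    by_cases hij : i ∈ S ∧ j ∈ S
    · exact restr_a hij.1 hij.2
    · exact absurd (restr_a_eq_zero hij) h
  constructor
  · intro i₁ h₁ i₂ h₂ i₃ h₃ j hj l hl hne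
    have e : ∀ i, i = i₁ ∨ i = i₂ ∨ i = i₃ →
      (σ.restr S B₀).a B i j = σ.a B i j ∧ (σ.restr S B₀).a B i l = σ.a B i l := fun i hi =>
        ⟨key _ _ (hne i hi).1, key _ _ (hne i hi).2⟩
    have := (hW hB.1).1 i₁ h₁ i₂ h₂ i₃ h₃ j hj l hl (fun i hi => by
      rw [← (e i hi).1, ← (e i hi).2]; exact hne i hi)
    simpa [e] using this
  · intro i hi k hk j₁ h₁ j₂ h₂ j₃ h₃ hne
    have e : ∀ j, j = j₁ ∨ j = j₂ ∨ j = j₃ →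
      (σ.restr S B₀).a B i j = σ.a B i j ∧ (σ.restr S B₀).a B k j = σ.a B k j := fun j hj =>
        ⟨key _ _ (hne j hj).1, key _ _ (hne j hj).2⟩
    have := (hW hB.1).2 i hi k hk j₁ h₁ j₂ h₂ j₃ h₃ (fun i hi => by
      rw [← (e i hi).1, ← (e i hi).2]; exact hne i hi)
    simpa [e] using this

theorem sdiff_eq_sdiff_mono {B B₀ S S' : Set E} (hSS : S ⊆ S') (h : B \ S = B₀ \ S) :
    B \ S' = B₀ \ S' := by
  ext x
  have := Set.ext_iff.1 h x
  simp only [mem_sdiff] at this ⊢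
  have := @hSS x
  tauto

theorem Lift.restr (hu : IsCrossMap u) (h : Lift u (σ.restr S' B₀) τ) (hSS : S ⊆ S') :
    Lift u (σ.restr S B₀) (τ.restr S B₀) := by
  rintro B ⟨hB, hBS⟩
  have hB' : (σ.restr S' B₀).IsBase B := ⟨hB, sdiff_eq_sdiff_mono hSS hBS⟩
  refine ⟨⟨(h hB').1, hBS⟩, fun i hi j hj _ => ?_, fun i hi k hk j hj l hl _ _ => ?_⟩
  · by_cases hij : i ∈ S ∧ j ∈ S
    · rw [restr_a hij.1 hij.2, restr_a hij.1 hij.2, ← h.a_eq_zero_iff hB' hi hj,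
        restr_a (hSS hij.1) (hSS hij.2)]
    · rw [restr_a_eq_zero hij, restr_a_eq_zero hij]
      simp
  · by_cases hij : i ∈ S ∧ j ∈ S
    swap
    · exact crossAgree_of_eq_zero hu (by simp [restr_a_eq_zero hij]) (by simp [restr_a_eq_zero hij])
    by_cases hkl : k ∈ S ∧ l ∈ S
    swap
    · exact crossAgree_of_eq_zero hu (by simp [restr_a_eq_zero hkl]) (by simp [restr_a_eq_zero hkl])
    have := h.crossAgree hB' hi hk hj hl
    simpa only [CrossAgree, crossRatio, restr_a hij.1 hij.2, restr_a hkl.1 hkl.2,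
      restr_a hij.1 hkl.2, restr_a hkl.1 hij.2, restr_a (hSS hij.1) (hSS hij.2),
      restr_a (hSS hkl.1) (hSS hkl.2), restr_a (hSS hij.1) (hSS hkl.2),
      restr_a (hSS hkl.1) (hSS hij.2)] using this

theorem restr_graph_adj {v w : E} :
    ((σ.restr S B₀).graph B).Adj v w ↔ (σ.graph B).Adj v w ∧ v ∈ S ∧ w ∈ S := by
  have key : ∀ i j, (σ.restr S B₀).a B i j ≠ 0 ↔ σ.a B i j ≠ 0 ∧ i ∈ S ∧ j ∈ S := by
    intro i j
    by_cases hij : i ∈ S ∧ j ∈ S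
    · rw [restr_a hij.1 hij.2]; tauto
    · rw [restr_a_eq_zero hij]; tauto
  simp only [graph, key]
  tauto

/-- A lift of the restriction to `S`, normalized on the part of the forest inside `S`. -/
def IsNormLift (u : K → L) (σ : PivotSystem K E) (B₀ : Set E) (h : E → ℕ) (p : E → E) (S : Set E)
    (τ : PivotSystem L E) : Prop :=
  Lift u (σ.restr S B₀) τ ∧ τ.IsNormalized B₀ (S.indicator h) p

variable {h : E → ℕ} {p : E → E}

theorem exists_isNormLift (hu : IsCrossMap u) (hW : σ.WLUM) (hB₀ : σ.IsBase B₀)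
    (hF : IsSpanningForest (σ.graph B₀) h p) (S : Finset E) (hS : ∀ v ∈ S, h v ≠ 0 → p v ∈ S) :
    ∃ τ : PivotSystem L E, IsNormLift u σ B₀ h p S τ := by
  obtain ⟨τ, hτ⟩ := exists_lift_of_finite (L := L) hu (hW.restr S B₀) (B := B₀) (S := S) ⟨hB₀, rfl⟩
    fun v w h => (restr_graph_adj.1 h).2.1
  obtain ⟨t, ht, hN⟩ := hτ.exists_isNormalized (B := B₀) ⟨hB₀, rfl⟩ le_rfl
    (hF.indicator (S := S) hS fun v w => restr_graph_adj)
  exact ⟨_, hτ.scale t ht, hN⟩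

theorem IsNormLift.restr (hu : IsCrossMap u) (hτ : IsNormLift u σ B₀ h p S' τ) (hSS : S ⊆ S')
    (hS : ∀ v ∈ S, h v ≠ 0 → p v ∈ S) : IsNormLift u σ B₀ h p S (τ.restr S B₀) := by
  refine ⟨hτ.1.restr hu hSS, fun v hv => ?_⟩
  rw [Set.indicator_apply_ne_zero] at hv
  have hv' : S'.indicator h v ≠ 0 := Set.indicator_apply_ne_zero.2 ⟨hSS hv.1, hv.2⟩
  have hp := hS v hv.1 hv.2
  rw [restr_a hv.1 hp, restr_a hp hv.1]
  exact hτ.2 v hv'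

theorem IsNormLift.agree_of_subset (hu : IsCrossMap u) (hB₀ : σ.IsBase B₀)
    (hF : IsSpanningForest (σ.graph B₀) h p) (hτ : IsNormLift u σ B₀ h p S τ)
    (hτ' : IsNormLift u σ B₀ h p S' τ') (hSS : S ⊆ S') (hS : ∀ v ∈ S, h v ≠ 0 → p v ∈ S) {i j : E}
    (hi : i ∈ B₀) (hj : j ∉ B₀) (hiS : i ∈ S) (hjS : j ∈ S) : τ.a B₀ i j = τ'.a B₀ i j := by
  have h2 := hτ'.restr hu hSS hS
  rw [hτ.1.agree_of_isNormalized h2.1 ⟨hB₀, rfl⟩ (hF.indicator hS fun v w => restr_graph_adj)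
    hτ.2 h2.2 hi hj, restr_a hiS hjS]

/-- Every column finite system without large uniform minors lifts. -/
theorem exists_lift (hu : IsCrossMap u) (hW : σ.WLUM) (hB₀ : σ.IsBase B₀)
    (hfin : ∀ j ∉ B₀, {i | i ∈ B₀ ∧ σ.a B₀ i j ≠ 0}.Finite) :
    ∃ φ : E → (E →₀ L), (ofVectors L φ B₀).IsBase B₀ ∧ Lift u σ (ofVectors L φ B₀) := by
  classical
  obtain ⟨h, p, hF⟩ : ∃ h p, IsSpanningForest (σ.graph B₀) h p := by
    cases isEmpty_or_nonempty E with
    | inl hE => exact ⟨fun _ => 0, id, ⟨isEmptyElim, isEmptyElim, isEmptyElim, isEmptyElim⟩⟩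
    | inr hE =>
      obtain ⟨h, p, hF, -⟩ := exists_isSpanningForest (σ.graph B₀) hE.some
      exact ⟨h, p, hF⟩
  choose hull hsub hcl using fun i j : E => hF.exists_closed (T := {i, j}) (toFinite _)
  have : Nonempty (PivotSystem L E) := ⟨ofVectors L (fun _ => (0 : L)) B₀⟩
  choose! τ hτ using exists_isNormLift (L := L) hu hW hB₀ hF
  have hag : ∀ S : Finset E, (∀ v ∈ S, h v ≠ 0 → p v ∈ S) → ∀ i ∈ B₀, ∀ j ∉ B₀, i ∈ S → j ∈ S →
      (τ (hull i j)).a B₀ i j = (τ S).a B₀ i j := by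
    intro S hS i hi j hj hiS hjS
    have hc : ∀ v ∈ S ∪ hull i j, h v ≠ 0 → p v ∈ S ∪ hull i j := by
      intro v hv h0
      rw [Finset.mem_union] at hv ⊢
      exact hv.imp (hS v · h0) (hcl i j v · h0)
    have hij := insert_subset_iff.1 (hsub i j)
    rw [(hτ _ (hcl i j)).agree_of_subset hu hB₀ hF (hτ _ hc) (by simp) (hcl i j) hi hj hij.1
      (hij.2 rfl), (hτ S hS).agree_of_subset hu hB₀ hF (hτ _ hc) (by simp) hS hi hj hiS hjS]
  have hr : ∀ S : Finset E, (σ.restr S B₀).IsBase B₀ := fun S => ⟨hB₀, rfl⟩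
  have hA : ∀ i ∈ B₀, ∀ j ∉ B₀, (σ.a B₀ i j = 0 ↔ (τ (hull i j)).a B₀ i j = 0) := by
    intro i hi j hj
    have hij := insert_subset_iff.1 (hsub i j)
    rw [← (hτ _ (hcl i j)).1.a_eq_zero_iff (hr _) hi hj, restr_a hij.1 (hij.2 rfl)]
  obtain ⟨φ, hφB, hφ⟩ := exists_ofVectors B₀ (fun i j => (τ (hull i j)).a B₀ i j)
    fun j hj => (hfin j hj).subset fun i hi => ⟨hi.1, (hA i hi.1 j hj).not.2 hi.2⟩
  refine ⟨φ, hφB, ?_⟩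
  generalize ofVectors L φ B₀ = σ' at hφB hφ
  intro B hB
  have key : ∀ T : Set E, T.Finite → σ'.IsBase B ∧
      ∀ i ∈ B, ∀ k ∈ B, ∀ j ∉ B, ∀ l ∉ B, i ∈ T → k ∈ T → j ∈ T → l ∈ T →
        (σ.a B i j = 0 ↔ σ'.a B i j = 0) ∧ CrossAgree u (σ.a B) (σ'.a B) i k j l := by
    intro T hT
    obtain ⟨S, hTS, hS⟩ := hF.exists_closed (T := (B \ B₀ ∪ B₀ \ B) ∪ T)
      (((σ.finite_diff hB hB₀).union (σ.finite_diff hB₀ hB)).union hT)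
    have hBS : (σ.restr S B₀).IsBase B := by
      refine ⟨hB, ?_⟩
      ext x
      have := @hTS x
      simp only [mem_union, mem_sdiff] at this ⊢
      tauto
    obtain ⟨hL, -⟩ := hτ S hS
    obtain ⟨h1, h2⟩ := agree_of_agree (τ S) (σ'.restr S B₀) (hL (hr S)).1 ⟨hφB, rfl⟩
      (fun i hi j hj => by
        by_cases hij : i ∈ (S : Set E) ∧ j ∈ (S : Set E)
        · rw [restr_a hij.1 hij.2, hφ i hi j hj, hag S hS i hi j hj hij.1 hij.2]
        · rw [restr_a_eq_zero hij, ← hL.a_eq_zero_iff (hr S) hi hj, restr_a_eq_zero hij])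
      (hL hBS).1
    refine ⟨h1.1, fun i hi k hk j hj l hl hiT hkT hjT hlT => ?_⟩
    have hiS := hTS (Or.inr hiT)
    have hkS := hTS (Or.inr hkT)
    have hjS := hTS (Or.inr hjT)
    have hlS := hTS (Or.inr hlT)
    have h3 := hL.a_eq_zero_iff hBS hi hj
    have h4 := hL.crossAgree hBS hi hk hj hl
    rw [h2 i hi j hj, restr_a hiS hjS, restr_a hiS hjS] at h3
    refine ⟨h3, ?_⟩
    simpa only [CrossAgree, crossRatio, h2 _ hi _ hj, h2 _ hk _ hl, h2 _ hi _ hl, h2 _ hk _ hj,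
      restr_a hiS hjS, restr_a hkS hlS, restr_a hiS hlS, restr_a hkS hjS] using h4
  refine ⟨(key ∅ finite_empty).1, fun i hi j hj _ => ?_, fun i hi k hk j hj l hl _ _ => ?_⟩
  · exact ((key {i, j} (toFinite _)).2 i hi i hi j hj j hj (by simp) (by simp) (by simp)
      (by simp)).1
  · exact ((key {i, k, j, l} (toFinite _)).2 i hi k hk j hj l hl (by simp) (by simp) (by simp)
      (by simp)).2

end PivotSystem

namespace PivotSystem

section vectors

variable {K E V : Type*} [Field K] [AddCommGroup V] [Module K V] {φ : E → V} {B₀ : Set E}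

/-- A finite independent set extends to a base of the pivot system. -/
theorem exists_isBase_superset (hB₀ : (ofVectors K φ B₀).IsBase B₀) (I : Finset E)
    (hI : LinearIndepOn K φ (I : Set E)) : ∃ B, (ofVectors K φ B₀).IsBase B ∧ (I : Set E) ⊆ B := by
  classical
  induction I using Finset.induction_on with
  | empty => exact ⟨B₀, hB₀, by simp⟩
  | insert j I hj ih =>
    rw [Finset.coe_insert] at hI ⊢
    obtain ⟨B, hB, hIB⟩ := ih (hI.mono (subset_insert _ _))
    by_cases hjB : j ∈ B
    · exact ⟨B, hB, insert_subset hjB hIB⟩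
    obtain ⟨i, hi, hiI, hne⟩ : ∃ i ∈ B, i ∉ I ∧ coord (K := K) φ B j i ≠ 0 := by
      by_contra! hcon
      refine ((linearIndepOn_insert (Finset.mem_coe.not.2 hj)).1 hI).2
        ((Finsupp.mem_span_image_iff_linearCombination K).2
          ⟨coord φ B j, (Finsupp.mem_supported' K _).2 fun i hi => ?_, (hB.1.coord_spec j).2⟩)
      by_cases hiB : i ∈ B
      · exact hcon i hiB hi
      · exact hB.1.coord_apply j hiB
    exact ⟨exch B i j, (ofVectors K φ B₀).isBase_exch hB hi hjB hne,
      insert_subset_insert fun k hk => ⟨hIB hk, fun h => hiI (h ▸ hk)⟩⟩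

end vectors

section Lift

variable {K L E : Type*} [Field K] [Field L] {u : K → L}

theorem Lift.isBase_iff {σ : PivotSystem K E} {τ : PivotSystem L E} (h : Lift u σ τ) {B₀ : Set E}
    (hB₀ : σ.IsBase B₀) {B : Set E} : σ.IsBase B ↔ τ.IsBase B := by
  refine ⟨fun hB => (h hB).1, fun hB => ?_⟩
  refine τ.base_induction (h hB₀).1 (fun B => σ.IsBase B) hB₀ (fun B i j _ hB hi hj hne => ?_) hB
  exact σ.isBase_exch hB hi hj (mt (h.a_eq_zero_iff hB hi hj).1 hne)

variable {V W : Type*} [AddCommGroup V] [Module K V] [AddCommGroup W] [Module L W] {φ : E → V}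
  {ψ : E → W} {B₀ : Set E}

theorem Lift.linearIndepOn_iff (h : Lift u (ofVectors K φ B₀) (ofVectors L ψ B₀))
    (hB₀ : (ofVectors K φ B₀).IsBase B₀) (I : Set E) :
    LinearIndepOn K φ I ↔ LinearIndepOn L ψ I := by
  rw [linearIndepOn_iff_linearIndepOn_finset, linearIndepOn_iff_linearIndepOn_finset (R := L)]
  refine forall₂_congr fun t _ => ⟨fun ht => ?_, fun ht => ?_⟩
  · obtain ⟨B, hB, htB⟩ := exists_isBase_superset hB₀ t ht
    exact ((h.isBase_iff hB₀).1 hB).1.1.mono htB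
  · obtain ⟨B, hB, htB⟩ := exists_isBase_superset (h hB₀).1 t ht
    exact ((h.isBase_iff hB₀).2 hB).1.1.mono htB

end Lift

end PivotSystem

namespace Matroid

variable {α : Type*} {M : Matroid α}

theorem hasUniformMinor_of_isBase {B S : Set α} {r n : ℕ} (hB : M.IsBase B) (hS : S ⊆ M.E)
    (hSfin : S.Finite) (hn : S.ncard = n) (hr : (S ∩ B).ncard = r)
    (h : ∀ I ⊆ S, I.ncard = r → M.IsBase (I ∪ B \ S)) : Paper.HasUniformMinor M r n := by
  have hBS : M.Indep (B \ S) := hB.indep.subset sdiff_subset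
  have hE : (M.E \ (B \ S)) \ Sᶜ = S := by
    ext x
    have := @hS x
    simp only [mem_sdiff, mem_compl_iff]
    tauto
  refine ⟨M ／ (B \ S) ＼ Sᶜ, ⟨B \ S, Sᶜ, rfl⟩, ?_⟩
  have hN : (M ／ (B \ S) ＼ Sᶜ).E = S := by
    rw [delete_ground, contract_ground, hE]
  refine ⟨hN.symm ▸ hSfin, hN.symm ▸ hn, fun I hI => ?_⟩
  rw [hN] at hI
  have hdisj : Disjoint I (B \ S) := disjoint_sdiff_right.mono_left hI
  rw [delete_indep_iff, hBS.contract_indep_iff, and_iff_right hdisj,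
    and_iff_left (disjoint_compl_right.mono_left hI)]
  constructor
  · intro hind
    by_contra! hlt
    obtain ⟨I', hI', hcard⟩ := exists_subset_card_eq hlt.le
    have := (h I' (hI'.trans hI) hcard).eq_of_subset_indep hind (union_subset_union_left _ hI')
    have hII : I ⊆ I' := fun x hx => by
      have hx' : x ∈ I' ∪ B \ S := this ▸ Or.inl hx
      exact hx'.resolve_right (disjoint_left.1 hdisj hx)
    have := ncard_le_ncard hII ((hSfin.subset hI).subset hI')
    omega
  · intro hle
    obtain ⟨I', h1, h2, h3⟩ := exists_subsuperset_card_eq hI hle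
      (hr ▸ ncard_le_ncard inter_subset_left hSfin)
    exact (h I' h2 h3).indep.subset (union_subset_union_left _ h1)

variable {K : Type*} [Field K] {σ : PivotSystem K α} {B : Set α}

theorem hasUniformMinor_two_five (hσ : ∀ B, σ.IsBase B → M.IsBase B) (hB : σ.IsBase B) {i k : α}
    (hi : i ∈ B) (hk : k ∈ B) (hik : i ≠ k) {J : Set α} (hJ : ∀ j ∈ J, j ∉ B) (hJ3 : J.ncard = 3)
    (hne : ∀ j ∈ J, σ.a B i j ≠ 0 ∧ σ.a B k j ≠ 0)
    (hdet : ∀ p ∈ J, ∀ q ∈ J, p ≠ q → σ.a B i p * σ.a B k q ≠ σ.a B i q * σ.a B k p) :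
    Paper.HasUniformMinor M 2 5 := by
  have hJfin : J.Finite := finite_of_ncard_ne_zero (by omega)
  have hdisj : Disjoint {i, k} J := disjoint_left.2 fun x hx hxJ => hJ x hxJ (by
    rcases hx with rfl | rfl <;> assumption)
  have hi' := fun {p} hp => σ.isBase_exch hB hi (hJ p hp) (hne p hp).1
  have hk' := fun {p} hp => σ.isBase_exch hB hk (hJ p hp) (hne p hp).2
  refine hasUniformMinor_of_isBase (S := {i, k} ∪ J) (hσ _ hB)
    (union_subset (insert_subset ((hσ _ hB).subset_ground hi)
      (singleton_subset_iff.2 ((hσ _ hB).subset_ground hk)))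
      fun j hj => (hσ _ (hi' hj)).subset_ground mem_exch_self)
    ((toFinite _).union hJfin)
    (by rw [ncard_union_eq hdisj (toFinite _) hJfin, ncard_pair hik, hJ3]) ?_ ?_
  · rw [show ({i, k} ∪ J) ∩ B = {i, k} by grind, ncard_pair hik]
  · intro I hI hI2
    obtain ⟨p, q, hpq, rfl⟩ := ncard_eq_two.1 hI2
    have hp : (p = i ∨ p = k) ∨ p ∈ J := hI (mem_insert _ _)
    have hq : (q = i ∨ q = k) ∨ q ∈ J := hI (mem_insert_of_mem _ rfl)
    apply hσ
    by_cases hpJ : p ∈ J <;> by_cases hqJ : q ∈ J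
    · have h2 : σ.a (exch B i p) k q ≠ 0 := by
        rw [σ.a_other hB hi (hJ p hpJ) (hne p hpJ).1 hk hik.symm (hJ q hqJ) hpq.symm]
        have := hdet p hpJ q hqJ hpq
        have h0 := (hne p hpJ).1
        intro h
        field_simp at h
        exact this (by linear_combination h)
      convert σ.isBase_exch (hi' hpJ) (mem_exch_of_ne hk hik.symm)
        (notMem_exch (hJ q hqJ) hpq.symm) h2 using 1
      grind [exch]
    · rcases hq.resolve_right hqJ with rfl | rfl
      · convert hk' hpJ using 1
        grind [exch]
      · convert hi' hpJ using 1
        grind [exch]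
    · rcases hp.resolve_right hpJ with rfl | rfl
      · convert hk' hqJ using 1
        grind [exch]
      · convert hi' hqJ using 1
        grind [exch]
    · convert hB using 1
      grind

theorem hasUniformMinor_three_five (hσ : ∀ B, σ.IsBase B → M.IsBase B) (hB : σ.IsBase B) {j l : α}
    (hj : j ∉ B) (hl : l ∉ B) (hjl : j ≠ l) {R : Set α} (hR : R ⊆ B) (hR3 : R.ncard = 3)
    (hne : ∀ i ∈ R, σ.a B i j ≠ 0 ∧ σ.a B i l ≠ 0)
    (hdet : ∀ p ∈ R, ∀ q ∈ R, p ≠ q → σ.a B p j * σ.a B q l ≠ σ.a B p l * σ.a B q j) :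
    Paper.HasUniformMinor M 3 5 := by
  have hRfin : R.Finite := finite_of_ncard_ne_zero (by omega)
  have hdisj : Disjoint R {j, l} := disjoint_left.2 fun x hx hx' => by
    rcases hx' with rfl | rfl
    · exact hj (hR hx)
    · exact hl (hR hx)
  have hj' := fun {p} hp => σ.isBase_exch hB (hR hp) hj (hne p hp).1
  have hl' := fun {p} hp => σ.isBase_exch hB (hR hp) hl (hne p hp).2
  obtain ⟨r, hr⟩ : R.Nonempty := nonempty_of_ncard_ne_zero (by omega)
  have hcard : (R ∪ {j, l}).ncard = 5 := by
    rw [ncard_union_eq hdisj hRfin (toFinite _), ncard_pair hjl, hR3]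
  refine hasUniformMinor_of_isBase (S := R ∪ {j, l}) (hσ _ hB)
    (union_subset (hR.trans (hσ _ hB).subset_ground)
      (insert_subset ((hσ _ (hj' hr)).subset_ground mem_exch_self)
      (singleton_subset_iff.2 ((hσ _ (hl' hr)).subset_ground mem_exch_self))))
    (hRfin.union (toFinite _)) hcard ?_ ?_
  · rw [show (R ∪ {j, l}) ∩ B = R by grind, hR3]
  · intro I hI hI3
    have hc := ncard_sdiff_add_ncard_of_subset hI (hRfin.union (toFinite _))
    obtain ⟨p, q, hpq, hpqI⟩ := ncard_eq_two.1 (show ((R ∪ {j, l}) \ I).ncard = 2 by omega)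
    have hI' : I = (R ∪ {j, l}) \ {p, q} := by
      rw [← hpqI, sdiff_sdiff_cancel_left hI]
    have hp : p ∈ R ∨ p = j ∨ p = l := (hpqI ▸ mem_insert _ _ : p ∈ (R ∪ {j, l}) \ I).1
    have hq : q ∈ R ∨ q = j ∨ q = l :=
      (hpqI ▸ mem_insert_of_mem _ rfl : q ∈ (R ∪ {j, l}) \ I).1
    subst hI'
    clear hpqI hc hI hI3
    apply hσ
    by_cases hpR : p ∈ R <;> by_cases hqR : q ∈ R
    · have h2 : σ.a (exch B p j) q l ≠ 0 := by
        rw [σ.a_other hB (hR hpR) hj (hne p hpR).1 (hR hqR) hpq.symm hl hjl.symm]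
        have := hdet p hpR q hqR hpq
        have h0 := (hne p hpR).1
        intro h
        field_simp at h
        exact this (by linear_combination h)
      convert σ.isBase_exch (hj' hpR) (mem_exch_of_ne (hR hqR) hpq.symm)
        (notMem_exch hl hjl.symm) h2 using 1
      grind [exch]
    · rcases hq.resolve_left hqR with rfl | rfl
      · convert hl' hpR using 1
        grind [exch]
      · convert hj' hpR using 1
        grind [exch]
    · rcases hp.resolve_left hpR with rfl | rfl
      · convert hl' hqR using 1
        grind [exch]
      · convert hj' hqR using 1
        grind [exch]
    · convert hB using 1
      grind

theorem wlum (hM : Paper.NoLargeUniformMinors M) (hσ : ∀ B, σ.IsBase B → M.IsBase B) :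
    σ.WLUM := by
  intro B hB
  constructor
  · intro i₁ h₁ i₂ h₂ i₃ h₃ j hj l hl hne
    by_contra! hcon
    obtain ⟨h12, h13, h23⟩ := hcon
    have n12 : i₁ ≠ i₂ := by rintro rfl; exact h12 (mul_comm _ _)
    have n13 : i₁ ≠ i₃ := by rintro rfl; exact h13 (mul_comm _ _)
    have n23 : i₂ ≠ i₃ := by rintro rfl; exact h23 (mul_comm _ _)
    refine hM.2 (hasUniformMinor_three_five hσ hB hj hl (R := {i₁, i₂, i₃}) ?_ ?_
      (ncard_eq_three.2 ⟨i₁, i₂, i₃, n12, n13, n23, rfl⟩) (fun i hi => hne i hi) ?_)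
    · rintro rfl
      exact h12 rfl
    · rintro x (rfl | rfl | rfl) <;> assumption
    · rintro p (rfl | rfl | rfl) q (rfl | rfl | rfl) hpq h <;> grind
  · intro i hi k hk j₁ h₁ j₂ h₂ j₃ h₃ hne
    by_contra! hcon
    obtain ⟨h12, h13, h23⟩ := hcon
    have n12 : j₁ ≠ j₂ := by rintro rfl; exact h12 rfl
    have n13 : j₁ ≠ j₃ := by rintro rfl; exact h13 rfl
    have n23 : j₂ ≠ j₃ := by rintro rfl; exact h23 rfl
    refine hM.1 (hasUniformMinor_two_five hσ hB hi hk (J := {j₁, j₂, j₃}) ?_ ?_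
      (ncard_eq_three.2 ⟨j₁, j₂, j₃, n12, n13, n23, rfl⟩) (fun i hi => hne i hi) ?_)
    · rintro rfl
      exact h12 (mul_comm _ _)
    · rintro x (rfl | rfl | rfl) <;> assumption
    · rintro p (rfl | rfl | rfl) q (rfl | rfl | rfl) hpq h <;> grind

end Matroid

namespace Paper

open PivotSystem

/-- For matroids without large uniform minors, representations transfer along maps of fields
that preserve cross ratios. -/
theorem Representable.of_isCrossMap {α : Type u} {M : Matroid α} {K : Type v} {L : Type w}
    [Field K] [Field L] {f : K → L} (hf : IsCrossMap f) (hM : NoLargeUniformMinors M)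
    (hK : Representable M K) : Representable M L := by
  classical
  obtain ⟨V, _, _, φ₀, hφ₀⟩ := hK
  obtain ⟨φ, hφ⟩ : ∃ φ : α → V, ∀ I, M.Indep I ↔ LinearIndepOn K φ I := by
    refine ⟨fun e => if e ∈ M.E then φ₀ e else 0, fun I => ?_⟩
    by_cases hI : I ⊆ M.E
    · rw [hφ₀ I hI]
      exact linearIndepOn_congr fun e he => (if_pos (hI he)).symm
    · obtain ⟨e, he, heE⟩ := not_subset.1 hI
      exact iff_of_false (fun h => hI h.subset_ground) fun h => h.ne_zero he (if_neg heE)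
  have hbase : ∀ B, M.IsBase B ↔ IsVectorBase K φ B := by
    intro B
    rw [isBase_iff_maximal_indep, IsVectorBase, maximal_iff_forall_insert
      (fun s t hs hts => hs.subset hts), hφ]
    refine and_congr_right fun hB => ⟨fun h j => ?_, fun h j hj hind => ?_⟩
    · by_cases hj : j ∈ B
      · exact Submodule.subset_span (mem_image_of_mem φ hj)
      · by_contra hcon
        exact h j hj ((hφ _).2 ((linearIndepOn_insert hj).2 ⟨hB, hcon⟩))
    · exact ((linearIndepOn_insert hj).1 ((hφ _).1 hind)).2 (h j)
  obtain ⟨B₀, hB₀⟩ := M.exists_isBase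
  have hσB₀ : (ofVectors K φ B₀).IsBase B₀ := ⟨(hbase B₀).1 hB₀, by simp, by simp⟩
  obtain ⟨ψ, -, hψ⟩ :=
    exists_lift hf (wlum (σ := ofVectors K φ B₀) hM fun B hB => (hbase B).2 hB.1) hσB₀
    fun j _ => (coord (K := K) φ B₀ j).hasFiniteSupport.subset fun i hi => hi.2
  exact ⟨α →₀ L, inferInstance, inferInstance, ψ, fun I _ =>
    (hφ I).trans (hψ.linearIndepOn_iff hσB₀ I)⟩

end Paper

namespace PivotSystem

section sixForms

variable {K L : Type*} [Field K] [Field L]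

/-- The six forms of a cross ratio. -/
def crossForm (a : Fin 6) (x : K) : K :=
  (![x, 1 - x, x⁻¹, 1 - x⁻¹, (1 - x)⁻¹, 1 - (1 - x)⁻¹] : Fin 6 → K) a

theorem one_sub_crossForm (a : Fin 6) (x : K) :
    1 - crossForm a x = crossForm ((![1, 0, 3, 2, 5, 4] : Fin 6 → Fin 6) a) x := by
  fin_cases a <;> simp [crossForm]

theorem inv_one_sub_inv {x : K} (h0 : x ≠ 0) (h1 : x ≠ 1) :
    (1 - x⁻¹)⁻¹ = 1 - (1 - x)⁻¹ := by
  have h2 : 1 - x ≠ 0 := sub_ne_zero.2 h1.symm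
  have h3 : x - 1 ≠ 0 := sub_ne_zero.2 h1
  have h4 : 1 - x⁻¹ ≠ 0 := by
    rw [Ne, sub_eq_zero, eq_comm, inv_eq_one]
    exact h1
  refine inv_eq_of_mul_eq_one_right ?_
  field_simp
  ring

theorem inv_crossForm (a : Fin 6) {x : K} (h0 : x ≠ 0) (h1 : x ≠ 1) :
    (crossForm a x)⁻¹ = crossForm ((![2, 4, 0, 5, 1, 3] : Fin 6 → Fin 6) a) x := by
  have := inv_one_sub_inv h0 h1
  fin_cases a <;> simp [crossForm, this]
  rw [← this, inv_inv]

theorem range_crossForm_one_sub (x : K) :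
    range (fun a => crossForm a (1 - x)) = range fun a => crossForm a x := by
  have : ∀ a, crossForm a (1 - x) = crossForm ((![1, 0, 4, 5, 2, 3] : Fin 6 → Fin 6) a) x := by
    intro a
    fin_cases a <;> simp [crossForm]
  simp only [this]
  exact (show Function.Surjective (![1, 0, 4, 5, 2, 3] : Fin 6 → Fin 6) by decide).range_comp _

theorem range_crossForm_inv {x : K} (h0 : x ≠ 0) (h1 : x ≠ 1) :
    range (fun a => crossForm a x⁻¹) = range fun a => crossForm a x := by
  have h2 := inv_one_sub_inv h0 h1
  have : ∀ a, crossForm a x⁻¹ = crossForm ((![2, 3, 0, 1, 5, 4] : Fin 6 → Fin 6) a) x := by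
    intro a
    fin_cases a <;> simp [crossForm, h2]
  simp only [this]
  exact (show Function.Surjective (![2, 3, 0, 1, 5, 4] : Fin 6 → Fin 6) by decide).range_comp _

theorem one_sub_ne_zero_one {x : K} (h : x ≠ 0 ∧ x ≠ 1) : 1 - x ≠ 0 ∧ 1 - x ≠ 1 :=
  ⟨sub_ne_zero.2 h.2.symm, by simpa using h.1⟩

theorem inv_ne_zero_one {x : K} (h : x ≠ 0 ∧ x ≠ 1) : x⁻¹ ≠ 0 ∧ x⁻¹ ≠ 1 := by simpa using h

theorem crossForm_ne_zero_one {x : K} (h : x ≠ 0 ∧ x ≠ 1) (a : Fin 6) :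
    crossForm a x ≠ 0 ∧ crossForm a x ≠ 1 := by
  have h1 := one_sub_ne_zero_one h
  have h2 := inv_ne_zero_one h
  have h3 := inv_ne_zero_one h1
  have h4 := one_sub_ne_zero_one h2
  have h5 := one_sub_ne_zero_one h3
  fin_cases a <;> assumption

theorem range_crossForm_crossForm {x : K} (h : x ≠ 0 ∧ x ≠ 1) (a : Fin 6) :
    range (fun b => crossForm b (crossForm a x)) = range fun b => crossForm b x := by
  have h1 := one_sub_ne_zero_one h
  have h2 := inv_ne_zero_one h
  have h3 := inv_ne_zero_one h1
  fin_cases a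
  · rfl
  · exact range_crossForm_one_sub x
  · exact range_crossForm_inv h.1 h.2
  · exact (range_crossForm_one_sub x⁻¹).trans (range_crossForm_inv h.1 h.2)
  · exact (range_crossForm_inv h1.1 h1.2).trans (range_crossForm_one_sub x)
  · exact (range_crossForm_one_sub (1 - x)⁻¹).trans
      ((range_crossForm_inv h1.1 h1.2).trans (range_crossForm_one_sub x))

theorem crossForm_eq_of_eq {x : K} {y : L} (hx : x ≠ 0 ∧ x ≠ 1) (hy : y ≠ 0 ∧ y ≠ 1)
    (h1 : 2 * x = 1 → 2 * y = 1) (h2 : x = -1 → y = -1) (h3 : x = 2 → y = 2)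
    (h4 : x ^ 2 - x + 1 = 0 → y ^ 2 - y + 1 = 0) {a b : Fin 6} (h : crossForm a x = crossForm b x) :
    crossForm a y = crossForm b y := by
  obtain ⟨hx0, hx1⟩ := hx
  obtain ⟨hy0, hy1⟩ := hy
  have hx1' : 1 - x ≠ 0 := sub_ne_zero.2 hx1.symm
  have hy1' : 1 - y ≠ 0 := sub_ne_zero.2 hy1.symm
  fin_cases a <;> fin_cases b <;> simp [crossForm] at h ⊢ <;> grind

theorem exists_compatible (h2 : (2 : L) = 0 → (2 : K) = 0) (h3 : (3 : K) = 0 → (3 : L) = 0)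
    (hroot : (∃ x : K, x ^ 2 - x + 1 = 0) → ∃ y : L, y ^ 2 - y + 1 = 0)
    (hne : (∃ x : K, x ≠ 0 ∧ x ≠ 1) → ∃ y : L, y ≠ 0 ∧ y ≠ 1) {x : K} (hx : x ≠ 0 ∧ x ≠ 1) :
    ∃ y : L, (y ≠ 0 ∧ y ≠ 1) ∧
      ∀ a b : Fin 6, crossForm a x = crossForm b x → crossForm a y = crossForm b y := by
  have key : ∃ y : L, (y ≠ 0 ∧ y ≠ 1) ∧ (2 * x = 1 → 2 * y = 1) ∧ (x = -1 → y = -1) ∧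
      (x = 2 → y = 2) ∧ (x ^ 2 - x + 1 = 0 → y ^ 2 - y + 1 = 0) := by
    obtain ⟨hx0, hx1⟩ := hx
    by_cases hx2 : x = -1
    · have : (2 : L) ≠ 0 := fun h => hx1 (by linear_combination hx2 - h2 h)
      exact ⟨-1, by grind, by grind, by grind, by grind, by grind⟩
    by_cases hx3 : x = 2
    · have : (2 : L) ≠ 0 := fun h => hx0 (hx3.trans (h2 h))
      exact ⟨2, by grind, by grind, by grind, by grind, by grind⟩
    by_cases hx4 : 2 * x = 1
    · have : (2 : L) ≠ 0 := fun h => by simp [h2 h] at hx4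
      exact ⟨2⁻¹, by grind, by grind, by grind, by grind, by grind⟩
    by_cases hx5 : x ^ 2 - x + 1 = 0
    · obtain ⟨y, hy⟩ := hroot ⟨x, hx5⟩
      exact ⟨y, by grind, by grind, by grind, by grind, fun _ => hy⟩
    · obtain ⟨y, hy⟩ := hne ⟨x, hx0, hx1⟩
      exact ⟨y, hy, by grind, by grind, by grind, by grind⟩
  obtain ⟨y, hy, k1, k2, k3, k4⟩ := key
  exact ⟨y, hy, fun a b => crossForm_eq_of_eq hx hy k1 k2 k3 k4⟩

theorem exists_isCrossMap (h2' : (2 : K) = 0 → (2 : L) = 0) (h2 : (2 : L) = 0 → (2 : K) = 0)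
    (h3 : (3 : K) = 0 → (3 : L) = 0)
    (hroot : (∃ x : K, x ^ 2 - x + 1 = 0) → ∃ y : L, y ^ 2 - y + 1 = 0)
    (hne : (∃ x : K, x ≠ 0 ∧ x ≠ 1) → ∃ y : L, y ≠ 0 ∧ y ≠ 1) :
    ∃ u : K → L, IsCrossMap u := by
  classical
  have hrep : ∀ O : Set K, ∃ r, O.Nonempty → r ∈ O := fun O => by
    by_cases hO : O.Nonempty
    · exact ⟨hO.some, fun _ => hO.some_mem⟩
    · exact ⟨0, fun h => absurd h hO⟩
  choose rep hrep using hrep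
  let r : K → K := fun x => rep (range fun a => crossForm a x)
  have hr : ∀ x, x ≠ 0 ∧ x ≠ 1 → (r x ≠ 0 ∧ r x ≠ 1) ∧ ∃ a, crossForm a (r x) = x := by
    intro x hx
    obtain ⟨a, ha⟩ := hrep (range fun a => crossForm a x) (range_nonempty _)
    have ha' : crossForm a x = r x := ha
    rw [← ha']
    refine ⟨crossForm_ne_zero_one hx a, ?_⟩
    have : x ∈ range fun a => crossForm a x := ⟨0, rfl⟩
    rwa [← range_crossForm_crossForm hx a] at this
  choose! y hy hcompat using fun (x : K) (hx : x ≠ 0 ∧ x ≠ 1) =>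
    exists_compatible h2 h3 hroot hne hx
  choose! a ha using fun (x : K) (hx : x ≠ 0 ∧ x ≠ 1) => (hr x hx).2
  have hr1 : ∀ x, r (1 - x) = r x := fun x => congrArg rep (range_crossForm_one_sub x)
  have hr2 : ∀ x, x ≠ 0 ∧ x ≠ 1 → r x⁻¹ = r x := fun x hx =>
    congrArg rep (range_crossForm_inv hx.1 hx.2)
  let u : K → L := fun x => if x = 0 then 0 else if x = 1 then 1 else crossForm (a x) (y (r x))
  have hu0 : u 0 = 0 := if_pos rfl
  have hu1 : u 1 = 1 := by simp [u]
  have hu : ∀ x, x ≠ 0 ∧ x ≠ 1 → u x = crossForm (a x) (y (r x)) := fun x hx => by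
    simp only [u, if_neg hx.1, if_neg hx.2]
  refine ⟨u, hu0, fun {x} hx => ?_, fun x => ?_, fun x => ?_, h2'⟩
  · by_contra h0
    by_cases h1 : x = 1
    · rw [h1, hu1] at hx
      exact one_ne_zero hx
    · rw [hu x ⟨h0, h1⟩] at hx
      exact (crossForm_ne_zero_one (hy _ (hr x ⟨h0, h1⟩).1) _).1 hx
  · by_cases h0 : x = 0
    · simp [h0, hu0, hu1]
    by_cases h1 : x = 1
    · simp [h1, hu0, hu1]
    have hx := one_sub_ne_zero_one ⟨h0, h1⟩
    rw [hu x ⟨h0, h1⟩, hu _ hx, hr1, one_sub_crossForm]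
    refine hcompat _ (hr x ⟨h0, h1⟩).1 _ _ ?_
    have := ha _ hx
    rw [hr1] at this
    rw [this, ← one_sub_crossForm, ha x ⟨h0, h1⟩]
  · by_cases h0 : x = 0
    · simp [h0, hu0]
    by_cases h1 : x = 1
    · simp [h1, hu1]
    have hx := inv_ne_zero_one ⟨h0, h1⟩
    have hrx := hr x ⟨h0, h1⟩
    have hyx := hy _ hrx.1
    rw [hu x ⟨h0, h1⟩, hu _ hx, hr2 x ⟨h0, h1⟩, inv_crossForm _ hyx.1 hyx.2]
    refine hcompat _ hrx.1 _ _ ?_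
    have := ha _ hx
    rw [hr2 x ⟨h0, h1⟩] at this
    rw [this, ← inv_crossForm _ hrx.1.1 hrx.1.2, ha x ⟨h0, h1⟩]

end sixForms

section galoisField

/-- Every field has the same invariants as a finite field with at most eight elements. -/
theorem exists_galoisField (K : Type*) [Field K] : ∃ (p n : ℕ) (_ : Fact p.Prime), n ≠ 0 ∧
    p ^ n ≤ 8 ∧ ((2 : K) = 0 ↔ (2 : GaloisField p n) = 0) ∧
    ((3 : K) = 0 ↔ (3 : GaloisField p n) = 0) ∧
    ((∃ x : K, x ^ 2 - x + 1 = 0) ↔ ∃ x : GaloisField p n, x ^ 2 - x + 1 = 0) ∧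
    ((∃ x : K, x ≠ 0 ∧ x ≠ 1) ↔ ∃ x : GaloisField p n, x ≠ 0 ∧ x ≠ 1) := by
  have hcast (p n m : ℕ) [Fact p.Prime] : ((m : ℕ) : GaloisField p n) = 0 ↔ p ∣ m :=
    CharP.cast_eq_zero_iff _ p m
  have hpow (p n : ℕ) [Fact p.Prime] (hn : n ≠ 0) (x : GaloisField p n) : x ^ p ^ n = x := by
    have := Fintype.ofFinite (GaloisField p n)
    rw [← GaloisField.card p n hn, Nat.card_eq_fintype_card, FiniteField.pow_card]
  have hex (p n : ℕ) [Fact p.Prime] (hn : n ≠ 0) (h : 2 < p ^ n) :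
      ∃ x : GaloisField p n, x ≠ 0 ∧ x ≠ 1 := by
    classical
    have := Fintype.ofFinite (GaloisField p n)
    by_contra! hcon
    have h1 : (Finset.univ : Finset (GaloisField p n)) ⊆ {0, 1} := fun x _ => by
      have := hcon x
      simp only [Finset.mem_insert, Finset.mem_singleton]
      tauto
    have h2 := (Finset.card_le_card h1).trans Finset.card_le_two
    rw [Finset.card_univ, ← Nat.card_eq_fintype_card, GaloisField.card p n hn] at h2
    omega
  have : Fact (Nat.Prime 5) := ⟨by norm_num⟩
  have : Fact (Nat.Prime 7) := ⟨by norm_num⟩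
  have hchar (p n : ℕ) [Fact p.Prime] : ((p : ℕ) : GaloisField p n) = 0 := (hcast p n p).2 dvd_rfl
  by_cases h2 : (2 : K) = 0
  · have h3 : (3 : K) ≠ 0 := fun h => one_ne_zero (α := K) (by linear_combination h - h2)
    have c2 (n : ℕ) : (2 : GaloisField 2 n) = 0 := by exact_mod_cast hchar 2 n
    have c3 (n : ℕ) : (3 : GaloisField 2 n) ≠ 0 := by
      have := (hcast 2 n 3).not.2 (by norm_num)
      exact_mod_cast this
    by_cases hne : ∃ x : K, x ≠ 0 ∧ x ≠ 1
    · by_cases hr : ∃ x : K, x ^ 2 - x + 1 = 0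
      · refine ⟨2, 2, inferInstance, by norm_num, by norm_num, iff_of_true h2 (c2 2),
          iff_of_false h3 (c3 2), iff_of_true hr ?_,
          iff_of_true hne (hex 2 2 (by norm_num) (by norm_num))⟩
        obtain ⟨x, h0, h1⟩ := hex 2 2 (by norm_num) (by norm_num)
        refine ⟨x, ?_⟩
        have hx := hpow 2 2 (by norm_num) x
        have h1' : x - 1 ≠ 0 := sub_ne_zero.2 h1
        refine (mul_eq_zero.1 (?_ : (x * (x - 1)) * (x ^ 2 - x + 1) = 0)).resolve_left
          (mul_ne_zero h0 h1')
        norm_num at hx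
        linear_combination hx + (-x ^ 3 + x ^ 2) * c2 2
      · refine ⟨2, 3, inferInstance, by norm_num, by norm_num, iff_of_true h2 (c2 3),
          iff_of_false h3 (c3 3), iff_of_false hr ?_,
          iff_of_true hne (hex 2 3 (by norm_num) (by norm_num))⟩
        rintro ⟨x, hx⟩
        have h8 := hpow 2 3 (by norm_num) x
        norm_num at h8
        grind
    · refine ⟨2, 1, inferInstance, by norm_num, by norm_num, iff_of_true h2 (c2 1),
        iff_of_false h3 (c3 1), iff_of_false ?_ ?_, iff_of_false hne ?_⟩
      · rintro ⟨x, hx⟩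
        exact hne ⟨x, by grind, by grind⟩
      · rintro ⟨x, hx⟩
        have := hpow 2 1 (by norm_num) x
        norm_num at this
        grind
      · rintro ⟨x, h0, h1⟩
        have := hpow 2 1 (by norm_num) x
        norm_num at this
        grind
  · have hne : ∃ x : K, x ≠ 0 ∧ x ≠ 1 := ⟨-1, by simp, fun h => h2 (by linear_combination -h)⟩
    by_cases h3 : (3 : K) = 0
    · have c2 : (2 : GaloisField 3 1) ≠ 0 := by
        have := (hcast 3 1 2).not.2 (by norm_num)
        exact_mod_cast this
      have c3 : (3 : GaloisField 3 1) = 0 := by exact_mod_cast hchar 3 1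
      exact ⟨3, 1, inferInstance, by norm_num, by norm_num, iff_of_false h2 c2, iff_of_true h3 c3,
        iff_of_true ⟨-1, by linear_combination h3⟩ ⟨-1, by linear_combination c3⟩,
        iff_of_true hne (hex 3 1 (by norm_num) (by norm_num))⟩
    by_cases hr : ∃ x : K, x ^ 2 - x + 1 = 0
    · have c2 : (2 : GaloisField 7 1) ≠ 0 := by
        have := (hcast 7 1 2).not.2 (by norm_num)
        exact_mod_cast this
      have c3 : (3 : GaloisField 7 1) ≠ 0 := by
        have := (hcast 7 1 3).not.2 (by norm_num)
        exact_mod_cast this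
      have c7 : (7 : GaloisField 7 1) = 0 := by exact_mod_cast hchar 7 1
      exact ⟨7, 1, inferInstance, by norm_num, by norm_num, iff_of_false h2 c2, iff_of_false h3 c3,
        iff_of_true hr ⟨3, by linear_combination c7⟩,
        iff_of_true hne (hex 7 1 (by norm_num) (by norm_num))⟩
    · have c2 : (2 : GaloisField 5 1) ≠ 0 := by
        have := (hcast 5 1 2).not.2 (by norm_num)
        exact_mod_cast this
      have c3 : (3 : GaloisField 5 1) ≠ 0 := by
        have := (hcast 5 1 3).not.2 (by norm_num)
        exact_mod_cast this
      have c5 : (5 : GaloisField 5 1) = 0 := by exact_mod_cast hchar 5 1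
      refine ⟨5, 1, inferInstance, by norm_num, by norm_num, iff_of_false h2 c2,
        iff_of_false h3 c3, iff_of_false hr ?_,
        iff_of_true hne (hex 5 1 (by norm_num) (by norm_num))⟩
      rintro ⟨x, hx⟩
      have := hpow 5 1 (by norm_num) x
      norm_num at this
      grind

end galoisField

end PivotSystem

namespace Paper

open PivotSystem

theorem representable_iff_of_invariants {α : Type u} {M : Matroid α}
    (hM : NoLargeUniformMinors M) {K : Type v} {L : Type w} [Field K] [Field L]
    (h2 : (2 : K) = 0 ↔ (2 : L) = 0) (h3 : (3 : K) = 0 ↔ (3 : L) = 0)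
    (hroot : (∃ x : K, x ^ 2 - x + 1 = 0) ↔ ∃ y : L, y ^ 2 - y + 1 = 0)
    (hne : (∃ x : K, x ≠ 0 ∧ x ≠ 1) ↔ ∃ y : L, y ≠ 0 ∧ y ≠ 1) :
    Representable M K ↔ Representable M L := by
  obtain ⟨f, hf⟩ := exists_isCrossMap h2.1 h2.2 h3.1 hroot.1 hne.1
  obtain ⟨g, hg⟩ := exists_isCrossMap h2.2 h2.1 h3.2 hroot.2 hne.2
  exact ⟨Representable.of_isCrossMap hf hM, Representable.of_isCrossMap hg hM⟩

end Paper

/-- Let `M` and `M'` be matroids without large uniform minors. If for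
every prime power `q ≤ 8` the matroid `M` is representable over `𝔽_q` exactly when `M'`
is representable over `𝔽_q`, then for every field `K` the matroid `M` is representable
over `K` exactly when `M'` is. -/
theorem representation_equivalence_determined_by_small_prime_powers
    {α : Type u} {β : Type v} (M : Matroid α) (M' : Matroid β)
    (hM : Paper.NoLargeUniformMinors M) (hM' : Paper.NoLargeUniformMinors M')
    (h : ∀ (p n : ℕ) [Fact p.Prime], n ≠ 0 → p ^ n ≤ 8 →
      (Paper.Representable M (GaloisField p n) ↔ Paper.Representable M' (GaloisField p n))) :
    ∀ (K : Type w) [Field K], (Paper.Representable M K ↔ Paper.Representable M' K) := by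
  intro K _
  obtain ⟨p, n, _, hn, hpn, h2, h3, hroot, hne⟩ := PivotSystem.exists_galoisField K
  exact (Paper.representable_iff_of_invariants hM h2 h3 hroot hne).trans
    ((h p n hn hpn).trans (Paper.representable_iff_of_invariants hM' h2 h3 hroot hne).symm)
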